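/- Let F be an algebraically closed field of characteristic 0. Any two maximal finite abelian subgroups of Aut(𝔢₈) each containing an element of order 6 are conjugate in Aut(𝔢₈); that is, up to conjugation Aut(𝔢₈) contains a unique maximal finite abelian subgroup with elements of order 6. -/

import Mathlib

open LieAlgebra

/-- The group of automorphisms of a Lie algebra, realized as the subgroup of the group
of linear automorphisms consisting of those preserving the bracket. -/
def lieAut (R L : Type*) [CommRing R] [LieRing L] [LieAlgebra R L] :
    Subgroup (L ≃ₗ[R] L) where
  carrier := {e | ∀ x y : L, e ⁅x, y⁆ = ⁅e x, e y⁆}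
  one_mem' := fun _ _ => rfl
  mul_mem' := by
    intro f g hf hg x y
    show f (g ⁅x, y⁆) = _
    rw [hg]
    exact hf _ _
  inv_mem' := by
    intro f hf x y
    apply f.injective
    show f (f.symm ⁅x, y⁆) = f ⁅f.symm x, f.symm y⁆
    rw [hf (f.symm x) (f.symm y), f.apply_symm_apply, f.apply_symm_apply, f.apply_symm_apply]

/-- The subalgebra of fixed points of an automorphism of a Lie algebra. -/
def fixedSubalgebra {R L : Type*} [CommRing R] [LieRing L] [LieAlgebra R L]
    (θ : lieAut R L) : LieSubalgebra R L where
  carrier := {x | (θ : L ≃ₗ[R] L) x = x}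
  add_mem' := by
    intro a b ha hb
    simp only [Set.mem_setOf_eq] at *
    rw [map_add, ha, hb]
  zero_mem' := map_zero _
  smul_mem' := by
    intro c a ha
    simp only [Set.mem_setOf_eq] at *
    rw [map_smul, ha]
  lie_mem' := by
    intro a b ha hb
    simp only [Set.mem_setOf_eq] at *
    rw [θ.2 a b, ha, hb]

/-- A maximal finite abelian subgroup: a finite abelian subgroup which is maximal among
all abelian subgroups. -/
def IsMaximalFiniteAbelian {G : Type*} [Group G] (Q : Subgroup G) : Prop :=
  Finite Q ∧ (∀ a b, a ∈ Q → b ∈ Q → a * b = b * a) ∧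
    ∀ Q' : Subgroup G, (∀ a b, a ∈ Q' → b ∈ Q' → a * b = b * a) → Q ≤ Q' → Q' = Q

/-- Two subgroups are conjugate. -/
def SubgroupIsConj {G : Type*} [Group G] (Q₁ Q₂ : Subgroup G) : Prop :=
  ∃ g : G, Q₂ = Q₁.map (MulAut.conj g).toMonoidHom

set_option linter.all false

namespace E8

/-- The root lattice. -/
abbrev V := Fin 8 → ℤ

/-- pairing of a lattice vector with the simple coroot `i`. -/
def ca (i : Fin 8) (l : V) : ℤ := ∑ j, CartanMatrix.E₈ i j * l j

/-- simple root -/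
abbrev al (i : Fin 8) : V := Pi.single i 1

lemma ca_add (i) (l m : V) : ca i (l + m) = ca i l + ca i m := by
  simp [ca, mul_add, Finset.sum_add_distrib]
lemma ca_neg (i) (l : V) : ca i (-l) = - ca i l := by
  simp [ca, Finset.sum_neg_distrib]
lemma ca_sub (i) (l m : V) : ca i (l - m) = ca i l - ca i m := by
  simp [sub_eq_add_neg, ca_add, ca_neg]
lemma ca_zero (i) : ca i 0 = 0 := by simp [ca]
lemma ca_smul (i) (n : ℤ) (l : V) : ca i (n • l) = n * ca i l := by
  simp only [ca, Pi.smul_apply, smul_eq_mul, Finset.mul_sum]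
  exact Finset.sum_congr rfl fun _ _ => by ring
lemma ca_al (i j) : ca i (al j) = CartanMatrix.E₈ i j := by
  simp [ca, Pi.single_apply]

lemma ca_inj {l m : V} (h : ∀ i, ca i l = ca i m) : l = m := by
  have h0 := h 0; have h1 := h 1; have h2 := h 2; have h3 := h 3
  have h4 := h 4; have h5 := h 5; have h6 := h 6; have h7 := h 7
  simp [ca, Fin.sum_univ_eight, CartanMatrix.E₈] at h0 h1 h2 h3 h4 h5 h6 h7
  funext i
  fin_cases i <;> simp <;> omega

/-- A system of Serre generators of type E8. -/
structure Gen (F L : Type*) [Field F] [LieRing L] [LieAlgebra F L] where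
  e : Fin 8 → L
  f : Fin 8 → L
  h : Fin 8 → L
  hh : ∀ i j, ⁅h i, h j⁆ = 0
  ef : ∀ i, ⁅e i, f i⁆ = h i
  ef' : ∀ i j, i ≠ j → ⁅e i, f j⁆ = 0
  he : ∀ i j, ⁅h i, e j⁆ = ((CartanMatrix.E₈ i j : ℤ) : F) • e j
  hf : ∀ i j, ⁅h i, f j⁆ = -((CartanMatrix.E₈ i j : ℤ) : F) • f j
  adE : ∀ i j, i ≠ j → ⁅e i, ⁅e i, e j⁆⁆ = 0
  adF : ∀ i j, i ≠ j → ⁅f i, ⁅f i, f j⁆⁆ = 0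
  gen : LieSubalgebra.lieSpan F L (Set.range e ∪ Set.range f) = ⊤

variable {F L : Type*} [Field F] [LieRing L] [LieAlgebra F L]

namespace Gen

/-- Chevalley swap. -/
def swap (G : Gen F L) : Gen F L where
  e := G.f
  f := G.e
  h := fun i => - G.h i
  hh i j := by simp [G.hh]
  ef i := by rw [← lie_skew, G.ef]
  ef' i j hij := by rw [← lie_skew, G.ef' _ _ hij.symm, neg_zero]
  he i j := by rw [neg_lie, G.hf]; simp
  hf i j := by rw [neg_lie, G.he]; simp
  adE := G.adF
  adF := G.adE
  gen := by rw [Set.union_comm]; exact G.gen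

/-- weight space -/
def W (G : Gen F L) (l : V) : Submodule F L :=
  ⨅ i, Module.End.eigenspace (ad F L (G.h i)) ((ca i l : ℤ) : F)

lemma mem_W {G : Gen F L} {l : V} {x : L} :
    x ∈ G.W l ↔ ∀ i, ⁅G.h i, x⁆ = ((ca i l : ℤ) : F) • x := by
  simp [W, Submodule.mem_iInf, Module.End.mem_eigenspace_iff]

lemma swap_W (G : Gen F L) (l : V) : G.swap.W l = G.W (-l) := by
  ext x
  simp only [mem_W, swap, neg_lie, ca_neg, Int.cast_neg, neg_smul]
  exact forall_congr' fun i => neg_eq_iff_eq_neg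

lemma lie_mem_W (G : Gen F L) {l m : V} {x y : L} (hx : x ∈ G.W l) (hy : y ∈ G.W m) :
    ⁅x, y⁆ ∈ G.W (l + m) := by
  rw [mem_W] at *
  intro i
  rw [leibniz_lie, hx, hy, ca_add, smul_lie, lie_smul, Int.cast_add, add_smul]

lemma e_mem (G : Gen F L) (i) : G.e i ∈ G.W (al i) := by
  rw [mem_W]; intro j; rw [G.he, ca_al]
lemma f_mem (G : Gen F L) (i) : G.f i ∈ G.W (-al i) := by
  rw [mem_W]; intro j; rw [G.hf, ca_neg, ca_al]; simp
lemma h_mem (G : Gen F L) (i) : G.h i ∈ G.W 0 := by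
  rw [mem_W]; intro j; rw [G.hh, ca_zero]; simp

lemma ad_h_comm (G : Gen F L) (i j) : Commute (ad F L (G.h i)) (ad F L (G.h j)) := by
  ext x
  simp only [Module.End.mul_apply, ad_apply]
  rw [leibniz_lie, G.hh, zero_lie, zero_add]

lemma W_indep [CharZero F] (G : Gen F L) : iSupIndep G.W := by
  have h1 := Module.End.independent_iInf_maxGenEigenspace_of_forall_mapsTo
    (fun i => ad F L (G.h i)) (fun i j φ => Module.End.mapsTo_maxGenEigenspace_of_comm
      (G.ad_h_comm j i) φ)
  have hinj : Function.Injective (fun (l : V) (i : Fin 8) => ((ca i l : ℤ) : F)) := by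
    intro l m hlm
    apply ca_inj
    intro i
    have := congrFun hlm i
    simp only [] at this
    exact_mod_cast this
  refine (h1.comp hinj).mono fun l => ?_
  exact iInf_mono fun i => Module.End.genEigenspace_le_maximal _ _ _

/-- nonneg vectors with at least two nonzero coordinates -/
def Two (l : V) : Prop := (∀ i, 0 ≤ l i) ∧ ∃ i j, i ≠ j ∧ 0 < l i ∧ 0 < l j

/-- auxiliary: monomials in the lowering elements -/
inductive MP (G : Gen F L) : L → Prop
  | base (i) : MP G (G.f i)
  | step (i) (x) : MP G x → MP G ⁅G.f i, x⁆

lemma MP_wt (G : Gen F L) {x : L} (hx : MP G x) :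
    x = 0 ∨ (∃ i, x = G.f i) ∨ ∃ l, Two l ∧ x ∈ G.W (-l) := by
  induction hx with
  | base i => exact Or.inr (Or.inl ⟨i, rfl⟩)
  | step i x hx ih =>
    rcases ih with rfl | ⟨j, rfl⟩ | ⟨l, hl, hx⟩
    · left; simp
    · by_cases hij : i = j
      · left; subst hij; simp
      · right; right
        refine ⟨al i + al j, ⟨?_, i, j, hij, ?_, ?_⟩, ?_⟩
        · intro k
          simp only [Pi.add_apply, Pi.single_apply]
          split_ifs <;> simp
        · simp [Pi.single_apply, hij]
        · simp [Pi.single_apply, Ne.symm hij]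
        · rw [neg_add]; exact G.lie_mem_W (G.f_mem i) (G.f_mem j)
    · right; right
      obtain ⟨h0, a, b, hab, ha, hb⟩ := hl
      have hp : ∀ k, 0 ≤ (al i : V) k := by
        intro k; simp only [Pi.single_apply]; split_ifs <;> simp
      refine ⟨al i + l, ⟨?_, a, b, hab, ?_, ?_⟩, ?_⟩
      · intro k; have := hp k; have := h0 k; simp only [Pi.add_apply]; omega
      · have := hp a; simp only [Pi.add_apply]; omega
      · have := hp b; simp only [Pi.add_apply]; omega
      · rw [neg_add]; exact G.lie_mem_W (G.f_mem i) hx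

/-- span of the coroots -/
def Hs (G : Gen F L) : Submodule F L := Submodule.span F (Set.range G.h)

def Ms (G : Gen F L) : Submodule F L := Submodule.span F {x | MP G x}

lemma swap_Hs (G : Gen F L) : G.swap.Hs = G.Hs := by
  apply le_antisymm
  · rw [Hs, Submodule.span_le]; rintro _ ⟨i, rfl⟩
    exact neg_mem (Submodule.subset_span ⟨i, rfl⟩)
  · rw [Hs, Submodule.span_le]; rintro _ ⟨i, rfl⟩
    rw [← neg_neg (G.h i)]
    exact neg_mem (Submodule.subset_span ⟨i, rfl⟩)

lemma h_W_Ms (G : Gen F L) {x} (hx : MP G x) (i) : ⁅G.h i, x⁆ ∈ G.Ms := by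
  rcases G.MP_wt hx with rfl | ⟨j, rfl⟩ | ⟨l, hl, h⟩
  · simp
  · rw [G.hf]; exact Submodule.smul_mem _ _ (Submodule.subset_span (MP.base j))
  · rw [mem_W.1 h]; exact Submodule.smul_mem _ _ (Submodule.subset_span hx)

lemma f_Hs (G : Gen F L) (i) {y} (hy : y ∈ G.Hs) : ⁅G.f i, y⁆ ∈ G.Ms := by
  induction hy using Submodule.span_induction with
  | mem y hy =>
    obtain ⟨j, rfl⟩ := hy
    rw [← lie_skew, G.hf, neg_smul, neg_neg]
    exact Submodule.smul_mem _ _ (Submodule.subset_span (MP.base i))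
  | zero => simp
  | add a b _ _ ha hb => rw [lie_add]; exact add_mem ha hb
  | smul c a _ ha => rw [lie_smul]; exact Submodule.smul_mem _ _ ha

lemma f_Ms (G : Gen F L) (i) {y} (hy : y ∈ G.Ms) : ⁅G.f i, y⁆ ∈ G.Ms := by
  induction hy using Submodule.span_induction with
  | mem y hy => exact Submodule.subset_span (MP.step i y hy)
  | zero => simp
  | add a b _ _ ha hb => rw [lie_add]; exact add_mem ha hb
  | smul c a _ ha => rw [lie_smul]; exact Submodule.smul_mem _ _ ha

lemma e_MP (G : Gen F L) (i) {y} (hy : MP G y) : ⁅G.e i, y⁆ ∈ G.Ms ⊔ G.Hs := by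
  induction hy with
  | base j =>
    by_cases hij : i = j
    · subst hij; rw [G.ef]
      exact Submodule.mem_sup_right (Submodule.subset_span ⟨i, rfl⟩)
    · rw [G.ef' _ _ hij]; simp
  | step j x hx ih =>
    rw [leibniz_lie]
    refine add_mem ?_ ?_
    · by_cases hij : i = j
      · subst hij; rw [G.ef]; exact Submodule.mem_sup_left (G.h_W_Ms hx i)
      · rw [G.ef' _ _ hij]; simp
    · obtain ⟨a, ha, b, hb, hab⟩ := Submodule.mem_sup.1 ih
      rw [← hab, lie_add]
      exact Submodule.mem_sup_left (add_mem (G.f_Ms j ha) (G.f_Hs j hb))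

lemma e_Ms (G : Gen F L) (i) {y} (hy : y ∈ G.Ms) : ⁅G.e i, y⁆ ∈ G.Ms ⊔ G.Hs := by
  induction hy using Submodule.span_induction with
  | mem y hy => exact G.e_MP i hy
  | zero => simp
  | add a b _ _ ha hb => rw [lie_add]; exact add_mem ha hb
  | smul c a _ ha => rw [lie_smul]; exact Submodule.smul_mem _ _ ha

lemma tri_f (G : Gen F L) (i) {y} (hy : y ∈ G.Ms ⊔ G.Hs ⊔ G.swap.Ms) :
    ⁅G.f i, y⁆ ∈ G.Ms ⊔ G.Hs ⊔ G.swap.Ms := by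
  obtain ⟨a', ha', b, hb, rfl⟩ := Submodule.mem_sup.1 hy
  obtain ⟨a, ha, c, hc, rfl⟩ := Submodule.mem_sup.1 ha'
  rw [lie_add, lie_add]
  refine add_mem (add_mem ?_ ?_) ?_
  · exact Submodule.mem_sup_left (Submodule.mem_sup_left (G.f_Ms i ha))
  · exact Submodule.mem_sup_left (Submodule.mem_sup_left (G.f_Hs i hc))
  · have := G.swap.e_Ms i hb
    rw [swap_Hs] at this
    obtain ⟨a, ha, c, hc, hac⟩ := Submodule.mem_sup.1 this
    change ⁅G.swap.e i, b⁆ ∈ _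
    rw [← hac]
    exact add_mem (Submodule.mem_sup_right ha) (Submodule.mem_sup_left (Submodule.mem_sup_right hc))

lemma tri_e (G : Gen F L) (i) {y} (hy : y ∈ G.Ms ⊔ G.Hs ⊔ G.swap.Ms) :
    ⁅G.e i, y⁆ ∈ G.Ms ⊔ G.Hs ⊔ G.swap.Ms := by
  have h1 : G.Ms ⊔ G.Hs ⊔ G.swap.Ms = G.swap.Ms ⊔ G.swap.Hs ⊔ G.swap.swap.Ms := by
    rw [swap_Hs]
    have : G.swap.swap.Ms = G.Ms := by
      have : G.swap.swap = G := by
        cases G; simp [swap]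
      rw [this]
    rw [this, sup_comm, sup_comm G.Ms, sup_assoc]
  rw [h1] at hy ⊢
  exact G.swap.tri_f i hy

lemma tri_top (G : Gen F L) : G.Ms ⊔ G.Hs ⊔ G.swap.Ms = ⊤ := by
  set T := G.Ms ⊔ G.Hs ⊔ G.swap.Ms with hT
  -- stabilizer subalgebra
  let S : LieSubalgebra F L :=
    { carrier := {x | ∀ y ∈ T, ⁅x, y⁆ ∈ T}
      add_mem' := fun {a b} ha hb y hy => by rw [add_lie]; exact add_mem (ha y hy) (hb y hy)
      zero_mem' := fun y _ => by simp
      smul_mem' := fun c a ha y hy => by rw [smul_lie]; exact T.smul_mem _ (ha y hy)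
      lie_mem' := fun {a b} ha hb y hy => by
        rw [lie_lie]; exact sub_mem (ha _ (hb y hy)) (hb _ (ha y hy)) }
  have hS : S = ⊤ := by
    rw [eq_top_iff, ← G.gen, LieSubalgebra.lieSpan_le]
    rintro x (⟨i, rfl⟩ | ⟨i, rfl⟩)
    · exact fun y hy => G.tri_e i hy
    · exact fun y hy => G.tri_f i hy
  have hS' : ∀ x, ∀ y ∈ T, ⁅x, y⁆ ∈ T := fun x => by
    have : x ∈ S := by rw [hS]; trivial
    exact this
  let T' : LieSubalgebra F L := { T with lie_mem' := fun {a b} ha hb => hS' a b hb }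
  have hT' : T' = ⊤ := by
    rw [eq_top_iff, ← G.gen, LieSubalgebra.lieSpan_le]
    rintro x (⟨i, rfl⟩ | ⟨i, rfl⟩)
    · exact Submodule.mem_sup_right (Submodule.subset_span (MP.base (G := G.swap) i))
    · exact Submodule.mem_sup_left (Submodule.mem_sup_left
        (Submodule.subset_span (MP.base (G := G) i)))
  rw [eq_top_iff]
  intro x _
  have : x ∈ T' := by rw [hT']; trivial
  exact this

/-- candidate weight spaces -/
def W' (G : Gen F L) (l : V) : Submodule F L :=
  ⨆ (s : Submodule F L) (_ : s = G.W l ∧ (Two l ∨ Two (-l)) ∨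
    (∃ i, (s = Submodule.span F {G.e i} ∧ l = al i) ∨ (s = Submodule.span F {G.f i} ∧ l = -al i))
    ∨ s = G.Hs ∧ l = 0), s

lemma Hs_le (G : Gen F L) : G.Hs ≤ G.W 0 := by
  rw [Hs, Submodule.span_le]; rintro _ ⟨i, rfl⟩; exact G.h_mem i

lemma W'_le (G : Gen F L) (l : V) : G.W' l ≤ G.W l := by
  refine iSup₂_le ?_
  rintro s (⟨rfl, -⟩ | ⟨i, ⟨rfl, rfl⟩ | ⟨rfl, rfl⟩⟩ | ⟨rfl, rfl⟩)
  · exact le_rfl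
  · rw [Submodule.span_singleton_le_iff_mem]; exact G.e_mem i
  · rw [Submodule.span_singleton_le_iff_mem]; exact G.f_mem i
  · exact G.Hs_le

lemma mem_W' (G : Gen F L) {l : V} (s : Submodule F L) (hs : s = G.W l ∧ (Two l ∨ Two (-l)) ∨
    (∃ i, (s = Submodule.span F {G.e i} ∧ l = al i) ∨ (s = Submodule.span F {G.f i} ∧ l = -al i))
    ∨ s = G.Hs ∧ l = 0) {x : L} (hx : x ∈ s) : x ∈ G.W' l := by
  have : s ≤ G.W' l := by
    rw [W']; exact le_iSup₂_of_le s hs le_rfl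
  exact this hx

lemma W'_top (G : Gen F L) : iSup G.W' = ⊤ := by
  rw [eq_top_iff, ← G.tri_top]
  refine sup_le (sup_le ?_ ?_) ?_
  · rw [Ms, Submodule.span_le]
    intro x hx
    rcases G.MP_wt hx with rfl | ⟨j, rfl⟩ | ⟨l, hl, h⟩
    · simp
    · refine Submodule.mem_iSup_of_mem (-al j) ?_
      exact G.mem_W' (Submodule.span F {G.f j}) (Or.inr (Or.inl ⟨j, Or.inr ⟨rfl, rfl⟩⟩))
        (Submodule.mem_span_singleton_self _)
    · refine Submodule.mem_iSup_of_mem (-l) ?_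
      exact G.mem_W' (G.W (-l)) (Or.inl ⟨rfl, Or.inr (by simpa using hl)⟩) h
  · refine le_iSup_of_le 0 ?_
    exact le_iSup₂_of_le G.Hs (Or.inr (Or.inr ⟨rfl, rfl⟩)) le_rfl
  · rw [Ms, Submodule.span_le]
    intro x hx
    rcases G.swap.MP_wt hx with rfl | ⟨j, rfl⟩ | ⟨l, hl, h⟩
    · simp
    · refine Submodule.mem_iSup_of_mem (al j) ?_
      exact G.mem_W' (Submodule.span F {G.e j}) (Or.inr (Or.inl ⟨j, Or.inl ⟨rfl, rfl⟩⟩))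
        (Submodule.mem_span_singleton_self _)
    · refine Submodule.mem_iSup_of_mem l ?_
      rw [swap_W, neg_neg] at h
      exact G.mem_W' (G.W l) (Or.inl ⟨rfl, Or.inl hl⟩) h

lemma W_eq [CharZero F] (G : Gen F L) : G.W' = G.W :=
  (G.W_indep.le_iff_eq_of_iSup_eq_top G.W'_top).1 (fun l => G.W'_le l)

lemma W_top [CharZero F] (G : Gen F L) : iSup G.W = ⊤ := by
  rw [← G.W_eq, G.W'_top]

lemma W_cases [CharZero F] (G : Gen F L) {l : V} (hl : G.W l ≠ ⊥) :
    Two l ∨ Two (-l) ∨ (∃ i, l = al i ∨ l = -al i) ∨ l = 0 := by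
  contrapose! hl
  rw [← G.W_eq, eq_bot_iff]
  refine iSup₂_le ?_
  rintro s (⟨rfl, h | h⟩ | ⟨i, ⟨rfl, h⟩ | ⟨rfl, h⟩⟩ | ⟨rfl, h⟩)
  · exact absurd h hl.1
  · exact absurd h hl.2.1
  · exact absurd h (hl.2.2.1 i).1
  · exact absurd h (hl.2.2.1 i).2
  · exact absurd h hl.2.2.2

lemma Two_not {l : V} (i : Fin 8) (c : ℤ) (h : Two l) : l ≠ c • al i := by
  rintro rfl
  obtain ⟨h0, a, b, hab, ha, hb⟩ := h
  simp only [Pi.smul_apply, Pi.single_apply, smul_eq_mul] at ha hb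
  split_ifs at ha hb with h1 h2
  · exact hab (h1.trans h2.symm)
  all_goals simp at ha hb

lemma al_ne_zero (i : Fin 8) : al i ≠ 0 := by
  intro h; simpa using congrFun h i

lemma W_zero [CharZero F] (G : Gen F L) : G.W 0 = G.Hs := by
  refine le_antisymm ?_ G.Hs_le
  rw [← G.W_eq]
  refine iSup₂_le ?_
  rintro s (⟨rfl, h | h⟩ | ⟨i, ⟨rfl, h⟩ | ⟨rfl, h⟩⟩ | ⟨rfl, h⟩)
  · exact absurd (by simp) (Two_not 0 0 h)
  · exact absurd (by simp) (Two_not 0 0 h)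
  · exact absurd h.symm (al_ne_zero i)
  · exact absurd h.symm (neg_ne_zero.2 (al_ne_zero i))
  · exact le_rfl

lemma W_al [CharZero F] (G : Gen F L) (j) : G.W (al j) = Submodule.span F {G.e j} := by
  refine le_antisymm ?_ (by rw [Submodule.span_singleton_le_iff_mem]; exact G.e_mem j)
  rw [← G.W_eq]
  refine iSup₂_le ?_
  rintro s (⟨rfl, h | h⟩ | ⟨i, ⟨rfl, h⟩ | ⟨rfl, h⟩⟩ | ⟨rfl, h⟩)
  · exact absurd (by simp) (Two_not j 1 h)
  · exact absurd (by simp) (Two_not j (-1) h)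
  · have : i = j := by
      by_contra hne
      have := congrFun h i
      simp [hne] at this
    rw [this]
  · exfalso
    have := congrFun h j
    simp only [Pi.single_apply, Pi.neg_apply, if_true] at this
    split_ifs at this <;> simp at this
  · exact absurd h (al_ne_zero j)

lemma W_sign [CharZero F] (G : Gen F L) {l : V} (hl : G.W l ≠ ⊥) :
    (∀ i, 0 ≤ l i) ∨ (∀ i, l i ≤ 0) := by
  rcases G.W_cases hl with h | h | ⟨i, rfl | rfl⟩ | rfl
  · exact Or.inl h.1
  · right; intro i; have := h.1 i; simp only [Pi.neg_apply] at this; omega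
  · left; intro k; simp only [Pi.single_apply]; split_ifs <;> simp
  · right; intro k; simp only [Pi.neg_apply, Pi.single_apply]; split_ifs <;> simp
  · left; simp

lemma W_mul [CharZero F] (G : Gen F L) {i : Fin 8} {c : ℤ} (hl : G.W (c • al i) ≠ ⊥) :
    c = 1 ∨ c = -1 ∨ c = 0 := by
  rcases G.W_cases hl with h | h | ⟨j, h | h⟩ | h
  · exact absurd rfl (Two_not i c h)
  · exact absurd (by rw [neg_smul]) (Two_not i (-c) h)
  · have := congrFun h j
    simp only [Pi.smul_apply, Pi.single_apply, smul_eq_mul, if_true] at this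
    split_ifs at this <;> omega
  · have := congrFun h j
    simp only [Pi.smul_apply, Pi.single_apply, smul_eq_mul, if_true, Pi.neg_apply] at this
    split_ifs at this <;> omega
  · have := congrFun h i
    simp at this; omega

end Gen
end E8

namespace E8

/-- the quadratic form -/
def q (l : V) : ℤ := ∑ i, l i * ca i l
/-- the bilinear form -/
def bl (l m : V) : ℤ := ∑ i, l i * ca i m

lemma q_eq (l : V) : q l = 2*(l 0^2+l 1^2+l 2^2+l 3^2+l 4^2+l 5^2+l 6^2+l 7^2
    - (l 0*l 2+l 1*l 3+l 2*l 3+l 3*l 4+l 4*l 5+l 5*l 6+l 6*l 7)) := by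
  simp [q, ca, Fin.sum_univ_eight, CartanMatrix.E₈]; ring

lemma bl_eq (l m : V) : bl l m = 2*(l 0*m 0+l 1*m 1+l 2*m 2+l 3*m 3+l 4*m 4+l 5*m 5+l 6*m 6+l 7*m 7)
    - (l 0*m 2+l 1*m 3+l 2*m 3+l 3*m 4+l 4*m 5+l 5*m 6+l 6*m 7)
    - (m 0*l 2+m 1*l 3+m 2*l 3+m 3*l 4+m 4*l 5+m 5*l 6+m 6*l 7) := by
  simp [bl, ca, Fin.sum_univ_eight, CartanMatrix.E₈]; ring

lemma q_bl (l : V) : q l = bl l l := rfl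
lemma bl_comm (l m : V) : bl l m = bl m l := by rw [bl_eq, bl_eq]; ring
lemma bl_add (l m n : V) : bl l (m + n) = bl l m + bl l n := by
  simp [bl, ca_add, mul_add, Finset.sum_add_distrib]
lemma bl_smul (c : ℤ) (l m : V) : bl l (c • m) = c * bl l m := by
  simp only [bl, ca_smul, Finset.mul_sum]; exact Finset.sum_congr rfl fun _ _ => by ring
lemma bl_neg (l m : V) : bl l (-m) = - bl l m := by
  simp [bl, ca_neg, Finset.sum_neg_distrib]
lemma bl_sub (l m n : V) : bl l (m - n) = bl l m - bl l n := by
  rw [sub_eq_add_neg, bl_add, bl_neg]; ring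
lemma add_bl (l m n : V) : bl (m + n) l = bl m l + bl n l := by
  rw [bl_comm, bl_add, bl_comm, bl_comm l n]
lemma smul_bl (c : ℤ) (l m : V) : bl (c • m) l = c * bl m l := by
  rw [bl_comm, bl_smul, bl_comm]
lemma neg_bl (l m : V) : bl (-m) l = - bl m l := by rw [bl_comm, bl_neg, bl_comm]
lemma sub_bl (l m n : V) : bl (m - n) l = bl m l - bl n l := by
  rw [sub_eq_add_neg, add_bl, neg_bl]; ring
lemma bl_al (i) (l : V) : bl (al i) l = ca i l := by
  simp [bl, Pi.single_apply]
lemma ca_al_self (i) : ca i (al i) = 2 := by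
  rw [ca_al]; fin_cases i <;> rfl
lemma q_neg (l : V) : q (-l) = q l := by rw [q_bl, q_bl, neg_bl, bl_neg]; ring

lemma q_sos (l : V) : 60 * q l = 30*(2*l 0-l 2)^2+10*(3*l 2-2*l 3)^2+30*(2*l 1-l 3)^2
    +2*(5*l 3-6*l 4)^2+3*(4*l 4-5*l 5)^2+5*(3*l 5-4*l 6)^2+10*(2*l 6-3*l 7)^2+30*l 7^2 := by
  rw [q_eq]; ring

lemma q_nonneg (l : V) : 0 ≤ q l := by
  have := q_sos l
  have : 0 ≤ 60 * q l := by rw [this]; positivity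
  omega

lemma q_eq_zero {l : V} (h : q l = 0) : l = 0 := by
  have h1 := q_sos l
  rw [h] at h1
  have n1 := sq_nonneg (2*l 0-l 2); have n2 := sq_nonneg (3*l 2-2*l 3)
  have n3 := sq_nonneg (2*l 1-l 3); have n4 := sq_nonneg (5*l 3-6*l 4)
  have n5 := sq_nonneg (4*l 4-5*l 5); have n6 := sq_nonneg (3*l 5-4*l 6)
  have n7 := sq_nonneg (2*l 6-3*l 7); have n8 := sq_nonneg (l 7)
  have e1 : (2*l 0-l 2)^2 = 0 := by linarith
  have e2 : (3*l 2-2*l 3)^2 = 0 := by linarith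
  have e3 : (2*l 1-l 3)^2 = 0 := by linarith
  have e4 : (5*l 3-6*l 4)^2 = 0 := by linarith
  have e5 : (4*l 4-5*l 5)^2 = 0 := by linarith
  have e6 : (3*l 5-4*l 6)^2 = 0 := by linarith
  have e7 : (2*l 6-3*l 7)^2 = 0 := by linarith
  have e8 : (l 7)^2 = 0 := by linarith
  simp only [pow_eq_zero_iff, ne_eq, OfNat.ofNat_ne_zero, not_false_eq_true] at *
  funext i
  fin_cases i <;> simp <;> omega

lemma q_ge_two {l : V} (h : l ≠ 0) : 2 ≤ q l := by
  have h1 := q_nonneg l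
  have h2 : q l ≠ 0 := fun h' => h (q_eq_zero h')
  have h3 := q_eq l
  omega

lemma q_mixed {l : V} {i j} (hi : 0 < l i) (hj : l j < 0) : 4 ≤ q l := by
  set p : V := fun k => max (l k) 0 with hp
  set n : V := fun k => max (-l k) 0 with hn
  have hl : l = p - n := by
    funext k; simp only [hp, hn, Pi.sub_apply]; rcases le_total 0 (l k) with h | h
    · rw [max_eq_left h, max_eq_right (by omega)]; omega
    · rw [max_eq_right h, max_eq_left (by omega)]; omega
  have hpn : ∀ k, p k * n k = 0 := by
    intro k; simp only [hp, hn]; rcases le_total 0 (l k) with h | h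
    · rw [max_eq_right (a := -l k) (by omega)]; omega
    · rw [max_eq_right h]; omega
  have p0 : ∀ k, 0 ≤ p k := fun k => le_max_right _ _
  have n0 : ∀ k, 0 ≤ n k := fun k => le_max_right _ _
  have h1 : 2 ≤ q p := q_ge_two (by
    intro h; have := congrFun h i; simp only [hp, Pi.zero_apply] at this
    have := le_max_left (l i) 0; omega)
  have h2 : 2 ≤ q n := q_ge_two (by
    intro h; have := congrFun h j; simp only [hn, Pi.zero_apply] at this
    have := le_max_left (-l j) 0; omega)
  have h3 : bl p n ≤ 0 := by
    have m := fun a b => mul_nonneg (p0 a) (n0 b)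
    have m' := fun a b => mul_nonneg (n0 a) (p0 b)
    rw [bl_eq]
    simp only [hpn]
    nlinarith [m 0 2, m 1 3, m 2 3, m 3 4, m 4 5, m 5 6, m 6 7,
      m' 0 2, m' 1 3, m' 2 3, m' 3 4, m' 4 5, m' 5 6, m' 6 7]
  rw [hl, q_bl, bl_sub, sub_bl, sub_bl, bl_comm n p, ← q_bl, ← q_bl]
  omega

/-- simple reflection -/
def sr (i : Fin 8) (l : V) : V := l - ca i l • al i

lemma sr_neg (i) (l : V) : sr i (-l) = - sr i l := by
  simp [sr, ca_neg, sub_eq_add_neg, add_comm]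
lemma ca_sr (i) (l : V) : ca i (sr i l) = - ca i l := by
  rw [sr, ca_sub, ca_smul, ca_al_self]; ring
lemma sr_sr (i) (l : V) : sr i (sr i l) = l := by
  rw [sr, ca_sr, sr]; simp
lemma q_sr (i) (l : V) : q (sr i l) = q l := by
  rw [q_bl, sr, bl_sub, sub_bl, sub_bl, bl_smul, smul_bl, smul_bl, bl_smul, bl_comm l (al i),
    bl_al, bl_al, ca_al_self, ← q_bl]; ring
lemma sr_apply_ne {i k : Fin 8} (h : k ≠ i) (l : V) : sr i l k = l k := by
  simp [sr, Pi.single_apply, h]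
lemma sr_apply_self (i : Fin 8) (l : V) : sr i l i = l i - ca i l := by
  simp [sr]

section sl2
variable {F L : Type*} [Field F] [LieRing L] [LieAlgebra F L] [CharZero F]

lemma sl2_hf {h e f : L} (t : IsSl2Triple h e f) {z : L} {μ : F} (hz : ⁅h, z⁆ = μ • z) (k : ℕ) :
    ⁅h, (ad F L f ^ k) z⁆ = (μ - 2 * k) • (ad F L f ^ k) z := by
  induction k with
  | zero => simp [hz]
  | succ k ih =>
    rw [pow_succ', Module.End.mul_apply, ad_apply, leibniz_lie, ih, t.lie_h_f_nsmul, neg_lie,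
      lie_smul, nsmul_lie, ← Nat.cast_smul_eq_nsmul F, ← neg_smul, ← add_smul]
    congr 1; push_cast; ring

lemma sl2_step {h e f : L} (t : IsSl2Triple h e f) {z : L} {μ : F} (hz : ⁅h, z⁆ = μ • z) (k : ℕ) :
    ∃ c : F, ⁅e, (ad F L f ^ (k + 1)) z⁆ = (ad F L f ^ (k+1)) ⁅e, z⁆ + c • (ad F L f ^ k) z := by
  induction k with
  | zero =>
    refine ⟨μ, ?_⟩
    simp only [zero_add, pow_one, ad_apply, pow_zero, Module.End.one_apply]
    rw [leibniz_lie, t.lie_e_f, hz, add_comm]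
  | succ k ih =>
    obtain ⟨c, hc⟩ := ih
    refine ⟨(μ - 2 * ((k+1 : ℕ) : F)) + c, ?_⟩
    rw [pow_succ' _ (k+1), Module.End.mul_apply, ad_apply, leibniz_lie, t.lie_e_f, sl2_hf t hz, hc,
      lie_add, lie_smul, Module.End.mul_apply, ad_apply]
    rw [pow_succ' (ad F L f) k]
    simp only [Module.End.mul_apply, ad_apply, add_smul]
    abel

lemma sl2_inj {h e f : L} (t : IsSl2Triple h e f) {x : L} {m : ℕ} (hx : ⁅h, x⁆ = (m : F) • x)
    (he : ∃ N, (ad F L e ^ N) x = 0) (hf : (ad F L f ^ m) x = 0) : x = 0 := by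
  by_contra hne
  classical
  have hwt : ∀ a, ⁅h, (ad F L e ^ a) x⁆ = ((m + 2 * a : ℕ) : F) • (ad F L e ^ a) x := by
    intro a
    have := sl2_hf (F := F) t.symm (z := x) (μ := -(m : F)) (by rw [neg_lie, hx, neg_smul]) a
    rw [neg_lie, neg_eq_iff_eq_neg, ← neg_smul] at this
    rw [this]; congr 1; push_cast; ring
  have key : ∀ a, (ad F L f ^ (m + a)) ((ad F L e ^ a) x) = 0 := by
    intro a
    induction a with
    | zero => simpa using hf
    | succ a ih =>
      obtain ⟨c, hc⟩ := sl2_step (F := F) t (hwt a) (m + a)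
      have h2 : (ad F L f ^ (m + a + 1)) ((ad F L e ^ a) x) = 0 := by
        rw [pow_succ', Module.End.mul_apply, ih, map_zero]
      rw [h2, ih, lie_zero, smul_zero, add_zero] at hc
      rw [← add_assoc, pow_succ' (ad F L e), Module.End.mul_apply, ad_apply]
      exact hc.symm
  have hN := Nat.find_spec he
  set N := Nat.find he with hNdef
  have hN0 : N ≠ 0 := by
    intro h0; rw [h0] at hN; exact hne (by simpa using hN)
  obtain ⟨n, hn⟩ := Nat.exists_eq_succ_of_ne_zero hN0
  have hy : (ad F L e ^ n) x ≠ 0 := Nat.find_min he (by omega)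
  have P : t.HasPrimitiveVectorWith ((ad F L e ^ n) x) (((m + 2 * n : ℕ) : F)) :=
    { ne_zero := hy
      lie_h := hwt n
      lie_e := by
        rw [hn, Nat.succ_eq_add_one, pow_succ'] at hN
        exact hN }
  exact P.pow_toEnd_f_ne_zero_of_eq_nat rfl (i := m + n) (by omega) (key n)
end sl2

namespace Gen
variable {F L : Type*} [Field F] [LieRing L] [LieAlgebra F L] [CharZero F]

lemma e_nilp (G : Gen F L) (i) (x : L) : ∃ n, (ad F L (G.e i) ^ n) x = 0 := by
  have : LieSubalgebra.engel F (G.e i) = ⊤ := by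
    rw [eq_top_iff, ← G.gen, LieSubalgebra.lieSpan_le]
    rintro x (⟨j, rfl⟩ | ⟨j, rfl⟩)
    · by_cases hij : i = j
      · subst hij; exact LieSubalgebra.self_mem_engel F _
      · rw [SetLike.mem_coe, LieSubalgebra.mem_engel_iff]
        exact ⟨2, by simp [pow_succ, Module.End.mul_apply, G.adE _ _ hij]⟩
    · rw [SetLike.mem_coe, LieSubalgebra.mem_engel_iff]
      by_cases hij : i = j
      · subst hij
        refine ⟨3, ?_⟩
        simp only [pow_succ, pow_zero, one_mul, Module.End.mul_apply, ad_apply]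
        rw [G.ef, ← lie_skew (G.e i) (G.h i), G.he]; simp
      · exact ⟨1, by simp [G.ef' _ _ hij]⟩
  rw [← LieSubalgebra.mem_engel_iff, this]; trivial

lemma h_zero_step (G : Gen F L) {i j} (hi : G.h i = 0) (hij : CartanMatrix.E₈ i j ≠ 0) :
    G.h j = 0 := by
  have h1 := G.he i j
  rw [hi, zero_lie] at h1
  have h2 : G.e j = 0 := by
    rcases smul_eq_zero.1 h1.symm with h | h
    · exact absurd (by exact_mod_cast h) hij
    · exact h
  rw [← G.ef, h2, zero_lie]

lemma h_ne [Nontrivial L] (G : Gen F L) (i) : G.h i ≠ 0 := by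
  intro hi
  have s := fun {i j} => G.h_zero_step (i := i) (j := j)
  have h3 : G.h 3 = 0 := by
    have u2 : G.h 2 = 0 → G.h 3 = 0 := fun h => s h (by decide)
    have u4 : G.h 4 = 0 → G.h 3 = 0 := fun h => s h (by decide)
    have u5 : G.h 5 = 0 → G.h 4 = 0 := fun h => s h (by decide)
    have u6 : G.h 6 = 0 → G.h 5 = 0 := fun h => s h (by decide)
    have u7 : G.h 7 = 0 → G.h 6 = 0 := fun h => s h (by decide)
    have u0 : G.h 0 = 0 → G.h 2 = 0 := fun h => s h (by decide)
    have u1 : G.h 1 = 0 → G.h 3 = 0 := fun h => s h (by decide)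
    fin_cases i <;> simp only [] at hi <;> tauto
  have h2 : G.h 2 = 0 := s h3 (by decide)
  have h1 : G.h 1 = 0 := s h3 (by decide)
  have h0 : G.h 0 = 0 := s h2 (by decide)
  have h4 : G.h 4 = 0 := s h3 (by decide)
  have h5 : G.h 5 = 0 := s h4 (by decide)
  have h6 : G.h 6 = 0 := s h5 (by decide)
  have h7 : G.h 7 = 0 := s h6 (by decide)
  have hall : ∀ j, G.h j = 0 := by intro j; fin_cases j <;> assumption
  have e0 : ∀ j, G.e j = 0 := by
    intro j
    have h1 := G.he j j
    rw [hall j, zero_lie] at h1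
    rcases smul_eq_zero.1 h1.symm with h | h
    · rw [← ca_al, ca_al_self] at h; simp at h
    · exact h
  have f0 : ∀ j, G.f j = 0 := by
    intro j
    have h1 := G.hf j j
    rw [hall j, zero_lie] at h1
    rcases smul_eq_zero.1 h1.symm with h | h
    · rw [← ca_al, ca_al_self] at h; simp at h
    · exact h
  have : (⊤ : LieSubalgebra F L) = ⊥ := by
    rw [eq_bot_iff, ← G.gen, LieSubalgebra.lieSpan_le]
    rintro x (⟨j, rfl⟩ | ⟨j, rfl⟩)
    · exact e0 j
    · exact f0 j
  obtain ⟨x, hx⟩ := exists_ne (0 : L)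
  have hx' : x ∈ (⊤ : LieSubalgebra F L) := trivial
  rw [this] at hx'
  exact hx hx'

lemma sl2 [Nontrivial L] (G : Gen F L) (i) : IsSl2Triple (G.h i) (G.e i) (G.f i) where
  h_ne_zero := G.h_ne i
  lie_e_f := G.ef i
  lie_h_e_nsmul := by
    rw [G.he, ← ca_al, ca_al_self, ← Nat.cast_smul_eq_nsmul F]; simp
  lie_h_f_nsmul := by
    rw [G.hf, ← ca_al, ca_al_self, ← Nat.cast_smul_eq_nsmul F]; simp

lemma ad_pow_mem (G : Gen F L) {l m : V} {x y : L} (hx : x ∈ G.W l) (hy : y ∈ G.W m) (n : ℕ) :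
    (ad F L x ^ n) y ∈ G.W (m + (n : ℤ) • l) := by
  induction n with
  | zero => simpa using hy
  | succ n ih =>
    rw [pow_succ', Module.End.mul_apply, ad_apply]
    have := G.lie_mem_W hx ih
    convert this using 1
    push_cast; rw [add_smul, one_smul]; abel_nf

/-- `(ad f_i)^m` is injective from weight `l` to weight `s_i l`. -/
lemma f_pow_inj [Nontrivial L] (G : Gen F L) {i} {l : V} {m : ℕ} (hm : ca i l = m) {x : L}
    (hx : x ∈ G.W l) (h0 : (ad F L (G.f i) ^ m) x = 0) : x = 0 := by
  refine sl2_inj (F := F) (m := m) (G.sl2 i) ?_ (G.e_nilp i x) h0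
  rw [mem_W.1 hx i, hm]; simp

lemma f_pow_mem (G : Gen F L) {i} {l : V} {m : ℕ} (hm : ca i l = m) {x : L}
    (hx : x ∈ G.W l) : (ad F L (G.f i) ^ m) x ∈ G.W (sr i l) := by
  have := G.ad_pow_mem (G.f_mem i) hx m
  convert this using 1
  rw [sr, hm]; simp [sub_eq_add_neg]

lemma rank_le [Nontrivial L] (G : Gen F L) {i} {l : V} (h : 0 ≤ ca i l) :
    Module.rank F (G.W l) ≤ Module.rank F (G.W (sr i l)) := by
  obtain ⟨m, hm⟩ := Int.eq_ofNat_of_zero_le h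
  refine LinearMap.rank_le_of_injective
    ((ad F L (G.f i) ^ m).restrict (p := G.W l) (q := G.W (sr i l))
      (fun x hx => G.f_pow_mem hm hx)) ?_
  rw [← LinearMap.ker_eq_bot, LinearMap.ker_eq_bot']
  rintro ⟨x, hx⟩ h0
  have : (ad F L (G.f i) ^ m) x = 0 := congrArg Subtype.val h0
  exact Subtype.ext (G.f_pow_inj hm hx this)

lemma rank_le' [Nontrivial L] (G : Gen F L) (i) (l : V) :
    Module.rank F (G.W l) ≤ Module.rank F (G.W (sr i l)) := by
  rcases le_total 0 (ca i l) with h | h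
  · exact G.rank_le h
  · have := G.swap.rank_le (i := i) (l := -l) (by rw [ca_neg]; omega)
    rwa [swap_W, swap_W, neg_neg, sr_neg, neg_neg] at this

lemma rank_sr [Nontrivial L] (G : Gen F L) (i) (l : V) :
    Module.rank F (G.W (sr i l)) = Module.rank F (G.W l) := by
  refine le_antisymm ?_ (G.rank_le' i l)
  have := G.rank_le' i (sr i l)
  rwa [sr_sr] at this

lemma e_ne [Nontrivial L] (G : Gen F L) (i) : G.e i ≠ 0 := (G.sl2 i).e_ne_zero

lemma exists_ca_pos {l : V} (h0 : ∀ i, 0 ≤ l i) (hl : l ≠ 0) : ∃ i, 0 < l i ∧ 0 < ca i l := by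
  by_contra! h
  have h2 := q_ge_two hl
  have : q l ≤ 0 := Finset.sum_nonpos fun i _ => by
    rcases (h0 i).eq_or_lt with h' | h'
    · simp [← h']
    · exact mul_nonpos_of_nonneg_of_nonpos (h0 i) (h i h')
  omega

lemma mult_or {l : V} (i) : (∃ c : ℤ, l = c • al i) ∨ ∃ j, j ≠ i ∧ l j ≠ 0 := by
  by_cases h : ∃ j, j ≠ i ∧ l j ≠ 0
  · exact Or.inr h
  · push Not at h
    left
    refine ⟨l i, ?_⟩
    funext k
    by_cases hk : k = i
    · subst hk; simp
    · simp [hk, h k hk]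

/-- induction principle for nonneg nonzero vectors -/
lemma pos_ind {P : V → Prop}
    (h1 : ∀ i (c : ℤ), 0 < c → P (c • al i))
    (h2 : ∀ i (l : V), 0 < ca i l → (∃ j, 0 < sr i l j) → (∃ j, sr i l j < 0) → P l)
    (h3 : ∀ i (l : V), 0 < ca i l → (∀ k, 0 ≤ sr i l k) → sr i l ≠ 0 → P (sr i l) → P l)
    (l : V) (h0 : ∀ i, 0 ≤ l i) (hl : l ≠ 0) : P l := by
  have key : ∀ n : ℕ, ∀ l : V, (∀ i, 0 ≤ l i) → l ≠ 0 → ∑ i, l i ≤ n → P l := by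
    intro n
    induction n with
    | zero =>
      intro l h0 hl hs
      exfalso
      apply hl
      have := (Finset.sum_eq_zero_iff_of_nonneg (fun i _ => h0 i)).1
        (le_antisymm (by simpa using hs) (Finset.sum_nonneg fun i _ => h0 i))
      funext i; exact this i (Finset.mem_univ _)
    | succ n ih =>
      intro l h0 hl hs
      obtain ⟨i, hli, hi⟩ := exists_ca_pos h0 hl
      rcases mult_or (l := l) i with ⟨c, rfl⟩ | ⟨j, hji, hj⟩
      · exact h1 i c (by simpa using hli)
      · have hj' : 0 < sr i l j := by
          rw [sr_apply_ne hji]; have := h0 j; omega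
        by_cases hneg : sr i l i < 0
        · exact h2 i l hi ⟨j, hj'⟩ ⟨i, hneg⟩
        · have hnn : ∀ k, 0 ≤ sr i l k := by
            intro k
            by_cases hk : k = i
            · subst hk; omega
            · rw [sr_apply_ne hk]; exact h0 k
          refine h3 i l hi hnn (fun h => by rw [h] at hj'; simp at hj') ?_
          refine ih _ hnn (fun h => by rw [h] at hj'; simp at hj') ?_
          have : ∑ k, sr i l k = ∑ k, l k - ca i l := by
            simp [sr, Finset.sum_sub_distrib, Pi.single_apply]
          push_cast at hs
          omega
  exact key (∑ i, l i).toNat l h0 hl (by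
    rw [Int.toNat_of_nonneg (Finset.sum_nonneg fun i _ => h0 i)])

lemma rank_pos [Nontrivial L] (G : Gen F L) (l : V) (h0 : ∀ i, 0 ≤ l i) (hl : l ≠ 0) :
    Module.rank F (G.W l) = if q l = 2 then 1 else 0 := by
  refine pos_ind (P := fun l => Module.rank F (G.W l) = if q l = 2 then 1 else 0)
    ?_ ?_ ?_ l h0 hl
  · intro i c hc
    have hq : q (c • al i) = c * (c * 2) := by
      rw [q_bl, smul_bl, bl_smul, bl_al, ca_al_self]
    by_cases h1 : c = 1
    · subst h1
      rw [hq, one_smul, W_al]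
      simp only [mul_one, one_mul, if_true]
      rw [rank_submodule_eq_one_iff]
      exact ⟨G.e i, Submodule.mem_span_singleton_self _, G.e_ne i, le_rfl⟩
    · have hb : G.W (c • al i) = ⊥ := by
        by_contra hb
        rcases G.W_mul hb with h | h | h <;> omega
      rw [hb, rank_bot, if_neg]
      have : 2 ≤ c := by omega
      rw [hq]; intro h; nlinarith
  · rintro i l hi ⟨j, hj⟩ ⟨k, hk⟩
    have h4 := q_mixed hj hk
    rw [q_sr] at h4
    have hb : G.W (sr i l) = ⊥ := by
      by_contra hb
      rcases G.W_sign hb with h | h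
      · have := h k; omega
      · have := h j; omega
    rw [← rank_sr, hb, rank_bot, if_neg (by omega)]
  · intro i l hi _ _ ih
    rw [rank_sr, q_sr] at ih
    exact ih

lemma rank_W [Nontrivial L] (G : Gen F L) (l : V) (hl : l ≠ 0) :
    Module.rank F (G.W l) = if q l = 2 then 1 else 0 := by
  by_cases h : ∀ i, 0 ≤ l i
  · exact G.rank_pos l h hl
  by_cases h' : ∀ i, l i ≤ 0
  · have := G.swap.rank_pos (-l) (fun i => by have := h' i; simp; exact this) (neg_ne_zero.2 hl)
    rwa [swap_W, neg_neg, q_neg] at this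
  push Not at h h'
  obtain ⟨i, hi⟩ := h
  obtain ⟨j, hj⟩ := h'
  have h4 := q_mixed hj hi
  have hb : G.W l = ⊥ := by
    by_contra hb
    rcases G.W_sign hb with h | h
    · have := h i; omega
    · have := h j; omega
  rw [hb, rank_bot, if_neg (by omega)]

lemma W_bot [Nontrivial L] (G : Gen F L) {l : V} (hl : l ≠ 0) (hq : q l ≠ 2) : G.W l = ⊥ := by
  have := G.rank_W l hl
  rw [if_neg hq] at this
  exact Submodule.rank_eq_zero.1 this

lemma W_root [Nontrivial L] (G : Gen F L) {l : V} (hq : q l = 2) :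
    ∃ v, v ≠ 0 ∧ G.W l = Submodule.span F {v} := by
  have hl : l ≠ 0 := by rintro rfl; simp [q] at hq
  have := G.rank_W l hl
  rw [if_pos hq, rank_submodule_eq_one_iff] at this
  obtain ⟨v, hv, h0, hle⟩ := this
  exact ⟨v, h0, le_antisymm hle (by rw [Submodule.span_singleton_le_iff_mem]; exact hv)⟩

end Gen
end E8

namespace E8

/-- decimal codes of the positive roots -/
def posN : List ℕ := [
1, 10, 100, 1000, 10000, 100000, 1000000, 10000000, 11, 110, 1100, 11000, 110000, 1010000,
10100000, 111, 1110, 11100, 111000, 1011000, 1110000, 10110000, 1111, 11110, 111100, 1011100,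
1111000, 10111000, 11110000, 11111, 111110, 1011110, 1111100, 1121000, 10111100, 11111000,
111111, 1011111, 1111110, 1121100, 10111110, 11111100, 11121000, 1111111, 1121110, 1122100,
10111111, 11111110, 11121100, 11221000, 1121111, 1122110, 11111111, 11121110, 11122100,
11221100, 1122111, 1122210, 11121111, 11122110, 11221110, 11222100, 1122211, 11122111,
11122210, 11221111, 11222110, 11232100, 1122221, 11122211, 11222111, 11222210, 11232110,
12232100, 11122221, 11222211, 11232111, 11232210, 12232110, 11222221, 11232211, 11233210,
12232111, 12232210, 11232221, 11233211, 12232211, 12233210, 11233221, 12232221, 12233211,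
12243210, 11233321, 12233221, 12243211, 12343210, 12233321, 12243221, 12343211, 22343210,
12243321, 12343221, 22343211, 12244321, 12343321, 22343221, 12344321, 22343321, 12354321,
22344321, 13354321, 22354321, 22454321, 23354321, 23454321, 23464321, 23465321, 23465421,
23465431, 23465432]

/-- decoding -/
def dec (n : ℕ) : V := fun i => ((n / 10 ^ (7 - (i : ℕ)) % 10 : ℕ) : ℤ)

lemma posN_closed : ∀ n ∈ posN, ∀ i : Fin 8, ca i (dec n) < 0 →
    ∃ m ∈ posN, ∀ k, dec m k = dec n k - ca i (dec n) * (if k = i then 1 else 0) := by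
  decide +kernel

lemma posN_simple : ∀ i : Fin 8, ∃ m ∈ posN, ∀ k, dec m k = if k = i then 1 else 0 := by
  decide +kernel

lemma posN_q : ∀ n ∈ posN, q (dec n) = 2 := by decide +kernel

lemma posN_nonneg (n : ℕ) (i) : 0 ≤ dec n i := by simp only [dec]; positivity

lemma exists_posN {l : V} (h0 : ∀ i, 0 ≤ l i) (hq : q l = 2) : ∃ n ∈ posN, dec n = l := by
  have hl : l ≠ 0 := by rintro rfl; simp [q] at hq
  revert hq
  refine Gen.pos_ind (P := fun l => q l = 2 → ∃ n ∈ posN, dec n = l) ?_ ?_ ?_ l h0 hl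
  · intro i c hc hq
    rw [q_bl, smul_bl, bl_smul, bl_al, ca_al_self] at hq
    have : c = 1 := by nlinarith
    subst this
    obtain ⟨m, hm, h⟩ := posN_simple i
    refine ⟨m, hm, ?_⟩
    funext k; rw [h k]; simp [Pi.single_apply]
  · rintro i l hi ⟨j, hj⟩ ⟨k, hk⟩ hq
    have := q_mixed hj hk
    rw [q_sr] at this; omega
  · intro i l hi h0 hne ih hq
    rw [q_sr] at ih
    obtain ⟨n, hn, hnl⟩ := ih hq
    obtain ⟨m, hm, h⟩ := posN_closed n hn i (by rw [hnl, ca_sr]; omega)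
    refine ⟨m, hm, ?_⟩
    funext k
    rw [h k, hnl]
    have h5 : sr i (sr i l) k = sr i l k - ca i (sr i l) * (if k = i then 1 else 0) := by
      conv_lhs => rw [sr]
      simp [Pi.single_apply]
    rw [sr_sr] at h5
    exact h5.symm

/-- list of all roots -/
def rootL : List V := posN.map dec ++ posN.map (fun n => - dec n)

lemma mem_rootL {l : V} : l ∈ rootL ↔ q l = 2 := by
  simp only [rootL, List.mem_append, List.mem_map]
  constructor
  · rintro (⟨n, hn, rfl⟩ | ⟨n, hn, rfl⟩)
    · exact posN_q n hn
    · rw [q_neg]; exact posN_q n hn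
  · intro hq
    by_cases h : ∀ i, 0 ≤ l i
    · exact Or.inl (exists_posN h hq)
    by_cases h' : ∀ i, l i ≤ 0
    · obtain ⟨n, hn, h⟩ := exists_posN (l := -l) (fun i => by simpa using h' i) (by rw [q_neg, hq])
      exact Or.inr ⟨n, hn, by rw [h, neg_neg]⟩
    push Not at h h'
    obtain ⟨i, hi⟩ := h
    obtain ⟨j, hj⟩ := h'
    have := q_mixed hj hi; omega

/-- finset of all roots -/
def rootF : Finset V := rootL.toFinset
lemma mem_rootF {l : V} : l ∈ rootF ↔ q l = 2 := by rw [rootF, List.mem_toFinset, mem_rootL]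

lemma inv_E8 {K : Type*} [CommRing K] {c : Fin 8 → K}
    (h : ∀ i, ∑ j, ((CartanMatrix.E₈ i j : ℤ) : K) * c j = 0) : c = 0 := by
  have h0 := h 0; have h1 := h 1; have h2 := h 2; have h3 := h 3
  have h4 := h 4; have h5 := h 5; have h6 := h 6; have h7 := h 7
  simp [Fin.sum_univ_eight, CartanMatrix.E₈] at h0 h1 h2 h3 h4 h5 h6 h7
  funext i
  fin_cases i <;> simp only [Pi.zero_apply] <;>
    [show c 0 = 0; show c 1 = 0; show c 2 = 0; show c 3 = 0; show c 4 = 0; show c 5 = 0; show c 6 = 0; show c 7 = 0]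
  · linear_combination 4 * h0 + 5 * h1 + 7 * h2 + 10 * h3 + 8 * h4 + 6 * h5 + 4 * h6 + 2 * h7
  · linear_combination 5 * h0 + 8 * h1 + 10 * h2 + 15 * h3 + 12 * h4 + 9 * h5 + 6 * h6 + 3 * h7
  · linear_combination 7 * h0 + 10 * h1 + 14 * h2 + 20 * h3 + 16 * h4 + 12 * h5 + 8 * h6 + 4 * h7
  · linear_combination 10 * h0 + 15 * h1 + 20 * h2 + 30 * h3 + 24 * h4 + 18 * h5 + 12 * h6 + 6 * h7
  · linear_combination 8 * h0 + 12 * h1 + 16 * h2 + 24 * h3 + 20 * h4 + 15 * h5 + 10 * h6 + 5 * h7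
  · linear_combination 6 * h0 + 9 * h1 + 12 * h2 + 18 * h3 + 15 * h4 + 12 * h5 + 8 * h6 + 4 * h7
  · linear_combination 4 * h0 + 6 * h1 + 8 * h2 + 12 * h3 + 10 * h4 + 8 * h5 + 6 * h6 + 3 * h7
  · linear_combination 2 * h0 + 3 * h1 + 4 * h2 + 6 * h3 + 5 * h4 + 4 * h5 + 3 * h6 + 2 * h7

lemma E8_symm (i j) : CartanMatrix.E₈ i j = CartanMatrix.E₈ j i := by
  fin_cases i <;> fin_cases j <;> rfl

namespace Gen
variable {F L : Type*} [Field F] [LieRing L] [LieAlgebra F L] [CharZero F] [Nontrivial L]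

lemma iSup_roots (G : Gen F L) : (insert 0 rootF).sup G.W = ⊤ := by
  rw [eq_top_iff, ← G.W_top]
  refine iSup_le fun l => ?_
  by_cases h : l ∈ insert 0 rootF
  · exact Finset.le_sup h
  · rw [Finset.mem_insert, mem_rootF, not_or] at h
    rw [G.W_bot h.1 h.2]; exact bot_le

lemma finDim (G : Gen F L) : FiniteDimensional F L := by
  have h1 : ∀ l ∈ insert 0 rootF, FiniteDimensional F (G.W l) := by
    intro l hl
    rw [Finset.mem_insert, mem_rootF] at hl
    rcases hl with rfl | hl
    · rw [W_zero, Hs]; exact FiniteDimensional.span_of_finite F (Set.finite_range _)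
    · obtain ⟨v, -, hv⟩ := G.W_root hl
      rw [hv]; infer_instance
  have : FiniteDimensional F ((insert 0 rootF).sup G.W : Submodule F L) := by
    have : ∀ s : Finset V, (∀ l ∈ s, FiniteDimensional F (G.W l)) →
        FiniteDimensional F (s.sup G.W : Submodule F L) := by
      intro s
      induction s using Finset.induction_on with
      | empty => intro _; rw [Finset.sup_empty]; infer_instance
      | insert a s ha ih =>
        intro h
        rw [Finset.sup_insert]
        have := h a (Finset.mem_insert_self _ _)
        have := ih fun l hl => h l (Finset.mem_insert_of_mem hl)
        infer_instance
    exact this _ h1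
  rw [iSup_roots] at this
  exact Module.finite_def.2 ((Submodule.fg_top _).1 (Module.finite_def.1 this) |> fun h => by simpa using h)

lemma h_coef (G : Gen F L) {c : Fin 8 → F} (hc : ∀ j, ⁅∑ i, c i • G.h i, G.e j⁆ = 0) : c = 0 := by
  apply inv_E8
  intro j
  have := hc j
  rw [sum_lie] at this
  simp only [smul_lie, G.he, smul_smul, ← Finset.sum_smul] at this
  rcases smul_eq_zero.1 this with h | h
  · rw [← h]; exact Finset.sum_congr rfl fun i _ => by rw [E8_symm]; ring
  · exact absurd h (G.e_ne j)

lemma h_li (G : Gen F L) : LinearIndependent F G.h := by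
  rw [Fintype.linearIndependent_iff]
  intro g hg i
  rw [G.h_coef (c := g) (fun j => by rw [hg, zero_lie])]; rfl

/-- the standard Cartan subalgebra -/
def H0 (G : Gen F L) : LieSubalgebra F L :=
  { G.Hs with
    lie_mem' := fun {a b} ha hb => by
      have : ⁅a, b⁆ = 0 := by
        induction ha, hb using Submodule.span_induction₂ with
        | mem_mem x y hx hy => obtain ⟨i, rfl⟩ := hx; obtain ⟨j, rfl⟩ := hy; exact G.hh i j
        | zero_left => simp
        | zero_right => simp
        | add_left a b c _ _ _ h1 h2 => rw [add_lie, h1, h2, add_zero]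
        | add_right a b c _ _ _ h1 h2 => rw [lie_add, h1, h2, add_zero]
        | smul_left r a b _ _ h => rw [smul_lie, h, smul_zero]
        | smul_right r a b _ _ h => rw [lie_smul, h, smul_zero]
      rw [this]; exact G.Hs.zero_mem }

lemma mem_H0 {G : Gen F L} {x} : x ∈ G.H0 ↔ x ∈ G.W 0 := by
  rw [W_zero]; rfl

lemma H0_comm (G : Gen F L) {a b : L} (ha : a ∈ G.H0) (hb : b ∈ G.H0) : ⁅a, b⁆ = 0 := by
  have hb' := mem_W.1 (mem_H0.1 hb)
  change a ∈ Submodule.span F (Set.range G.h) at ha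
  induction ha using Submodule.span_induction with
  | mem x hx => obtain ⟨i, rfl⟩ := hx; rw [hb' i, ca_zero]; simp
  | zero => simp
  | add a b _ _ h1 h2 => rw [add_lie, h1, h2, add_zero]
  | smul r a _ h => rw [smul_lie, h, smul_zero]

instance (G : Gen F L) : IsLieAbelian G.H0 := ⟨fun a b => Subtype.ext (G.H0_comm a.2 b.2)⟩

lemma e_mem_top (G : Gen F L) (I : LieIdeal F L) (i) (hi : G.e i ∈ I) : I = ⊤ := by
  have hh : ∀ j, G.e j ∈ I → G.h j ∈ I := fun j hj => by
    rw [← G.ef, ← lie_skew]; exact neg_mem (lie_mem_right F L I _ _ hj)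
  have hf : ∀ j, G.h j ∈ I → G.f j ∈ I := fun j hj => by
    have h1 : ⁅G.f j, G.h j⁆ ∈ I := lie_mem_right F L I _ _ hj
    rw [← lie_skew, G.hf, ← ca_al, ca_al_self] at h1
    have : G.f j = (2 : F)⁻¹ • (-(-((2 : ℤ) : F) • G.f j)) := by
      rw [neg_smul, neg_neg, smul_smul]; norm_num
    rw [this]; exact I.smul_mem _ h1
  have s : ∀ {i j}, G.e i ∈ I → CartanMatrix.E₈ i j ≠ 0 → G.e j ∈ I := fun {i j} h hij => by
    have h1 : ⁅G.e j, G.h i⁆ ∈ I := lie_mem_right F L I _ _ (hh i h)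
    rw [← lie_skew, G.he, ← neg_smul] at h1
    have h0 : -((CartanMatrix.E₈ i j : ℤ) : F) ≠ 0 := by
      rw [neg_ne_zero]; exact_mod_cast hij
    have h2 := I.smul_mem (-((CartanMatrix.E₈ i j : ℤ) : F))⁻¹ h1
    rwa [smul_smul, inv_mul_cancel₀ h0, one_smul] at h2
  have h3 : G.e 3 ∈ I := by
    have u2 : G.e 2 ∈ I → G.e 3 ∈ I := fun h => s h (by decide)
    have u4 : G.e 4 ∈ I → G.e 3 ∈ I := fun h => s h (by decide)
    have u5 : G.e 5 ∈ I → G.e 4 ∈ I := fun h => s h (by decide)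
    have u6 : G.e 6 ∈ I → G.e 5 ∈ I := fun h => s h (by decide)
    have u7 : G.e 7 ∈ I → G.e 6 ∈ I := fun h => s h (by decide)
    have u0 : G.e 0 ∈ I → G.e 2 ∈ I := fun h => s h (by decide)
    have u1 : G.e 1 ∈ I → G.e 3 ∈ I := fun h => s h (by decide)
    fin_cases i <;> simp only [] at hi <;> tauto
  have h2 : G.e 2 ∈ I := s h3 (by decide)
  have h1 : G.e 1 ∈ I := s h3 (by decide)
  have h0 : G.e 0 ∈ I := s h2 (by decide)
  have h4 : G.e 4 ∈ I := s h3 (by decide)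
  have h5 : G.e 5 ∈ I := s h4 (by decide)
  have h6 : G.e 6 ∈ I := s h5 (by decide)
  have h7 : G.e 7 ∈ I := s h6 (by decide)
  have hall : ∀ j, G.e j ∈ I := by intro j; fin_cases j <;> assumption
  have : LieSubalgebra.lieSpan F L (Set.range G.e ∪ Set.range G.f) ≤ (I : LieSubalgebra F L) := by
    rw [LieSubalgebra.lieSpan_le]
    rintro x (⟨j, rfl⟩ | ⟨j, rfl⟩)
    · exact hall j
    · exact hf j (hh j (hall j))
  rw [G.gen] at this
  rw [eq_top_iff]
  intro x _
  exact this (LieSubalgebra.mem_top x)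

lemma ad_pow_mem_ideal (I : LieIdeal F L) (y : L) {x : L} (hx : x ∈ I) (n : ℕ) :
    (ad F L y ^ n) x ∈ I := by
  induction n with
  | zero => simpa using hx
  | succ n ih => rw [pow_succ', Module.End.mul_apply]; exact lie_mem_right F L I _ _ ih

lemma ideal_pos (G : Gen F L) (I : LieIdeal F L) {l : V} (h0 : ∀ i, 0 ≤ l i) (hl : l ≠ 0)
    {x : L} (hx : x ∈ G.W l) (hx0 : x ≠ 0) (hxI : x ∈ I) : ∃ i, G.e i ∈ I := by
  revert hxI hx0 hx
  revert x
  suffices h : ∀ x, x ∈ G.W l → x ≠ 0 → x ∈ I → ∃ i, G.e i ∈ I from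
    fun {x} h1 h2 h3 => h x h1 h2 h3
  refine pos_ind (P := fun l => ∀ x, x ∈ G.W l → x ≠ 0 → x ∈ I → ∃ i, G.e i ∈ I) ?_ ?_ ?_ l h0 hl
  · intro i c hc x hx hx0 hxI
    have hb : G.W (c • al i) ≠ ⊥ := fun h => hx0 (by rw [h] at hx; exact hx)
    have : c = 1 := by rcases G.W_mul hb with h | h | h <;> omega
    rw [this, one_smul, W_al] at hx
    obtain ⟨a, rfl⟩ := Submodule.mem_span_singleton.1 hx
    refine ⟨i, ?_⟩
    have ha : a ≠ 0 := by rintro rfl; simp at hx0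
    have := I.smul_mem a⁻¹ hxI
    rwa [smul_smul, inv_mul_cancel₀ ha, one_smul] at this
  · rintro i l hi ⟨j, hj⟩ ⟨k, hk⟩ x hx hx0 hxI
    exfalso
    have h4 := q_mixed hj hk
    rw [q_sr] at h4
    have : l ≠ 0 := by rintro rfl; simp [q] at h4
    rw [G.W_bot this (by omega)] at hx
    exact hx0 hx
  · intro i l hi _ _ ih x hx hx0 hxI
    obtain ⟨m, hm⟩ := Int.eq_ofNat_of_zero_le hi.le
    exact ih _ (G.f_pow_mem hm hx) (fun h => hx0 (G.f_pow_inj hm hx h))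
      (ad_pow_mem_ideal I _ hxI m)

lemma e_of_f (G : Gen F L) (I : LieIdeal F L) {i} (hi : G.f i ∈ I) : G.e i ∈ I := by
  have hh : G.h i ∈ I := by rw [← G.ef]; exact lie_mem_right F L I _ _ hi
  have h1 : ⁅G.e i, G.h i⁆ ∈ I := lie_mem_right F L I _ _ hh
  rw [← lie_skew, G.he, ← ca_al, ca_al_self] at h1
  have : G.e i = (-2 : F)⁻¹ • (-(((2 : ℤ) : F) • G.e i)) := by
    rw [← neg_smul, smul_smul]; norm_num
  rw [this]; exact I.smul_mem _ h1

lemma ideal_wt (G : Gen F L) (I : LieIdeal F L) {l : V}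
    {x : L} (hx : x ∈ G.W l) (hx0 : x ≠ 0) (hxI : x ∈ I) : ∃ i, G.e i ∈ I := by
  have hb : G.W l ≠ ⊥ := fun h => hx0 (by rw [h] at hx; exact hx)
  by_cases hl : l = 0
  · subst hl
    rw [W_zero, Hs, Submodule.mem_span_range_iff_exists_fun] at hx
    obtain ⟨c, rfl⟩ := hx
    by_contra! hno
    apply hx0
    rw [G.h_coef (c := c) ?_]
    · simp
    intro j
    by_contra hne
    have hmem : ⁅G.e j, ∑ i, c i • G.h i⁆ ∈ I := lie_mem_right F L I _ _ hxI
    rw [← lie_skew] at hmem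
    have hmem := neg_mem hmem
    rw [neg_neg] at hmem
    have hw : ⁅∑ i, c i • G.h i, G.e j⁆ ∈ G.W (al j) := by
      have := G.lie_mem_W (l := 0) (m := al j) (x := ∑ i, c i • G.h i) (y := G.e j)
        (sum_mem fun i _ => Submodule.smul_mem _ _ (G.h_mem i)) (G.e_mem j)
      rwa [zero_add] at this
    obtain ⟨i, hi⟩ := G.ideal_pos I (l := al j) (fun k => by
      simp only [Pi.single_apply]; split_ifs <;> simp) (al_ne_zero j) hw hne hmem
    exact hno i hi
  · rcases G.W_sign hb with h | h
    · exact G.ideal_pos I h hl hx hx0 hxI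
    · obtain ⟨i, hi⟩ := G.swap.ideal_pos I (l := -l) (fun i => by simpa using h i)
        (neg_ne_zero.2 hl) (by rwa [swap_W, neg_neg]) hx0 hxI
      exact ⟨i, G.e_of_f I hi⟩

/-- joint eigenvectors are weight vectors -/
lemma joint_eig (G : Gen F L) {χ : Fin 8 → F} {x : L} (hx0 : x ≠ 0)
    (hx : ∀ i, ⁅G.h i, x⁆ = χ i • x) : ∃ l, x ∈ G.W l := by
  have h1 := Module.End.independent_iInf_maxGenEigenspace_of_forall_mapsTo
    (fun i => ad F L (G.h i)) (fun i j φ => Module.End.mapsTo_maxGenEigenspace_of_comm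
      (G.ad_h_comm j i) φ)
  have hxE : x ∈ ⨅ i, (ad F L (G.h i)).maxGenEigenspace (χ i) := by
    rw [Submodule.mem_iInf]
    intro i
    exact Module.End.genEigenspace_le_maximal _ _ 1 (Module.End.mem_eigenspace_iff.2 (hx i))
  by_contra! hno
  have hχ : ∀ l : V, (fun i => ((ca i l : ℤ) : F)) ≠ χ := by
    rintro l rfl
    exact hno l (mem_W.2 hx)
  have h2 := h1 χ
  have h3 : ⨆ (j) (_ : j ≠ χ), ⨅ i, (ad F L (G.h i)).maxGenEigenspace (j i) = ⊤ := by
    rw [eq_top_iff, ← G.W_top]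
    refine iSup_le fun l => ?_
    refine le_iSup₂_of_le (fun i => ((ca i l : ℤ) : F)) (hχ l) ?_
    exact iInf_mono fun i => Module.End.genEigenspace_le_maximal _ _ _
  rw [h3] at h2
  have := disjoint_top.1 h2
  have h6 : x ∈ (⊥ : Submodule F L) := by rw [← this]; exact hxE
  exact hx0 h6

lemma simple [IsAlgClosed F] (G : Gen F L) : LieAlgebra.IsSimple F L where
  non_abelian := fun h => by
    have h1 := G.ef 0
    rw [trivial_lie_zero] at h1
    exact G.h_ne 0 h1.symm
  eq_bot_or_eq_top := fun I => by
    by_cases hI : I = ⊥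
    · exact Or.inl hI
    right
    have := G.finDim
    have hn : Nontrivial I := by
      rw [LieSubmodule.nontrivial_iff_ne_bot]; exact hI
    obtain ⟨χ, hχ⟩ := LieModule.exists_nontrivial_weightSpace_of_isSolvable F G.H0 I
    obtain ⟨⟨v, hv⟩, hv0⟩ := exists_ne (0 : LieModule.weightSpace I χ)
    rw [LieModule.mem_weightSpace] at hv
    have hv0' : (v : L) ≠ 0 := by
      intro h; apply hv0; ext; exact h
    have hx : ∀ i, ⁅G.h i, (v : L)⁆ = χ ⟨G.h i, mem_H0.2 (G.h_mem i)⟩ • (v : L) := by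
      intro i
      have := congrArg Subtype.val (hv ⟨G.h i, mem_H0.2 (G.h_mem i)⟩)
      exact this
    obtain ⟨l, hl⟩ := G.joint_eig hv0' hx
    obtain ⟨i, hi⟩ := G.ideal_wt I hl hv0' v.2
    exact G.e_mem_top I i hi

lemma killing [IsAlgClosed F] (G : Gen F L) : LieAlgebra.IsKilling F L := by
  have := G.simple
  have := G.finDim
  infer_instance

end Gen
end E8

namespace E8
variable {F L : Type*} [Field F] [LieRing L] [LieAlgebra F L]

section Grad
variable {ι : Type*} [AddCommMonoid ι] {U : ι → Submodule F L}

lemma grad_lin [DecidableEq ι] (hi : iSupIndep U) (ht : iSup U = ⊤) (χ : ι → F) :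
    ∃ g : L →ₗ[F] L, ∀ a, ∀ x ∈ U a, g x = χ a • x := by
  have hI : DirectSum.IsInternal U :=
    (DirectSum.isInternal_submodule_iff_iSupIndep_and_iSup_eq_top U).2 ⟨hi, ht⟩
  let e : DirectSum ι (fun a => U a) ≃ₗ[F] L :=
    LinearEquiv.ofBijective (DirectSum.coeLinearMap U) hI
  refine ⟨(DirectSum.toModule F ι L (fun a => χ a • (U a).subtype)) ∘ₗ e.symm.toLinearMap, ?_⟩
  intro a x hx
  have h1 : e.symm x = DirectSum.lof F ι (fun a => U a) a ⟨x, hx⟩ := by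
    rw [LinearEquiv.symm_apply_eq]
    show x = DirectSum.coeLinearMap U _
    rw [DirectSum.coeLinearMap_lof]
  show DirectSum.toModule F ι L _ (e.symm x) = _
  rw [h1, DirectSum.toModule_lof]
  simp

lemma lin_ext_sup (ht : iSup U = ⊤) {f g : L →ₗ[F] L} (h : ∀ a, ∀ x ∈ U a, f x = g x) (x : L) :
    f x = g x := by
  have hx : x ∈ iSup U := by rw [ht]; trivial
  induction hx using Submodule.iSup_induction' with
  | mem a x hx => exact h a x hx
  | zero => simp
  | add x y _ _ hx hy => rw [map_add, map_add, hx, hy]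

/-- A multiplicative character on a grading gives an automorphism. -/
lemma grad_aut [DecidableEq ι] (hi : iSupIndep U) (ht : iSup U = ⊤)
    (hb : ∀ a b x y, x ∈ U a → y ∈ U b → ⁅x, y⁆ ∈ U (a + b))
    (χ : ι → F) (h0 : ∀ a, χ a ≠ 0)
    (hχ : ∀ a b, U a ≠ ⊥ → U b ≠ ⊥ → χ (a + b) = χ a * χ b) :
    ∃ g : lieAut F L, ∀ a, ∀ x ∈ U a, g.1 x = χ a • x := by
  obtain ⟨g, hg⟩ := grad_lin hi ht χ
  obtain ⟨g', hg'⟩ := grad_lin hi ht (fun a => (χ a)⁻¹)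
  let e : L ≃ₗ[F] L := LinearEquiv.ofLinear g g'
    (by
      ext x
      refine lin_ext_sup ht (f := g ∘ₗ g') (g := LinearMap.id) (fun a x hx => ?_) x
      rw [LinearMap.comp_apply, hg' a x hx, map_smul, hg a x hx, smul_smul,
        inv_mul_cancel₀ (h0 a), one_smul]; rfl)
    (by
      ext x
      refine lin_ext_sup ht (f := g' ∘ₗ g) (g := LinearMap.id) (fun a x hx => ?_) x
      rw [LinearMap.comp_apply, hg a x hx, map_smul, hg' a x hx, smul_smul,
        mul_inv_cancel₀ (h0 a), one_smul]; rfl)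
  refine ⟨⟨e, ?_⟩, hg⟩
  intro x y
  show g ⁅x, y⁆ = ⁅g x, g y⁆
  have hx : x ∈ iSup U := by rw [ht]; trivial
  induction hx using Submodule.iSup_induction' with
  | mem a x hx =>
    have hy : y ∈ iSup U := by rw [ht]; trivial
    induction hy using Submodule.iSup_induction' with
    | mem b y hy =>
      by_cases ha : U a = ⊥
      · rw [ha, Submodule.mem_bot] at hx; simp [hx]
      by_cases hb' : U b = ⊥
      · rw [hb', Submodule.mem_bot] at hy; simp [hy]
      rw [hg _ _ (hb a b x y hx hy), hg a x hx, hg b y hy, hχ a b ha hb', smul_lie, lie_smul,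
        smul_smul]
    | zero => simp
    | add y z _ _ hy hz => rw [lie_add, map_add, map_add, lie_add, hy, hz]
  | zero => simp
  | add x z _ _ hx hz => rw [add_lie, map_add, map_add, add_lie, hx, hz]
end Grad

section Exp
variable [CharZero F]

/-- Exponential of a nilpotent derivation `ad x`. -/
lemma exists_exp (x : L) (hx : IsNilpotent (ad F L x)) :
    ∃ g : lieAut F L, ∀ (n : ℕ) (y : L), (ad F L x ^ n) y = 0 →
      g.1 y = ∑ k ∈ Finset.range n, ((k.factorial : F)⁻¹) • (ad F L x ^ k) y := by
  letI : Module ℚ L := Module.compHom L (algebraMap ℚ F)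
  have hst : ∀ (r : ℚ) (y : L), r • y = (algebraMap ℚ F r) • y := fun r y => rfl
  letI : LieAlgebra ℚ L := { lie_smul := fun r a b => by rw [hst, hst, lie_smul] }
  let D : LieDerivation F L L := LieDerivation.ad F L x
  have hD : D.toLinearMap = ad F L x := by ext y; show (LieDerivation.ad F L x) y = _; simp
  have hn : IsNilpotent D.toLinearMap := by rw [hD]; exact hx
  let g := LieDerivation.exp D hn
  refine ⟨⟨g.toLinearEquiv, fun a b => LieHom.map_lie g.toLieHom a b⟩, ?_⟩
  intro n y hy
  show g y = _
  rw [LieDerivation.exp_map_apply]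
  obtain ⟨m, hm⟩ := hn
  have hm' : D.toLinearMap ^ (max m n) = 0 := pow_eq_zero_of_le (le_max_left _ _) hm
  rw [IsNilpotent.exp_eq_sum hm', hD]
  rw [LinearMap.sum_apply]
  have : ∀ k, ((k.factorial : ℚ)⁻¹ • ad F L x ^ k) y = ((k.factorial : F)⁻¹) • (ad F L x ^ k) y := by
    intro k
    rw [LinearMap.smul_apply, hst]
    simp
  simp only [this]
  symm
  apply Finset.sum_subset
  · exact Finset.range_mono (le_max_right _ _)
  · intro k _ hk
    rw [Finset.mem_range, not_lt] at hk
    obtain ⟨c, rfl⟩ := Nat.exists_eq_add_of_le hk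
    rw [add_comm, pow_add, Module.End.mul_apply, hy, map_zero, smul_zero]

/-- `exp (ad x)` -/
noncomputable def expA (x : L) (hx : IsNilpotent (ad F L x)) : lieAut F L :=
  (exists_exp x hx).choose

lemma expA_apply (x : L) (hx : IsNilpotent (ad F L x)) (n : ℕ) (y : L)
    (h : (ad F L x ^ n) y = 0) :
    (expA x hx).1 y = ∑ k ∈ Finset.range n, ((k.factorial : F)⁻¹) • (ad F L x ^ k) y :=
  (exists_exp x hx).choose_spec n y h

lemma expA_two (x : L) (hx : IsNilpotent (ad F L x)) (y : L) (h : ⁅x, ⁅x, y⁆⁆ = 0) :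
    (expA x hx).1 y = y + ⁅x, y⁆ := by
  rw [expA_apply x hx 2 y (by simpa [pow_succ] using h)]
  simp [Finset.sum_range_succ]

lemma expA_three (x : L) (hx : IsNilpotent (ad F L x)) (y : L) (h : ⁅x, ⁅x, ⁅x, y⁆⁆⁆ = 0) :
    (expA x hx).1 y = y + ⁅x, y⁆ + (2 : F)⁻¹ • ⁅x, ⁅x, y⁆⁆ := by
  rw [expA_apply x hx 3 y (by simpa [pow_succ] using h)]
  simp [Finset.sum_range_succ, pow_succ]
end Exp

lemma ad_nilp_smul {x : L} (hx : IsNilpotent (ad F L x)) (c : F) :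
    IsNilpotent (ad F L (c • x)) := by
  rw [map_smul]; exact hx.smul c

lemma ad_nilp_neg {x : L} (hx : IsNilpotent (ad F L x)) :
    IsNilpotent (ad F L (-x)) := by
  rw [map_neg]; exact hx.neg

namespace Gen
variable [CharZero F]

/-- character of the root lattice -/
noncomputable def chr (c : Fin 8 → F) (l : V) : F := ∏ i, c i ^ l i

lemma chr_ne {c : Fin 8 → F} (hc : ∀ i, c i ≠ 0) (l : V) : chr c l ≠ 0 :=
  Finset.prod_ne_zero_iff.2 fun i _ => zpow_ne_zero _ (hc i)

lemma chr_add {c : Fin 8 → F} (hc : ∀ i, c i ≠ 0) (l m : V) :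
    chr c (l + m) = chr c l * chr c m := by
  simp only [chr, ← Finset.prod_mul_distrib, Pi.add_apply]
  exact Finset.prod_congr rfl fun i _ => zpow_add₀ (hc i) _ _

lemma exists_torus (G : Gen F L) (c : Fin 8 → F) (hc : ∀ i, c i ≠ 0) :
    ∃ g : lieAut F L, ∀ l, ∀ x ∈ G.W l, g.1 x = chr c l • x :=
  grad_aut G.W_indep G.W_top (fun a b x y hx hy => G.lie_mem_W hx hy) (chr c) (chr_ne hc)
    (fun a b _ _ => chr_add hc a b)

variable [Nontrivial L]

/-- root vectors are ad-nilpotent -/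
lemma ad_nilp (G : Gen F L) {l : V} (hl : l ≠ 0) {x : L} (hx : x ∈ G.W l) :
    IsNilpotent (ad F L x) := by
  have hm : ∀ (k : ℕ) (m : V) (y : L), y ∈ G.W m → (ad F L x ^ k) y ∈ G.W (m + k • l) := by
    intro k m y hy
    induction k with
    | zero => simpa using hy
    | succ k ih =>
      rw [pow_succ', Module.End.mul_apply, ad_apply, succ_nsmul, ← add_assoc, add_comm]
      exact G.lie_mem_W hx ih
  have := G.finDim
  apply Module.End.isNilpotent_iff_of_finite.2
  intro y
  have hy : y ∈ iSup G.W := by rw [G.W_top]; trivial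
  induction hy using Submodule.iSup_induction' with
  | mem m y hy =>
    have hinj : Function.Injective (fun k : ℕ => m + k • l) := by
      intro a b hab
      simp only [add_right_inj] at hab
      obtain ⟨i, hi⟩ := Function.ne_iff.1 hl
      have := congrFun hab i
      have hi' : l i ≠ 0 := hi
      simpa [hi'] using this
    obtain ⟨k, hk⟩ := Set.Infinite.exists_notMem_finset (s := Set.range (fun k : ℕ => m + k • l))
      (Set.infinite_range_of_injective hinj) (insert 0 rootF)
    obtain ⟨⟨k, rfl⟩, hk⟩ := hk
    simp only [Finset.mem_insert, mem_rootF, not_or] at hk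
    refine ⟨k, ?_⟩
    have := hm k m y hy
    rw [G.W_bot hk.1 hk.2] at this
    exact this
  | zero => exact ⟨0, by simp⟩
  | add y z _ _ hy hz =>
    obtain ⟨a, ha⟩ := hy
    obtain ⟨b, hb⟩ := hz
    refine ⟨a + b, ?_⟩
    rw [map_add, pow_add, Module.End.mul_apply, Module.End.mul_apply, hb, map_zero, add_zero,
      ← Module.End.mul_apply, ← pow_add, add_comm, pow_add, Module.End.mul_apply, ha, map_zero]

lemma e_nil (G : Gen F L) (i) : IsNilpotent (ad F L (G.e i)) :=
  G.ad_nilp (al_ne_zero i) (G.e_mem i)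
lemma f_nil (G : Gen F L) (i) : IsNilpotent (ad F L (G.f i)) :=
  G.ad_nilp (neg_ne_zero.2 (al_ne_zero i)) (G.f_mem i)

/-- Weyl group lifts -/
noncomputable def nn (G : Gen F L) (i : Fin 8) : lieAut F L :=
  expA (G.e i) (G.e_nil i) * expA (-G.f i) (ad_nilp_neg (G.f_nil i)) * expA (G.e i) (G.e_nil i)

lemma nn_h (G : Gen F L) (i j) : (G.nn i).1 (G.h j) = G.h j - ((CartanMatrix.E₈ j i : ℤ) : F) • G.h i := by
  set a : F := ((CartanMatrix.E₈ j i : ℤ) : F) with ha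
  have eh : ∀ k, ⁅G.e i, G.h k⁆ = -(((CartanMatrix.E₈ k i : ℤ) : F) • G.e i) := fun k => by
    rw [← lie_skew, G.he]
  have fh : ∀ k, ⁅G.f i, G.h k⁆ = (((CartanMatrix.E₈ k i : ℤ) : F) • G.f i) := fun k => by
    rw [← lie_skew, G.hf, neg_smul, neg_neg]
  have h2 : CartanMatrix.E₈ i i = 2 := by rw [← ca_al, ca_al_self]
  have fe : ⁅G.f i, G.e i⁆ = - G.h i := by rw [← lie_skew, G.ef]
  have E1 : ∀ k, (expA (G.e i) (G.e_nil i)).1 (G.h k) = G.h k - ((CartanMatrix.E₈ k i : ℤ) : F) • G.e i := by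
    intro k
    rw [expA_two _ _ _ (by rw [eh, lie_neg, lie_smul, lie_self]; simp), eh]; abel
  have E2 : (expA (G.e i) (G.e_nil i)).1 (G.e i) = G.e i := by
    rw [expA_two _ _ _ (by simp)]; simp
  have F1 : ∀ k, (expA (-G.f i) (ad_nilp_neg (G.f_nil i))).1 (G.h k) = G.h k - ((CartanMatrix.E₈ k i : ℤ) : F) • G.f i := by
    intro k
    rw [expA_two _ _ _ (by rw [neg_lie, neg_lie, fh, lie_neg, lie_smul, lie_self]; simp), neg_lie, fh]; abel
  have F2 : (expA (-G.f i) (ad_nilp_neg (G.f_nil i))).1 (G.e i) = G.e i + G.h i - G.f i := by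
    rw [expA_three _ _ _ (by simp [fe, fh])]
    simp only [neg_lie, fe, lie_neg, neg_neg, fh, h2]
    rw [smul_neg, smul_smul]; norm_num; abel
  show (expA (G.e i) (G.e_nil i)).1 ((expA (-G.f i) (ad_nilp_neg (G.f_nil i))).1
    ((expA (G.e i) (G.e_nil i)).1 (G.h j))) = _
  rw [E1, map_sub, map_smul, F1, F2, ← ha]
  have : G.h j - a • G.f i - a • (G.e i + G.h i - G.f i) = G.h j - a • G.e i - a • G.h i := by
    simp only [smul_add, smul_sub]; abel
  rw [this, map_sub, map_sub, map_smul, map_smul, E1, E1, E2, ← ha, h2, smul_sub, smul_smul]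
  have h3 : (a * ((2 : ℤ) : F)) • G.e i = a • G.e i + a • G.e i := by
    rw [← add_smul]; congr 1; push_cast; ring
  rw [h3]; abel

lemma nn_W (G : Gen F L) (i) {l : V} {x : L} (hx : x ∈ G.W l) : (G.nn i).1 x ∈ G.W (sr i l) := by
  rw [mem_W] at *
  intro j
  have h2 : CartanMatrix.E₈ i i = 2 := by rw [← ca_al, ca_al_self]
  have h1 : (G.nn i).1 (G.h j - ((CartanMatrix.E₈ j i : ℤ) : F) • G.h i) = G.h j := by
    rw [map_sub, map_smul, nn_h, nn_h, h2, smul_sub, smul_smul]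
    have : (((CartanMatrix.E₈ j i : ℤ) : F) * ((2 : ℤ) : F)) • G.h i =
      ((CartanMatrix.E₈ j i : ℤ) : F) • G.h i + ((CartanMatrix.E₈ j i : ℤ) : F) • G.h i := by
      rw [← add_smul]; congr 1; push_cast; ring
    rw [this]; abel
  calc ⁅G.h j, (G.nn i).1 x⁆ = ⁅(G.nn i).1 (G.h j - ((CartanMatrix.E₈ j i : ℤ) : F) • G.h i), (G.nn i).1 x⁆ := by rw [h1]
    _ = (G.nn i).1 ⁅G.h j - ((CartanMatrix.E₈ j i : ℤ) : F) • G.h i, x⁆ := ((G.nn i).2 _ _).symm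
    _ = _ := by
      rw [sub_lie, smul_lie, hx, hx, smul_smul, ← sub_smul, map_smul, sr, ca_sub, ca_smul, ca_al]
      congr 1; push_cast; ring

end Gen
end E8

namespace E8
variable {F L : Type*} [Field F] [LieRing L] [LieAlgebra F L]

lemma max_mem {G : Type*} [Group G] {Q : Subgroup G} (hQ : IsMaximalFiniteAbelian Q) {g : G}
    (h : ∀ a ∈ Q, g * a = a * g) : g ∈ Q := by
  obtain ⟨_, hc, hm⟩ := hQ
  have hle : Q ≤ Subgroup.closure (insert g (Q : Set G)) := fun a ha =>
    Subgroup.subset_closure (Set.mem_insert_of_mem _ ha)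
  have := hm (Subgroup.closure (insert g (Q : Set G))) ?_ hle
  · rw [← this]; exact Subgroup.subset_closure (Set.mem_insert _ _)
  · intro a b ha hb
    have hcomm : ∀ x ∈ insert g (Q : Set G), ∀ y ∈ insert g (Q : Set G), x * y = y * x := by
      rintro x (rfl | hx) y (rfl | hy)
      · rfl
      · exact h y hy
      · exact (h x hx).symm
      · exact hc x y hx hy
    have hI := Subgroup.isMulCommutative_closure hcomm
    exact congrArg Subtype.val (hI.is_comm.comm ⟨a, ha⟩ ⟨b, hb⟩)

lemma aut_ad_pow (g : lieAut F L) (x y : L) (n : ℕ) :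
    g.1 ((ad F L x ^ n) y) = (ad F L (g.1 x) ^ n) (g.1 y) := by
  induction n with
  | zero => simp
  | succ n ih => rw [pow_succ', Module.End.mul_apply, ad_apply, g.2, ih, pow_succ',
      Module.End.mul_apply, ad_apply]

lemma aut_ext {g h : lieAut F L} (H : ∀ x, g.1 x = h.1 x) : g = h :=
  Subtype.ext (LinearEquiv.ext H)

lemma aut_ad_nilp (g : lieAut F L) {x : L} (hx : IsNilpotent (ad F L x)) :
    IsNilpotent (ad F L (g.1 x)) := by
  obtain ⟨n, hn⟩ := hx
  refine ⟨n, ?_⟩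
  ext y
  obtain ⟨z, rfl⟩ := g.1.surjective y
  rw [← aut_ad_pow, hn]; simp

lemma conj_expA [CharZero F] (g : lieAut F L) (x : L) (hx : IsNilpotent (ad F L x)) :
    g * expA x hx = expA (g.1 x) (aut_ad_nilp g hx) * g := by
  apply aut_ext
  intro y
  show g.1 ((expA x hx).1 y) = (expA (g.1 x) (aut_ad_nilp g hx)).1 (g.1 y)
  obtain ⟨n, hn⟩ := id hx
  rw [expA_apply x _ n y (by rw [hn]; simp), expA_apply _ _ n (g.1 y) (by
    rw [← aut_ad_pow, hn]; simp)]
  rw [map_sum]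
  refine Finset.sum_congr rfl fun k _ => ?_
  rw [map_smul, aut_ad_pow]

lemma expA_congr [CharZero F] {x y : L} (h : x = y) (hx : IsNilpotent (ad F L x)) (hy : IsNilpotent (ad F L y)) :
    expA x hx = expA y hy := by subst h; rfl

/-- B0 -/
lemma fixed_zero [CharZero F] [IsAlgClosed F] [FiniteDimensional F L]
    (hz : ∀ x : L, ad F L x = 0 → x = 0) {Q : Subgroup (lieAut F L)}
    (hQ : IsMaximalFiniteAbelian Q) {x : L} (hx : ∀ a ∈ Q, a.1 x = x) : x = 0 := by
  have hfin : Finite Q := hQ.1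
  by_cases hn : IsNilpotent (ad F L x)
  · by_contra hx0
    have hmem : ∀ c : F, expA (c • x) (ad_nilp_smul hn c) ∈ Q := by
      intro c
      apply max_mem hQ
      intro a ha
      rw [conj_expA]
      congr 1
      apply expA_congr
      rw [map_smul, hx a ha]
    obtain ⟨c, c', hcc, he⟩ := Finite.exists_ne_map_eq_of_infinite
      (fun c : F => (⟨_, hmem c⟩ : Q))
    have he := congrArg Subtype.val he
    simp only at he
    have hne : ad F L x ≠ 0 := fun h => hx0 (hz x h)
    obtain ⟨n, hn0, hn1⟩ : ∃ n, (ad F L x) ^ n ≠ 0 ∧ (ad F L x) ^ (n + 1) = 0 := by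
      classical
      have hN := Nat.find_spec hn
      have hmin := fun m => Nat.find_min hn (m := m)
      set N := Nat.find hn
      rcases N with _ | N
      · exfalso; apply hne
        rw [pow_zero] at hN
        rw [← one_mul (ad F L x), hN, zero_mul]
      · exact ⟨N, hmin N (by omega), hN⟩
    rcases n with _ | n
    · rw [zero_add, pow_one] at hn1; exact hne hn1
    obtain ⟨z, hz1⟩ : ∃ z, ((ad F L x) ^ (n+1)) z ≠ 0 := by
      by_contra! h; exact hn0 (LinearMap.ext h)
    have h1 : ⁅x, ((ad F L x) ^ n) z⁆ ≠ 0 := by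
      rw [pow_succ', Module.End.mul_apply, ad_apply] at hz1; exact hz1
    have h2 : ⁅x, ⁅x, ((ad F L x) ^ n) z⁆⁆ = 0 := by
      have := LinearMap.congr_fun hn1 z
      rw [pow_succ', pow_succ', Module.End.mul_apply, Module.End.mul_apply] at this; exact this
    have h3 := congrArg (fun g : lieAut F L => g.1 (((ad F L x) ^ n) z)) he
    beta_reduce at h3
    rw [expA_two _ _ _ (by simp [h2]), expA_two _ _ _ (by simp [h2])] at h3
    rw [add_right_inj, smul_lie, smul_lie] at h3
    exact hcc (smul_left_injective F h1 h3)
  · exfalso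
    classical
    set U := (ad F L x).maxGenEigenspace with hU
    have hind : iSupIndep U := (ad F L x).independent_maxGenEigenspace
    have htop : iSup U = ⊤ := Module.End.iSup_maxGenEigenspace_eq_top _
    have hbr : ∀ a b y z, y ∈ U a → z ∈ U b → ⁅y, z⁆ ∈ U (a + b) := by
      intro a b y z hy hz
      exact LieModule.lie_mem_maxGenEigenspace_toEnd hy hz
    have hS : {a | U a ≠ ⊥}.Finite := WellFoundedGT.finite_ne_bot_of_iSupIndep hind
    obtain ⟨a0, ha0, hb0⟩ : ∃ a, a ≠ 0 ∧ U a ≠ ⊥ := by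
      by_contra! h
      apply hn
      have h0 : U 0 = ⊤ := by
        rw [eq_top_iff, ← htop]
        refine iSup_le fun a => ?_
        by_cases ha : a = 0
        · rw [ha]
        · rw [h a ha]; exact bot_le
      apply Module.End.isNilpotent_iff_of_finite.2
      intro y
      have hy : y ∈ U 0 := by rw [h0]; trivial
      rw [hU, Module.End.mem_maxGenEigenspace] at hy
      simpa using hy
    obtain ⟨l, hl⟩ : ∃ l : F →ₗ[ℚ] ℚ, l a0 ≠ 0 := by
      by_contra! h
      exact ha0 ((Module.forall_dual_apply_eq_zero_iff ℚ a0).1 h)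
    let N : ℕ := ∏ a ∈ hS.toFinset, (l a).den
    have hN0 : (N : ℚ) ≠ 0 := by
      simp only [N]; push_cast
      exact Finset.prod_ne_zero_iff.2 fun a _ => by exact_mod_cast (l a).den_ne_zero
    have hN : ∀ a, U a ≠ ⊥ → ∃ k : ℤ, N * l a = k := by
      intro a ha
      obtain ⟨c, hc⟩ : (l a).den ∣ N := Finset.dvd_prod_of_mem (fun a => (l a).den) (hS.mem_toFinset.2 ha)
      refine ⟨c * (l a).num, ?_⟩
      rw [hc]; push_cast
      rw [mul_comm ((l a).den : ℚ), mul_assoc, Rat.den_mul_eq_num]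
    obtain ⟨g, hg⟩ := grad_aut hind htop hbr (fun a => (2 : F) ^ (⌊N * l a⌋))
      (fun a => zpow_ne_zero _ two_ne_zero) (by
        intro a b ha hb
        obtain ⟨k, hk⟩ := hN a ha
        obtain ⟨m, hm⟩ := hN b hb
        rw [map_add, mul_add, hk, hm, ← Int.cast_add, Int.floor_intCast, Int.floor_intCast,
          Int.floor_intCast, zpow_add₀ two_ne_zero])
    have hgQ : g ∈ Q := by
      apply max_mem hQ
      intro a ha
      apply aut_ext
      intro y
      refine lin_ext_sup htop (f := g.1.toLinearMap ∘ₗ a.1.toLinearMap)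
        (g := a.1.toLinearMap ∘ₗ g.1.toLinearMap) (fun b y hy => ?_) y
      show g.1 (a.1 y) = a.1 (g.1 y)
      rw [hg b y hy, map_smul]
      apply hg
      rw [hU, Module.End.mem_maxGenEigenspace] at hy ⊢
      obtain ⟨k, hk⟩ := hy
      refine ⟨k, ?_⟩
      have hcom : Commute (ad F L x - b • 1) a.1.toLinearMap := by
        ext z
        have := a.2 x z
        rw [hx a ha] at this
        simp [this, LinearMap.sub_apply]
      have := LinearMap.congr_fun (hcom.pow_left k) y
      simp only [Module.End.mul_apply] at this
      rw [hk, map_zero] at this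
      exact this
    obtain ⟨n, hn0, hgn⟩ : ∃ n : ℕ, 0 < n ∧ g ^ n = 1 := by
      refine ⟨orderOf (⟨g, hgQ⟩ : Q), orderOf_pos _, ?_⟩
      exact congrArg Subtype.val (pow_orderOf_eq_one (⟨g, hgQ⟩ : Q))
    obtain ⟨v, hv, hv0⟩ := Submodule.exists_mem_ne_zero_of_ne_bot hb0
    obtain ⟨k, hk⟩ := hN a0 hb0
    have hp : ∀ n : ℕ, (g ^ n).1 v = ((2 : F) ^ k) ^ n • v := by
      intro n
      induction n with
      | zero => simp
      | succ n ih =>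
        rw [pow_succ]
        show (g ^ n).1 (g.1 v) = _
        rw [hg a0 v hv, map_smul, ih, smul_smul, hk, Int.floor_intCast, pow_succ, mul_comm]
    have h1 := hp n
    rw [hgn] at h1
    have h2 : ((2 : F) ^ k) ^ n = 1 := by
      have : (((2 : F) ^ k) ^ n - 1) • v = 0 := by
        rw [sub_smul, ← h1, one_smul]; exact sub_self v
      rcases smul_eq_zero.1 this with h | h
      · exact sub_eq_zero.1 h
      · exact absurd h hv0
    have h3 : ((2 : ℚ) ^ k) ^ n = 1 := by
      have : (((((2 : ℚ) ^ k) ^ n : ℚ)) : F) = ((1 : ℚ) : F) := by push_cast; exact h2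
      exact Rat.cast_injective this
    rw [← zpow_natCast, ← zpow_mul, zpow_eq_one_iff_right₀ (by norm_num) (by norm_num)] at h3
    rcases mul_eq_zero.1 h3 with h | h
    · rw [h] at hk
      simp at hk
      rcases hk with hk | hk
      · exact hN0 (by exact_mod_cast hk)
      · exact hl hk
    · omega
end E8

namespace E8
variable {F L : Type*} [Field F] [LieRing L] [LieAlgebra F L]

section TraceLemma
variable {M : Type*} [AddCommGroup M] [Module F M]

lemma pow_comm_rel {E Z D : Module.End F M} (hD : E * Z = Z * E + D) (hc : E * D = D * E) (k : ℕ) :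
    E ^ k * Z = Z * E ^ k + (k : F) • (D * E ^ (k - 1)) := by
  induction k with
  | zero => simp
  | succ k ih =>
    have hcp : ∀ j, E ^ j * D = D * E ^ j := fun j => (Commute.pow_left hc j)
    rw [pow_succ, mul_assoc, hD, mul_add, ← mul_assoc, ih, add_mul, hcp, mul_assoc, add_assoc]
    congr 1
    rcases k with _ | k
    · simp
    · simp only [Nat.add_sub_cancel]
      rw [smul_mul_assoc, mul_assoc, ← pow_succ]
      push_cast
      module

lemma D_nilp [CharZero F] {E Z D : Module.End F M} (hD : E * Z = Z * E + D) (hc : E * D = D * E)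
    (hE : IsNilpotent E) : IsNilpotent D := by
  obtain ⟨n, hn⟩ := hE
  have key : ∀ j m : ℕ, j + m = n → ∃ a, D ^ a * E ^ m = 0 := by
    intro j
    induction j with
    | zero => intro m hm; exact ⟨0, by rw [show m = n by omega, hn, mul_zero]⟩
    | succ j ih =>
      intro m hm
      obtain ⟨a, ha⟩ := ih (m + 1) (by omega)
      refine ⟨a + 1 + a, ?_⟩
      have hcp : ∀ i j, E ^ j * D ^ i = D ^ i * E ^ j := fun i j => (Commute.pow_pow hc j i)
      have h1 : D ^ a * (E ^ (m + 1) * Z) * D ^ a = 0 := by rw [← mul_assoc, ha]; simp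
      rw [pow_comm_rel hD hc, mul_add, add_mul, mul_assoc, mul_assoc Z, hcp, ha, mul_zero, mul_zero,
        zero_add, Nat.add_sub_cancel, mul_smul_comm, smul_mul_assoc] at h1
      have h2 := (smul_eq_zero.1 h1).resolve_left (by exact_mod_cast Nat.succ_ne_zero m)
      rw [mul_assoc, mul_assoc, hcp, ← mul_assoc, ← mul_assoc] at h2
      rw [pow_add, pow_succ]; exact h2
  obtain ⟨a, ha⟩ := key n 0 (by omega)
  exact ⟨a, by simpa using ha⟩

lemma trace_nil [CharZero F] {E Z D : Module.End F M} (hD : E * Z = Z * E + D) (hc : E * D = D * E)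
    (hE : IsNilpotent E) : IsNilpotent (E * Z) := by
  obtain ⟨a, ha⟩ := D_nilp hD hc hE
  have hcp : ∀ i j, E ^ j * D ^ i = D ^ i * E ^ j := fun i j => (Commute.pow_pow hc j i)
  have s1 : ∀ i v, (E ^ i) v = 0 → (E ^ i) ((E * Z) v) = 0 := by
    intro i v hv
    rw [← Module.End.mul_apply, ← mul_assoc, ← pow_succ, pow_comm_rel hD hc]
    simp [pow_succ', hv]
  have s2 : ∀ i v, (E ^ (i + 1)) v = 0 → (E ^ i) ((E * Z) v) = ((i + 1 : ℕ) : F) • D ((E ^ i) v) := by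
    intro i v hv
    rw [← Module.End.mul_apply, ← mul_assoc, ← pow_succ, pow_comm_rel hD hc]
    simp [hv]
  have s1' : ∀ i k v, (E ^ i) v = 0 → (E ^ i) (((E * Z) ^ k) v) = 0 := by
    intro i k v hv
    induction k with
    | zero => simpa
    | succ k ih => rw [pow_succ', Module.End.mul_apply]; exact s1 _ _ ih
  have s3 : ∀ i k v, (E ^ (i + 1)) v = 0 →
      (E ^ i) (((E * Z) ^ k) v) = ((i + 1 : ℕ) : F) ^ k • (D ^ k) ((E ^ i) v) := by
    intro i k v hv
    induction k with
    | zero => simp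
    | succ k ih =>
      rw [pow_succ', Module.End.mul_apply, s2 _ _ (s1' _ k _ hv), ih, map_smul, smul_smul, ← pow_succ',
        pow_succ' D, Module.End.mul_apply]
  have key : ∀ i, ∃ k, ∀ v, (E ^ i) v = 0 → ((E * Z) ^ k) v = 0 := by
    intro i
    induction i with
    | zero => exact ⟨0, fun v hv => by simpa using hv⟩
    | succ i ih =>
      obtain ⟨k, hk⟩ := ih
      refine ⟨k + a, fun v hv => ?_⟩
      rw [pow_add, Module.End.mul_apply]
      apply hk
      rw [s3 _ _ _ hv, ha]; simp
  obtain ⟨n, hn⟩ := hE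
  obtain ⟨k, hk⟩ := key n
  exact ⟨k, LinearMap.ext fun v => hk v (by rw [hn]; simp)⟩
end TraceLemma

lemma killing_nil [CharZero F] [FiniteDimensional F L] {e z : L} (he : IsNilpotent (ad F L e))
    (hz : ⁅e, ⁅e, z⁆⁆ = 0) : killingForm F L e z = 0 := by
  have h := trace_nil (E := ad F L e) (Z := ad F L z) (D := ad F L ⁅e, z⁆)
    (by ext y; simp only [Module.End.mul_apply, LinearMap.add_apply, ad_apply, lie_lie]; abel)
    (by
      ext y
      simp only [Module.End.mul_apply, ad_apply]
      rw [leibniz_lie, hz, zero_lie, zero_add]) he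
  have := (LinearMap.isNilpotent_trace_of_isNilpotent h).eq_zero
  exact this

section Main
variable [CharZero F] [IsAlgClosed F] [FiniteDimensional F L] [IsKilling F L]

lemma ad_inj (x : L) (h : ad F L x = 0) : x = 0 := by
  apply (LieDerivation.IsKilling.ad_apply_eq_zero_iff F L x).1
  ext y
  have := LinearMap.congr_fun h y
  simpa using this

/-- semisimple part -/
lemma jordan (y : L) : ∃ s : L, ∀ μ, ∀ z ∈ (ad F L y).maxGenEigenspace μ, ⁅s, z⁆ = μ • z := by
  classical
  set U := (ad F L y).maxGenEigenspace with hU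
  have hind : iSupIndep U := (ad F L y).independent_maxGenEigenspace
  have htop : iSup U = ⊤ := Module.End.iSup_maxGenEigenspace_eq_top _
  have hbr : ∀ a b x z, x ∈ U a → z ∈ U b → ⁅x, z⁆ ∈ U (a + b) := by
    intro a b x z hx hz
    exact LieModule.lie_mem_maxGenEigenspace_toEnd hx hz
  obtain ⟨g, hg⟩ := grad_lin hind htop (fun a => a)
  have hD : ∀ a b : L, g ⁅a, b⁆ = ⁅a, g b⁆ - ⁅b, g a⁆ := by
    intro x z
    have hx : x ∈ iSup U := by rw [htop]; trivial
    induction hx using Submodule.iSup_induction' with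
    | mem a x hx =>
      have hz : z ∈ iSup U := by rw [htop]; trivial
      induction hz using Submodule.iSup_induction' with
      | mem b z hz =>
        rw [hg _ _ (hbr a b x z hx hz), hg a x hx, hg b z hz, lie_smul, lie_smul, ← lie_skew x z]
        module
      | zero => simp
      | add z w _ _ hz hw => rw [lie_add, map_add, map_add, lie_add, add_lie, hz, hw]; abel
    | zero => simp
    | add x w _ _ hx hw => rw [add_lie, map_add, map_add, lie_add, add_lie, hx, hw]; abel
  obtain ⟨s, hs⟩ := LieDerivation.IsKilling.exists_eq_ad (R := F) (L := L) ⟨g, hD⟩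
  refine ⟨s, fun μ z hz => ?_⟩
  rw [← hg μ z hz]
  have := congrArg (fun D : LieDerivation F L L => D z) hs
  simpa using this

lemma killing_nd {c : L} (h : ∀ y, killingForm F L c y = 0) : c = 0 := by
  have := (LieAlgebra.IsKilling.ker_killingForm_eq_bot F L)
  rw [LinearMap.ker_eq_bot'] at this
  exact this c (LinearMap.ext h)

lemma aut_killing (g : lieAut F L) (x y : L) :
    killingForm F L (g.1 x) (g.1 y) = killingForm F L x y := by
  have e1 : ∀ x, ad F L (g.1 x) = g.1.conj (ad F L x) := by
    intro x; ext z
    rw [LinearEquiv.conj_apply_apply, ad_apply, ad_apply, g.2, LinearEquiv.apply_symm_apply]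
  rw [killingForm_apply_apply, killingForm_apply_apply, e1, e1]
  have : g.1.conj (ad F L x) ∘ₗ g.1.conj (ad F L y) = g.1.conj (ad F L x ∘ₗ ad F L y) := by
    rw [LinearEquiv.conj_comp]
  rw [this, LinearMap.trace_conj']

/-- nilpotent e, e = [e,[e,z]] -/
lemma exists_ee {e : L} (he : IsNilpotent (ad F L e)) : ∃ z, ⁅e, ⁅e, z⁆⁆ = e := by
  have hB := LieAlgebra.IsKilling.killingForm_nondegenerate F L
  have hR := (LieModule.traceForm_isSymm F L L).isRefl
  have h := LinearMap.BilinForm.orthogonal_orthogonal hB hR (LinearMap.range ((ad F L e) ^ 2))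
  have : e ∈ LinearMap.range ((ad F L e) ^ 2) := by
    rw [← h, LinearMap.BilinForm.mem_orthogonal_iff]
    intro z hz
    rw [LinearMap.BilinForm.mem_orthogonal_iff] at hz
    show killingForm F L z e = 0
    rw [LieModule.traceForm_comm]
    apply killing_nil he
    apply killing_nd (F := F)
    intro w
    have := hz _ ⟨w, rfl⟩
    have h2 : killingForm F L ⁅e, ⁅e, w⁆⁆ z = 0 := by
      simpa [pow_succ] using this
    rw [LieModule.traceForm_apply_lie_apply', LieModule.traceForm_apply_lie_apply', neg_neg,
      LieModule.traceForm_comm] at h2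
    exact h2
  obtain ⟨z, hz⟩ := this
  exact ⟨z, by simpa [pow_succ] using hz⟩

variable (θ : lieAut F L) (ζ : F)

lemma theta_pow {k : ℕ} {y : L} (h : θ.1 y = ζ ^ k • y) (j : ℕ) : (θ ^ j).1 y = ζ ^ (k * j) • y := by
  induction j with
  | zero => simp
  | succ j ih =>
    rw [pow_succ]; show (θ ^ j).1 (θ.1 y) = _
    rw [h, map_smul, ih, smul_smul, ← pow_add]; congr 2; ring

/-- projection to the ζ^k eigenspace -/
noncomputable def pr (k : ℕ) (y : L) : L := (6 : F)⁻¹ • ∑ j ∈ Finset.range 6, ζ ^ (5 * k * j) • (θ ^ j).1 y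

variable {θ ζ}

lemma pr_eig (hθ : θ ^ 6 = 1) (hζ : ζ ^ 6 = 1) (k : ℕ) (y : L) :
    θ.1 (pr θ ζ k y) = ζ ^ k • pr θ ζ k y := by
  have h0 : ∀ j, θ.1 ((θ ^ j).1 y) = (θ ^ (j + 1)).1 y := fun j => by rw [pow_succ']; rfl
  have e : ∀ a b, ζ ^ (a + 6 * b) = ζ ^ a := fun a b => by rw [pow_add, pow_mul, hζ, one_pow, mul_one]
  have e1 : ζ ^ (k + 5 * k * 0) = ζ ^ (5 * k * 5) := by rw [← e (k + 5 * k * 0) (4 * k)]; congr 1; ring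
  have e2 : ∀ j, ζ ^ (k + 5 * k * (j + 1)) = ζ ^ (5 * k * j) := fun j => by
    rw [← e (5 * k * j) k]; congr 1; ring
  rw [pr, map_smul, map_sum, smul_comm (ζ ^ k), Finset.smul_sum (r := ζ ^ k)]
  congr 1
  rw [Finset.sum_range_succ, Finset.sum_range_succ' (fun j => ζ ^ k • ζ ^ (5 * k * j) • (θ ^ j).1 y)]
  congr 1
  · refine Finset.sum_congr rfl fun j _ => ?_
    rw [map_smul, h0, smul_smul, ← pow_add, e2]
  · rw [map_smul, h0, smul_smul, ← pow_add, e1, hθ]; rfl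

lemma pr_sum (hζ : IsPrimitiveRoot ζ 6) (y : L) :
    ∑ k ∈ Finset.range 6, pr θ ζ k y = y := by
  simp only [pr]
  rw [← Finset.smul_sum, Finset.sum_comm]
  have h1 : ∀ j ∈ Finset.range 6, ∑ k ∈ Finset.range 6, ζ ^ (5 * k * j) • (θ ^ j).1 y =
      if j = 0 then (6 : F) • y else 0 := by
    intro j hj
    rw [← Finset.sum_smul]
    split_ifs with h
    · subst h; simp
    · have h2 : ∑ k ∈ Finset.range 6, ζ ^ (5 * k * j) = ∑ k ∈ Finset.range 6, (ζ ^ (5 * j)) ^ k :=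
        Finset.sum_congr rfl fun k _ => by rw [← pow_mul]; congr 1; ring
      have h3 : ζ ^ (5 * j) ≠ 1 := by
        intro h3
        rw [hζ.pow_eq_one_iff_dvd] at h3
        rw [Finset.mem_range] at hj; omega
      have h4 := mul_geom_sum (ζ ^ (5 * j)) 6
      rw [← pow_mul, mul_comm (5 * j) 6, pow_mul ζ 6, hζ.pow_eq_one, one_pow, sub_self] at h4
      rw [h2, (mul_eq_zero.1 h4).resolve_left (sub_ne_zero.2 h3), zero_smul]
  rw [Finset.sum_congr rfl h1, Finset.sum_ite_eq']
  simp [smul_smul]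

end Main
end E8

namespace E8
variable {F L : Type*} [Field F] [LieRing L] [LieAlgebra F L]
variable [CharZero F] [IsAlgClosed F] [FiniteDimensional F L] [IsKilling F L]
variable {θ : lieAut F L} {ζ : F} {x : L}
open LieSubalgebra

lemma pow_fix (hx : θ.1 x = x) (j : ℕ) : (θ ^ j).1 x = x := by
  induction j with
  | zero => rfl
  | succ j ih => rw [pow_succ]; show (θ ^ j).1 (θ.1 x) = x; rw [hx, ih]

lemma engel_theta (hx : θ.1 x = x) {y : L} (hy : y ∈ engel F x) : θ.1 y ∈ engel F x := by
  rw [mem_engel_iff] at *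
  obtain ⟨n, hn⟩ := hy
  refine ⟨n, ?_⟩
  have := aut_ad_pow θ x y n
  rw [hn, map_zero, hx] at this
  exact this.symm

lemma engel_pr (hx : θ.1 x = x) {y : L} (hy : y ∈ engel F x) (k : ℕ) : pr θ ζ k y ∈ engel F x := by
  rw [pr]
  exact (engel F x).smul_mem _ (sum_mem fun j _ => (engel F x).smul_mem _ (engel_theta (pow_fix hx j) hy))

/-- complement of the Engel subalgebra -/
lemma engel_decomp (x z : L) : ∃ a ∈ engel F x, ∃ b, z = a + b ∧ ∀ c ∈ engel F x, killingForm F L b c = 0 := by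
  have inv : ∀ (n : ℕ) (b c : L), killingForm F L ((ad F L x ^ n) b) c = (-1) ^ n * killingForm F L b ((ad F L x ^ n) c) := by
    intro n
    induction n with
    | zero => simp
    | succ n ih =>
      intro b c
      rw [pow_succ', Module.End.mul_apply, ad_apply, LieModule.traceForm_apply_lie_apply', ih,
        ← pow_succ', pow_succ (ad F L x), Module.End.mul_apply, pow_succ, ad_apply]
      ring
  have hcompl := LinearMap.isCompl_iSup_ker_pow_iInf_range_pow (ad F L x)
  have hz : z ∈ (⨆ n, LinearMap.ker (ad F L x ^ n)) ⊔ (⨅ n, LinearMap.range (ad F L x ^ n)) := by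
    rw [hcompl.sup_eq_top]; trivial
  obtain ⟨a, ha, b, hb, rfl⟩ := Submodule.mem_sup.1 hz
  have hle : (⨆ n, LinearMap.ker (ad F L x ^ n)) ≤ (engel F x).toSubmodule :=
    iSup_le fun n v hv => (mem_engel_iff ..).2 ⟨n, hv⟩
  refine ⟨a, hle ha, b, rfl, ?_⟩
  intro c hc
  obtain ⟨n, hn⟩ := (mem_engel_iff ..).1 hc
  obtain ⟨b', rfl⟩ := (Submodule.mem_iInf _).1 hb n
  rw [inv, hn]
  simp

lemma engel_nd (x : L) {u : L} (hu : u ∈ engel F x) (h : ∀ c ∈ engel F x, killingForm F L u c = 0) :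
    u = 0 := by
  apply killing_nd (F := F)
  intro y
  obtain ⟨a, ha, b, rfl, hb⟩ := engel_decomp (F := F) x y
  rw [map_add, h a ha, LieModule.traceForm_comm, hb u hu, add_zero]

lemma mem_mge_zero {w y : L} : y ∈ (ad F L w).maxGenEigenspace 0 ↔ y ∈ engel F w := by
  rw [Module.End.mem_maxGenEigenspace, mem_engel_iff]; simp

lemma mge_aut {c : F} (hc : c ≠ 0) {y : L} (hk : θ.1 y = c • y) {μ : F} {z : L}
    (hz : z ∈ (ad F L y).maxGenEigenspace μ) : θ.1 z ∈ (ad F L y).maxGenEigenspace (c⁻¹ * μ) := by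
  rw [Module.End.mem_maxGenEigenspace] at hz ⊢
  obtain ⟨n, hn⟩ := hz
  refine ⟨n, ?_⟩
  have e2 : ∀ (n : ℕ) (v : L), ((ad F L y - (c⁻¹ * μ) • 1) ^ n) (θ.1 v) =
      c⁻¹ ^ n • θ.1 (((ad F L y - μ • 1) ^ n) v) := by
    intro n
    induction n with
    | zero => intro v; simp
    | succ n ih =>
      intro v
      have : (ad F L y - (c⁻¹ * μ) • 1) (θ.1 v) = c⁻¹ • θ.1 ((ad F L y - μ • 1) v) := by
        simp only [LinearMap.sub_apply, ad_apply, LinearMap.smul_apply, Module.End.one_apply,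
            map_sub, map_smul, θ.2 y v, hk, smul_lie, smul_sub, smul_smul, inv_mul_cancel₀ hc, one_smul]
      rw [pow_succ, Module.End.mul_apply, this, map_smul, ih, smul_smul, pow_succ, pow_succ,
        Module.End.mul_apply, mul_comm]
  rw [e2, hn, map_zero, smul_zero]

lemma lemN (hx : θ.1 x = x) (hθ : θ ^ 6 = 1) (hζ : IsPrimitiveRoot ζ 6)
    (h0 : ∀ w ∈ engel F x, θ.1 w = w → engel F x ≤ engel F w)
    {k : ℕ} {y : L} (hy : y ∈ engel F x) (hk : θ.1 y = ζ ^ k • y) (hn : engel F x ≤ engel F y) :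
    ∀ c ∈ engel F x, ⁅y, c⁆ = 0 := by
  obtain ⟨s, hs⟩ := jordan (F := F) y
  have hζ0 : ζ ≠ 0 := hζ.ne_zero (by norm_num)
  have hsc : ∀ c ∈ engel F x, ⁅s, c⁆ = 0 := by
    intro c hc
    rw [hs 0 c (mem_mge_zero.2 (hn hc)), zero_smul]
  have hsC : s ∈ engel F x := by
    rw [mem_engel_iff]
    refine ⟨1, ?_⟩
    rw [pow_one, ad_apply, ← lie_skew, hsc x (self_mem_engel F x), neg_zero]
  -- θ s
  have hse : θ.1 s = ζ ^ k • s := by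
    rw [← sub_eq_zero]
    apply ad_inj (F := F)
    ext z'
    obtain ⟨z, rfl⟩ := θ.1.surjective z'
    refine lin_ext_sup (U := (ad F L y).maxGenEigenspace)
      (Module.End.iSup_maxGenEigenspace_eq_top _) (f := ad F L (θ.1 s - ζ ^ k • s) ∘ₗ θ.1.toLinearMap)
      (g := 0) (fun μ z hz => ?_) z
    have h1 := hs _ _ (mge_aut (pow_ne_zero k hζ0) hk hz)
    show ⁅θ.1 s - ζ ^ k • s, θ.1 z⁆ = 0
    rw [sub_lie, ← θ.2, hs μ z hz, smul_lie, h1, map_smul, smul_smul, ← mul_assoc,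
      mul_inv_cancel₀ (pow_ne_zero k hζ0), one_mul, sub_self]
  set e := y - s with he
  have heC : e ∈ engel F x := sub_mem hy hsC
  have hek : θ.1 e = ζ ^ k • e := by rw [he, map_sub, hk, hse, smul_sub]
  have hen : IsNilpotent (ad F L e) := by
    apply Module.End.isNilpotent_iff_of_finite.2
    intro z
    rw [← mem_engel_iff]
    have htop : iSup (ad F L y).maxGenEigenspace = ⊤ := Module.End.iSup_maxGenEigenspace_eq_top _
    have hle : iSup (ad F L y).maxGenEigenspace ≤ (engel F e).toSubmodule := by
      refine iSup_le fun μ z hz => ?_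
      have hz' := hz
      rw [Module.End.mem_maxGenEigenspace] at hz
      obtain ⟨n, hn⟩ := hz
      refine (mem_engel_iff ..).2 ⟨n, ?_⟩
      have e2 : ∀ (n : ℕ) (v : L), v ∈ (ad F L y).maxGenEigenspace μ →
          (ad F L e ^ n) v = ((ad F L y - μ • 1) ^ n) v := by
        intro n
        induction n with
        | zero => intro v _; rfl
        | succ n ih =>
          intro v hv
          have h1 : ad F L e v = (ad F L y - μ • 1) v := by
            simp only [LinearMap.sub_apply, ad_apply, LinearMap.smul_apply, Module.End.one_apply]
            rw [he, sub_lie, hs μ v hv]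
          have h2 : (ad F L y - μ • 1) v ∈ (ad F L y).maxGenEigenspace μ := by
            apply sub_mem
            · exact Module.End.mapsTo_maxGenEigenspace_of_comm (Commute.refl _) μ hv
            · exact Submodule.smul_mem _ _ hv
          rw [pow_succ, Module.End.mul_apply, h1, ih _ h2, pow_succ, Module.End.mul_apply]
      rw [e2 n z hz', hn]
    rw [htop] at hle
    exact hle trivial
  have he0 : e = 0 := by
    obtain ⟨z, hz⟩ := exists_ee hen
    obtain ⟨a, ha, b, rfl, hb⟩ := engel_decomp (F := F) x z
    have hz1 : ⁅e, ⁅e, a⁆⁆ = e := by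
      rw [← sub_eq_zero]
      apply engel_nd (F := F) x
      · exact sub_mem (lie_mem _ heC (lie_mem _ heC ha)) heC
      · intro c hc
        have : ⁅e, ⁅e, a⁆⁆ - e = - ⁅e, ⁅e, b⁆⁆ := by
          nth_rw 3 [← hz]; rw [lie_add, lie_add]; abel
        rw [this, map_neg, LinearMap.neg_apply, LieModule.traceForm_apply_lie_apply',
          LieModule.traceForm_apply_lie_apply']
        rw [show LieModule.traceForm F L L b ⁅e, ⁅e, c⁆⁆ = 0 from hb _ (lie_mem _ heC (lie_mem _ heC hc))]
        simp
    have hz2 : ⁅e, ⁅e, pr θ ζ (5 * k) a⁆⁆ = e := by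
      rw [pr, lie_smul, lie_smul, lie_sum, lie_sum]
      have : ∀ j ∈ Finset.range 6, ⁅e, ⁅e, ζ ^ (5 * (5 * k) * j) • (θ ^ j).1 a⁆⁆ = e := by
        intro j _
        have h1 := congrArg (θ ^ j).1 hz1
        rw [(θ ^ j).2, (θ ^ j).2, theta_pow θ ζ hek, smul_lie, smul_lie, lie_smul, smul_smul] at h1
        have h2 : ζ ^ (k * j) • (ζ ^ (k * j) • ⁅e, ⁅e, (θ ^ j).1 a⁆⁆) = ζ ^ (k * j) • e := by
          rw [smul_smul]; exact h1
        have h3 := smul_right_injective L (pow_ne_zero (k * j) hζ0) h2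
        beta_reduce at h3
        rw [lie_smul, lie_smul]
        have h4 : ζ ^ (5 * (5 * k) * j) = ζ ^ (k * j) := by
          rw [show 5 * (5 * k) * j = k * j + 6 * (4 * k * j) by ring, pow_add, pow_mul ζ 6, hζ.pow_eq_one,
            one_pow, mul_one]
        rw [h4, h3]
      rw [Finset.sum_congr rfl this]
      simp [← Nat.cast_smul_eq_nsmul F, smul_smul]
    set z := pr θ ζ (5 * k) a with hzdef
    have hzC : z ∈ engel F x := engel_pr hx ha _
    have hzk : θ.1 z = ζ ^ (5 * k) • z := pr_eig hθ hζ.pow_eq_one _ _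
    have hw : θ.1 ⁅e, z⁆ = ⁅e, z⁆ := by
      rw [θ.2, hek, hzk, smul_lie, lie_smul, smul_smul, ← pow_add, show k + 5 * k = 6 * k by ring, pow_mul,
        hζ.pow_eq_one, one_pow, one_smul]
    have h1 := h0 _ (lie_mem _ heC hzC) hw heC
    obtain ⟨n, hn⟩ := (mem_engel_iff ..).1 h1
    have h2 : ∀ n : ℕ, (ad F L ⁅e, z⁆ ^ n) e = (-1 : F) ^ n • e := by
      intro n
      induction n with
      | zero => simp
      | succ n ih =>
        rw [pow_succ', Module.End.mul_apply, ih, map_smul, ad_apply, ← lie_skew, hz2, pow_succ,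
          smul_neg, mul_neg_one, neg_smul]
    rw [h2] at hn
    exact (smul_eq_zero.1 hn).resolve_left (pow_ne_zero _ (by norm_num))
  intro c hc
  rw [show y = s by rw [← sub_eq_zero]; exact he0]
  exact hsc c hc

/-- B1 -/
lemma exists_fixed_cartan (hθ : θ ^ 6 = 1) :
    ∃ x : L, θ.1 x = x ∧ (engel F x).IsCartanSubalgebra := by
  obtain ⟨ζ, hζ⟩ := HasEnoughRootsOfUnity.exists_primitiveRoot F 6
  obtain ⟨x, hx, hmin⟩ : ∃ x : L, θ.1 x = x ∧ ∀ y, θ.1 y = y →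
      Module.finrank F (engel F x) ≤ Module.finrank F (engel F y) := by
    let S : Set ℕ := {n | ∃ x : L, θ.1 x = x ∧ Module.finrank F (engel F x) = n}
    have hS : S.Nonempty := ⟨_, 0, map_zero _, rfl⟩
    obtain ⟨x, hx, hn⟩ := Nat.sInf_mem hS
    exact ⟨x, hx, fun y hy => by rw [hn]; exact Nat.sInf_le ⟨y, hy, rfl⟩⟩
  refine ⟨x, hx, ?_⟩
  have h0 : ∀ w ∈ engel F x, θ.1 w = w → engel F x ≤ engel F w := by
    intro w hw hw1
    let U : LieSubalgebra F L := engel F x ⊓ fixedSubalgebra θ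
    have hxU : x ∈ U := ⟨self_mem_engel F x, hx⟩
    let Ex : {engel F z | z ∈ U} := ⟨engel F x, x, hxU, rfl⟩
    suffices IsBot Ex from @this ⟨engel F w, w, ⟨hw, hw1⟩, rfl⟩
    apply engel_isBot_of_isMin _ U Ex inf_le_left
    · rintro ⟨_, y, hy, rfl⟩ hyx
      suffices engel F y = engel F x from this.ge
      apply LieSubalgebra.toSubmodule_injective
      exact Submodule.eq_of_le_of_finrank_le hyx (hmin y hy.2)
    · have : Infinite F := inferInstance
      exact (Cardinal.nat_lt_aleph0 _).le.trans (Cardinal.aleph0_le_mk F)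
  let P : ℕ → Prop := fun k => ∀ y ∈ engel F x, θ.1 y = ζ ^ k • y → ∀ c ∈ engel F x, ⁅y, c⁆ = 0
  have hmod : ∀ k, P (k % 6) → P k := by
    intro k hk y hy hyk
    apply hk y hy
    rw [hyk]
    conv_lhs => rw [← Nat.mod_add_div k 6, pow_add, pow_mul ζ 6, hζ.pow_eq_one, one_pow, mul_one]
  have step : ∀ k, (∀ j < 6, ∃ m, P ((j + m * k) % 6)) → P k := by
    intro k hk y hy hyk
    refine lemN hx hθ hζ h0 hy hyk ?_
    intro c hc
    rw [← pr_sum (θ := θ) hζ c]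
    refine sum_mem fun j hj => ?_
    obtain ⟨m, hm⟩ := hk j (Finset.mem_range.1 hj)
    have hcj : pr θ ζ j c ∈ engel F x := engel_pr hx hc j
    have h1 : ∀ m, (ad F L y ^ m) (pr θ ζ j c) ∈ engel F x ∧
        θ.1 ((ad F L y ^ m) (pr θ ζ j c)) = ζ ^ (j + m * k) • ((ad F L y ^ m) (pr θ ζ j c)) := by
      intro m
      induction m with
      | zero => exact ⟨by simpa using hcj, by simpa using pr_eig hθ hζ.pow_eq_one _ _⟩
      | succ m ih =>
        rw [pow_succ', Module.End.mul_apply, ad_apply]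
        refine ⟨lie_mem _ hy ih.1, ?_⟩
        rw [θ.2, ih.2, hyk, smul_lie, lie_smul, smul_smul, ← pow_add]; congr 2; ring
    have h2 := hmod _ hm _ (h1 m).1 (h1 m).2 y hy
    refine (mem_engel_iff ..).2 ⟨m + 1, ?_⟩
    rw [pow_succ', Module.End.mul_apply, ad_apply, ← lie_skew, h2, neg_zero]
  have P0 : P 0 := by
    intro y hy hyk
    exact lemN hx hθ hζ h0 hy hyk (h0 y hy (by simpa using hyk))
  have P1 : P 1 := step 1 fun j hj => ⟨6 - j, by
    rw [show (j + (6 - j) * 1) % 6 = 0 by omega]; exact P0⟩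
  have P5 : P 5 := step 5 fun j hj => ⟨j, by
    rw [show (j + j * 5) % 6 = 0 by omega]; exact P0⟩
  have P2 : P 2 := step 2 fun j hj => by
    rcases Nat.even_or_odd' j with ⟨i, rfl | rfl⟩
    · exact ⟨2 * i, by rw [show (2 * i + 2 * i * 2) % 6 = 0 by omega]; exact P0⟩
    · exact ⟨2 * i + 2, by rw [show (2 * i + 1 + (2 * i + 2) * 2) % 6 = 5 by omega]; exact P5⟩
  have P4 : P 4 := step 4 fun j hj => by
    rcases Nat.even_or_odd' j with ⟨i, rfl | rfl⟩
    · exact ⟨i, by rw [show (2 * i + i * 4) % 6 = 0 by omega]; exact P0⟩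
    · exact ⟨i, by rw [show (2 * i + 1 + i * 4) % 6 = 1 by omega]; exact P1⟩
  have P3 : P 3 := step 3 fun j hj => by
    have : j = 0 ∨ j = 1 ∨ j = 2 ∨ j = 3 ∨ j = 4 ∨ j = 5 := by omega
    rcases this with rfl | rfl | rfl | rfl | rfl | rfl
    · exact ⟨0, P0⟩
    · exact ⟨0, P1⟩
    · exact ⟨0, P2⟩
    · exact ⟨1, P0⟩
    · exact ⟨0, P4⟩
    · exact ⟨0, P5⟩
  have hab : ∀ y ∈ engel F x, ∀ c ∈ engel F x, ⁅y, c⁆ = 0 := by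
    intro y hy c hc
    rw [← pr_sum (θ := θ) hζ y, sum_lie]
    refine Finset.sum_eq_zero fun k hk => ?_
    have hP : P k := by
      rw [Finset.mem_range] at hk
      interval_cases k <;> assumption
    exact hP _ (engel_pr hx hy k) (pr_eig hθ hζ.pow_eq_one _ _) c hc
  have : IsLieAbelian (engel F x) := ⟨fun a b => Subtype.ext (hab a.1 a.2 b.1 b.2)⟩
  exact ⟨inferInstance, normalizer_engel F x⟩

end E8

namespace E8

open MvPolynomial in
theorem chain_rule {F : Type*} [Field F] {n : ℕ} (f : Fin n → MvPolynomial (Fin n) F) (j : Fin n)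
    (P : MvPolynomial (Fin n) F) :
    pderiv j (aeval f P) = ∑ k, pderiv j (f k) * aeval f (pderiv k P) := by
  induction P using MvPolynomial.induction_on with
  | C a => simp
  | add p q hp hq => simp only [map_add, hp, hq, mul_add, Finset.sum_add_distrib]
  | mul_X p i h =>
    rw [map_mul, pderiv_mul, h, aeval_X]
    simp only [pderiv_mul, map_add, map_mul, aeval_X, mul_add, Finset.sum_add_distrib, pderiv_X]
    rw [Finset.sum_mul]
    congr 1
    · exact Finset.sum_congr rfl fun k _ => by ring
    · rw [Finset.sum_eq_single i]
      · simp; ring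
      · intro b _ hb; simp [Pi.single_apply, hb.symm]
      · simp

open MvPolynomial in
theorem jac_indep {F : Type*} [Field F] [CharZero F] {n : ℕ} (f : Fin n → MvPolynomial (Fin n) F)
    (u : Fin n → F)
    (hJ : (Matrix.of fun j k => eval u (pderiv j (f k))).det ≠ 0) : AlgebraicIndependent F f := by
  rw [algebraicIndependent_iff]
  have key : ∀ d : ℕ, ∀ P : MvPolynomial (Fin n) F,
      (∀ m : Fin n →₀ ℕ, d ≤ m.degree → coeff m P = 0) → aeval f P = 0 → P = 0 := by
    intro d
    induction d with
    | zero => intro P h _; ext m; simpa using h m (Nat.zero_le _)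
    | succ d ih =>
      intro P h hP
      have hdet : (Matrix.of fun j k => pderiv j (f k)).det ≠ 0 := by
        intro h0
        apply hJ
        have := congrArg (eval u) h0
        rw [RingHom.map_det, map_zero] at this
        rw [← this]; rfl
      have hz : ∀ k, aeval f (pderiv k P) = 0 := by
        have := Matrix.eq_zero_of_mulVec_eq_zero hdet (v := fun k => aeval f (pderiv k P)) (by
          funext j
          have := chain_rule f j P
          rw [hP, map_zero] at this
          simpa [Matrix.mulVec, dotProduct] using this.symm)
        exact fun k => congrFun this k
      have hk : ∀ k, pderiv k P = 0 := fun k => ih _ (fun m hm => by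
        rw [coeff_pderiv, h, zero_mul]
        rw [map_add, Finsupp.degree_single]; omega) (hz k)
      have hc : P = C (coeff 0 P) := by
        ext m
        by_cases hm : m = 0
        · subst hm; simp
        · rw [coeff_C, if_neg (Ne.symm hm)]
          obtain ⟨k, hk'⟩ : ∃ k, m k ≠ 0 := by
            by_contra hcon; push Not at hcon; exact hm (Finsupp.ext hcon)
          have := coeff_pderiv (i := k) P (m - Finsupp.single k 1)
          rw [hk k, coeff_zero, tsub_add_cancel_of_le (by
            rw [Finsupp.single_le_iff]; omega)] at this
          have h2 : (((m - Finsupp.single k 1 : Fin n →₀ ℕ) k : F) + 1) ≠ 0 := by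
            exact Nat.cast_add_one_ne_zero _
          exact (mul_eq_zero.mp this.symm).resolve_right h2
      rw [hc] at hP ⊢
      simp at hP
      rw [hP]; simp
  intro P hP
  exact key (P.totalDegree + 1) P (fun m hm => by
    by_contra hne
    have := le_totalDegree (mem_support_iff.mpr hne)
    have h3 : m.degree = m.sum fun _ e => e := rfl
    omega) hP

open MvPolynomial in
/-- embedding of the source polynomial ring sending `f k` to `t k` -/
theorem exists_embed {F : Type} [Field F] {n : ℕ} (f : Fin n → MvPolynomial (Fin n) F)
    (hf : AlgebraicIndependent F f) {Ω : Type} [Field Ω] [Algebra F Ω] [IsAlgClosed Ω]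
    (ι : MvPolynomial (Fin n) F →ₐ[F] Ω) (hι : Function.Injective ι) :
    ∃ φ : MvPolynomial (Fin n) F →ₐ[F] Ω,
      Function.Injective φ ∧ ∀ k, φ (f k) = ι (X k) := by
  have htb : IsTranscendenceBasis F f := by
    apply hf.isTranscendenceBasis_of_trdeg_le_of_finite
    rw [MvPolynomial.trdeg_of_isDomain]; simp
  have halg := htb.isAlgebraic
  let ψ : (Algebra.adjoin F (Set.range f)) →ₐ[F] Ω := ι.comp (hf.aevalEquiv.symm : _ →ₐ[F] _)
  have hψ : Function.Injective ψ := hι.comp hf.aevalEquiv.symm.injective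
  letI : Algebra (Algebra.adjoin F (Set.range f)) Ω := ψ.toRingHom.toAlgebra
  haveI : FaithfulSMul (Algebra.adjoin F (Set.range f)) Ω :=
    (faithfulSMul_iff_algebraMap_injective _ _).mpr hψ
  have hcomp : ∀ a, algebraMap (Algebra.adjoin F (Set.range f)) Ω a = ψ a := fun a => rfl
  let φ0 : MvPolynomial (Fin n) F →ₐ[Algebra.adjoin F (Set.range f)] Ω := IsAlgClosed.lift
  have h0 : ∀ a : Algebra.adjoin F (Set.range f), φ0 a.1 = ψ a := fun a => by
    have := φ0.commutes a
    rw [hcomp] at this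
    exact this
  refine ⟨{ φ0.toRingHom with
    commutes' := fun c => ?_ }, ?_, ?_⟩
  · have := h0 (algebraMap F _ c)
    rw [AlgHom.commutes] at this
    exact this
  · refine (injective_iff_map_eq_zero (φ0.toRingHom)).mpr fun s hs => ?_
    by_contra hne
    obtain ⟨r, hr, c, hc⟩ := (halg.isAlgebraic s).exists_nonzero_dvd
      (mem_nonZeroDivisors_of_ne_zero hne)
    apply hr
    apply hψ
    rw [map_zero, ← h0]
    have h1 : (r : MvPolynomial (Fin n) F) = s * c := hc
    rw [h1, map_mul, show φ0 s = 0 from hs, zero_mul]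
  · intro k
    have h1 := h0 ⟨f k, Algebra.subset_adjoin ⟨k, rfl⟩⟩
    have h2 : (hf.aevalEquiv.symm ⟨f k, Algebra.subset_adjoin ⟨k, rfl⟩⟩) = X k := by
      rw [AlgEquiv.symm_apply_eq]
      apply Subtype.ext
      simp
    have h3 : ψ ⟨f k, Algebra.subset_adjoin ⟨k, rfl⟩⟩ = ι (X k) := congrArg ι h2
    exact h1.trans h3

open MvPolynomial in
/-- two dominant maps have a common value, off given hypersurfaces -/
theorem common_value {F : Type} [Field F] [IsAlgClosed F] {n : ℕ}
    (f f' : Fin n → MvPolynomial (Fin n) F)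
    (hf : AlgebraicIndependent F f) (hf' : AlgebraicIndependent F f')
    (d d' : MvPolynomial (Fin n) F) (hd : d ≠ 0) (hd' : d' ≠ 0) :
    ∃ u u' : Fin n → F, eval u d ≠ 0 ∧ eval u' d' ≠ 0 ∧ ∀ k, eval u (f k) = eval u' (f' k) := by
  let Ω := AlgebraicClosure (FractionRing (MvPolynomial (Fin n) F))
  let ι : MvPolynomial (Fin n) F →ₐ[F] Ω := IsScalarTower.toAlgHom F _ Ω
  have hι : Function.Injective ι := ((algebraMap (FractionRing (MvPolynomial (Fin n) F)) Ω).injective).comp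
    (IsFractionRing.injective (MvPolynomial (Fin n) F) (FractionRing (MvPolynomial (Fin n) F)))
  obtain ⟨φ, hφ, hφk⟩ := exists_embed f hf ι hι
  obtain ⟨φ', hφ', hφk'⟩ := exists_embed f' hf' ι hι
  by_contra hcon
  push Not at hcon
  let I : Ideal (MvPolynomial (Fin n ⊕ Fin n) F) :=
    Ideal.span (Set.range fun k => rename Sum.inl (f k) - rename Sum.inr (f' k))
  let Φ : MvPolynomial (Fin n ⊕ Fin n) F →ₐ[F] Ω :=
    aeval (Sum.elim (fun i => φ (X i)) (fun i => φ' (X i)))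
  have hl : ∀ p, Φ (rename Sum.inl p) = φ p := fun p => by
    simp only [Φ, aeval_rename, Sum.elim_comp_inl]
    exact congrArg (fun g : _ →ₐ[F] Ω => g p)
      (show aeval (fun i => φ (X i)) = φ from (aeval_unique φ).symm)
  have hr : ∀ p, Φ (rename Sum.inr p) = φ' p := fun p => by
    simp only [Φ, aeval_rename, Sum.elim_comp_inr]
    exact congrArg (fun g : _ →ₐ[F] Ω => g p)
      (show aeval (fun i => φ' (X i)) = φ' from (aeval_unique φ').symm)
  have hI : I ≤ RingHom.ker Φ.toRingHom := by
    rw [Ideal.span_le]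
    rintro _ ⟨k, rfl⟩
    show Φ _ = 0
    rw [map_sub, hl, hr, hφk, hφk', sub_self]
  have hrad : rename Sum.inl d * rename Sum.inr d' ∈ I.radical := by
    rw [← MvPolynomial.vanishingIdeal_zeroLocus_eq_radical (K := F)]
    rw [mem_vanishingIdeal_iff]
    intro w hw
    rw [mem_zeroLocus_iff] at hw
    by_contra hne
    have e1 : ∀ p, aeval w (rename Sum.inl p : MvPolynomial (Fin n ⊕ Fin n) F) = eval (w ∘ Sum.inl) p := fun p => by
      rw [aeval_rename]; rfl
    have e2 : ∀ p, aeval w (rename Sum.inr p : MvPolynomial (Fin n ⊕ Fin n) F) = eval (w ∘ Sum.inr) p := fun p => by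
      rw [aeval_rename]; rfl
    rw [map_mul, e1, e2] at hne
    obtain ⟨k, hk⟩ := hcon (w ∘ Sum.inl) (w ∘ Sum.inr) (left_ne_zero_of_mul hne) (right_ne_zero_of_mul hne)
    apply hk
    have := hw _ (Ideal.subset_span ⟨k, rfl⟩)
    rw [map_sub, e1, e2] at this
    exact sub_eq_zero.mp this
  obtain ⟨N, hN⟩ := hrad
  have := hI hN
  have h0 : Φ ((rename Sum.inl d * rename Sum.inr d') ^ N) = 0 := this
  rw [map_pow, map_mul, hl, hr] at h0
  have h1 := pow_eq_zero_iff (by rintro rfl; simp at h0) |>.mp h0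
  rcases mul_eq_zero.mp h1 with h | h
  · exact hd (hφ (by rw [h, map_zero]))
  · exact hd' (hφ' (by rw [h, map_zero]))
end E8

namespace E8

section
variable {F L : Type} [Field F] [LieRing L] [LieAlgebra F L] {n : ℕ}

/-- `Φ` is polynomial in coordinates, with differential `D` at `u0`. -/
def PolyAt (B : Module.Basis (Fin n) F L) (u0 : Fin n → F) (Φ : (Fin n → F) → L) (D : Fin n → L) : Prop :=
  ∃ f : Fin n → MvPolynomial (Fin n) F,
    (∀ u k, MvPolynomial.eval u (f k) = B.repr (Φ u) k) ∧
    ∀ j k, MvPolynomial.eval u0 (MvPolynomial.pderiv j (f k)) = B.repr (D j) k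

variable {B : Module.Basis (Fin n) F L} {u0 : Fin n → F}

theorem PolyAt.const (B : Module.Basis (Fin n) F L) (u0 : Fin n → F) (c : L) :
    PolyAt B u0 (fun _ => c) (fun _ => 0) :=
  ⟨fun k => MvPolynomial.C (B.repr c k), by simp, by simp⟩

theorem PolyAt.add {Φ Ψ : (Fin n → F) → L} {D E : Fin n → L} (h : PolyAt B u0 Φ D)
    (h' : PolyAt B u0 Ψ E) : PolyAt B u0 (fun u => Φ u + Ψ u) (fun j => D j + E j) := by
  obtain ⟨f, h1, h2⟩ := h
  obtain ⟨g, h3, h4⟩ := h'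
  exact ⟨fun k => f k + g k, by simp [h1, h3], by simp [h2, h4]⟩

theorem PolyAt.lin {Φ : (Fin n → F) → L} {D : Fin n → L} (T : L →ₗ[F] L) (h : PolyAt B u0 Φ D) :
    PolyAt B u0 (fun u => T (Φ u)) (fun j => T (D j)) := by
  obtain ⟨f, h1, h2⟩ := h
  have hT : ∀ y k, B.repr (T y) k = ∑ l, B.repr (T (B l)) k * B.repr y l := by
    intro y k
    have h : B.repr (T y) k = B.repr (T (∑ l, B.repr y l • B l)) k := by rw [B.sum_repr]
    rw [h, map_sum, map_sum, Finsupp.finset_sum_apply]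
    exact Finset.sum_congr rfl fun l _ => by rw [map_smul, map_smul, Finsupp.smul_apply, smul_eq_mul, mul_comm]
  refine ⟨fun k => ∑ l, MvPolynomial.C (B.repr (T (B l)) k) * f l, ?_, ?_⟩
  · intro u k; rw [hT]; simp [h1]
  · intro j k; rw [hT]; simp [MvPolynomial.pderiv_C_mul, h2]

theorem PolyAt.smulX {Φ : (Fin n → F) → L} {D : Fin n → L} (i : Fin n) (h : PolyAt B u0 Φ D) :
    PolyAt B u0 (fun u => u i • Φ u) (fun j => (if j = i then Φ u0 else 0) + u0 i • D j) := by
  obtain ⟨f, h1, h2⟩ := h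
  refine ⟨fun k => MvPolynomial.X i * f k, by simp [h1], ?_⟩
  intro j k
  by_cases hj : j = i
  · subst hj; simp [MvPolynomial.pderiv_mul, h1, h2, add_comm]
  · simp [MvPolynomial.pderiv_mul, h1, h2, hj, MvPolynomial.pderiv_X_of_ne (Ne.symm hj)]

theorem PolyAt.congr {Φ Ψ : (Fin n → F) → L} {D E : Fin n → L} (h : PolyAt B u0 Φ D)
    (h1 : ∀ u, Ψ u = Φ u) (h2 : ∀ j, E j = D j) : PolyAt B u0 Ψ E := by
  rw [show Ψ = Φ from funext h1, show E = D from funext h2]; exact h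

theorem PolyAt.powX {Φ : (Fin n → F) → L} {D : Fin n → L} {i : Fin n} (hi : u0 i = 0)
    (h : PolyAt B u0 Φ D) (m : ℕ) :
    PolyAt B u0 (fun u => u i ^ m • Φ u)
      (fun j => if m = 0 then D j else if m = 1 then (if j = i then Φ u0 else 0) else 0) := by
  induction m with
  | zero => simpa using h
  | succ m ih =>
    refine (ih.smulX i).congr (fun u => by rw [pow_succ', mul_smul]) fun j => ?_
    rw [hi]
    rcases m with _ | m <;> simp

theorem PolyAt.expo [CharZero F] {Φ : (Fin n → F) → L} {D : Fin n → L} {i : Fin n} (hi : u0 i = 0)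
    (A : L →ₗ[F] L) (h : PolyAt B u0 Φ D) (N : ℕ) :
    PolyAt B u0 (fun u => ∑ m ∈ Finset.range (N + 2), ((m.factorial : F)⁻¹ * u i ^ m) • (A ^ m) (Φ u))
      (fun j => D j + if j = i then A (Φ u0) else 0) := by
  induction N with
  | zero =>
    refine ((h.powX hi 0).add ((h.powX hi 1).lin A)).congr (fun u => ?_) fun j => ?_
    · simp [Finset.sum_range_succ]
    · by_cases hj : j = i <;> simp [hj]
  | succ N ih =>
    refine (ih.add ((h.powX hi (N + 2)).lin ((((N + 2).factorial : F)⁻¹) • A ^ (N + 2)))).congr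
      (fun u => ?_) fun j => ?_
    · rw [Finset.sum_range_succ _ (N + 2)]
      simp only [LinearMap.smul_apply, map_smul, smul_smul, mul_comm]
    · simp

theorem PolyAt.sumX (s : Finset (Fin n)) (b : Fin n → L) :
    PolyAt B u0 (fun u => ∑ j ∈ s, u j • b j) (fun j => if j ∈ s then b j else 0) := by
  induction s using Finset.induction_on with
  | empty => simpa using PolyAt.const B u0 (0 : L)
  | insert a s ha ih =>
    refine (((PolyAt.const B u0 (b a)).smulX a).add ih).congr (fun u => ?_) fun j => ?_
    · rw [Finset.sum_insert ha]
    · by_cases hj : j = a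
      · subst hj; simp [ha]
      · simp [hj]

/-- a subalgebra together with enough nilpotent eigenvectors -/
def Spl (C : LieSubalgebra F L) (x : L) : Prop :=
  x ∈ C ∧ (∀ a ∈ C, ∀ b ∈ C, ⁅a, b⁆ = 0) ∧
  Submodule.span F ((C : Set L) ∪ {y | IsNilpotent (ad F L y) ∧
    ∃ α : L → F, α x ≠ 0 ∧ ∀ c ∈ C, ⁅c, y⁆ = α c • y}) = ⊤

theorem PolyAt.orbit [CharZero F] {T : Finset (Fin n)} {b : Fin n → L} (N : ℕ)
    (hn : ∀ i ∉ T, (ad F L (b i)) ^ N = 0)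
    (hu0 : ∀ i ∉ T, u0 i = 0) (l : List (Fin n)) (hl : ∀ i ∈ l, i ∉ T) (hnd : l.Nodup) :
    ∃ Φ, PolyAt B u0 Φ (fun j => (if j ∈ T then b j else 0) +
        if j ∈ l then ⁅b j, ∑ j ∈ T, u0 j • b j⁆ else 0) ∧
      (Φ u0 = ∑ j ∈ T, u0 j • b j) ∧ ∀ u, ∃ g : lieAut F L, Φ u = g.1 (∑ j ∈ T, u j • b j) := by
  induction l with
  | nil => exact ⟨_, by simpa using PolyAt.sumX T b, rfl, fun u => ⟨1, rfl⟩⟩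
  | cons i l ih =>
    obtain ⟨Φ, h1, h2, h3⟩ := ih (fun j hj => hl j (by simp [hj])) (List.nodup_cons.mp hnd).2
    have hi := hl i (by simp)
    have hil := (List.nodup_cons.mp hnd).1
    refine ⟨_, (h1.expo (hu0 i hi) (ad F L (b i)) N).congr (fun u => rfl) ?_, ?_, ?_⟩
    · intro j
      by_cases hj : j = i
      · subst hj; rw [h2]; simp only [hil, hi, if_false, if_true, List.mem_cons, true_or, zero_add, ad_apply]
      · simp [hj]
    · rw [hu0 i hi, Finset.sum_range_succ', Finset.sum_eq_zero]
      · simp [h2]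
      · intro m _; simp
    · intro u
      obtain ⟨g, hg⟩ := h3 u
      have hnil : IsNilpotent (ad F L (u i • b i)) := ⟨N, by
        rw [map_smul, smul_pow, hn i hi, smul_zero]⟩
      refine ⟨expA _ hnil * g, ?_⟩
      have := expA_apply _ hnil (N + 2) (Φ u) (by
        rw [map_smul, smul_pow, pow_add (ad F L (b i)), hn i hi, zero_mul, smul_zero]; rfl)
      show _ = (expA _ hnil).1 (g.1 _)
      rw [← hg, this]
      refine Finset.sum_congr rfl fun m _ => ?_
      rw [map_smul, smul_pow, LinearMap.smul_apply, smul_smul]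

theorem Spl.exists_frame [FiniteDimensional F L] {C : LieSubalgebra F L} {x : L} (h : Spl C x) :
    ∃ b : Module.Basis (Fin (Module.finrank F L)) F L, ∀ i, b i ∈ C ∨
      (IsNilpotent (ad F L (b i)) ∧ ∃ α : L → F, α x ≠ 0 ∧ ∀ c ∈ C, ⁅c, b i⁆ = α c • b i) := by
  obtain ⟨-, -, h⟩ := h
  have hb := Module.Basis.ofSpan_subset (K := F) h.ge
  let b := Module.Basis.ofSpan (K := F) h.ge
  have : Fintype (LinearIndepOn.extend (linearIndepOn_empty F (id : L → L)) (Set.empty_subset (((C : Set L) ∪ {y | IsNilpotent (ad F L y) ∧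
    ∃ α : L → F, α x ≠ 0 ∧ ∀ c ∈ C, ⁅c, y⁆ = α c • y})))) := FiniteDimensional.fintypeBasisIndex b
  refine ⟨b.reindex (Fintype.equivFinOfCardEq (Module.finrank_eq_card_basis b).symm), fun i => ?_⟩
  have := hb ⟨(Fintype.equivFinOfCardEq (Module.finrank_eq_card_basis b).symm).symm i, rfl⟩
  rw [Module.Basis.reindex_apply]
  exact this

theorem Spl.data [CharZero F] {C : LieSubalgebra F L} {x : L}
    (h : Spl C x) (B b : Module.Basis (Fin n) F L) (hb : ∀ i, b i ∈ C ∨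
      (IsNilpotent (ad F L (b i)) ∧ ∃ α : L → F, α x ≠ 0 ∧ ∀ c ∈ C, ⁅c, b i⁆ = α c • b i)) :
    ∃ (f : Fin n → MvPolynomial (Fin n) F) (d : MvPolynomial (Fin n) F),
      AlgebraicIndependent F f ∧ d ≠ 0 ∧ ∀ u, MvPolynomial.eval u d ≠ 0 →
        ∃ (g : lieAut F L) (y : L), (∀ k, MvPolynomial.eval u (f k) = B.repr (g.1 y) k) ∧
          LieSubalgebra.engel F y = C := by
  classical
  obtain ⟨hx, hab, -⟩ := h
  let T : Finset (Fin n) := Finset.univ.filter fun i => b i ∈ C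
  have hT : ∀ i, i ∈ T ↔ b i ∈ C := fun i => by simp [T]
  have hb' : ∀ i, i ∉ T → IsNilpotent (ad F L (b i)) ∧ ∃ α : L → F, α x ≠ 0 ∧ ∀ c ∈ C, ⁅c, b i⁆ = α c • b i :=
    fun i hi => (hb i).resolve_left (by rwa [← hT])
  have hα : ∀ i, ∃ α : L → F, i ∉ T → α x ≠ 0 ∧ ∀ c ∈ C, ⁅c, b i⁆ = α c • b i := by
    intro i
    by_cases hi : i ∈ T
    · exact ⟨fun _ => 0, fun h => absurd hi h⟩
    · obtain ⟨α, h⟩ := (hb' i hi).2; exact ⟨α, fun _ => h⟩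
  choose α hα using hα
  have hN : ∃ N, ∀ i ∉ T, (ad F L (b i)) ^ N = 0 := by
    have : ∀ i, ∃ N, i ∉ T → (ad F L (b i)) ^ N = 0 := fun i => by
      by_cases hi : i ∈ T
      · exact ⟨0, fun h => absurd hi h⟩
      · obtain ⟨N, h⟩ := (hb' i hi).1; exact ⟨N, fun _ => h⟩
    choose N hN using this
    exact ⟨∑ i, N i, fun i hi => pow_eq_zero_of_le
      (Finset.single_le_sum (fun _ _ => Nat.zero_le _) (Finset.mem_univ i)) (hN i hi)⟩
  obtain ⟨N, hN⟩ := hN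
  let u0 : Fin n → F := fun i => b.repr x i
  -- action of an element of `C`
  have act : ∀ h ∈ C, ∀ y, ∀ i, b.repr ⁅h, y⁆ i = if i ∈ T then 0 else α i h * b.repr y i := by
    intro h hh y i
    have e : ⁅h, y⁆ = ∑ j, b.repr y j • (if j ∈ T then 0 else α j h • b j) := by
      conv_lhs => rw [← b.sum_repr y]
      rw [lie_sum]
      refine Finset.sum_congr rfl fun j _ => ?_
      rw [lie_smul]
      split_ifs with hj
      · rw [hab h hh _ ((hT j).mp hj)]
      · rw [(hα j hj).2 h hh]
    rw [e, map_sum, Finsupp.finset_sum_apply, Finset.sum_eq_single i]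
    · split_ifs <;> simp [mul_comm]
    · intro j _ hj
      split_ifs <;> simp [Finsupp.single_apply, hj]
    · simp
  have hu0 : ∀ i ∉ T, u0 i = 0 := by
    intro i hi
    have := act x hx x i
    rw [lie_self, if_neg hi] at this
    simpa [(hα i hi).1] using this
  have hxs : x = ∑ j ∈ T, u0 j • b j := by
    conv_lhs => rw [← b.sum_repr x]
    symm
    apply Finset.sum_subset (Finset.subset_univ _)
    intro j _ hj
    rw [hu0 j hj, zero_smul]
  have hC : ∀ y, (∀ i ∉ T, b.repr y i = 0) → y ∈ C := by
    intro y hy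
    rw [← b.sum_repr y]
    refine sum_mem fun i _ => ?_
    by_cases hi : i ∈ T
    · exact C.smul_mem _ ((hT i).mp hi)
    · rw [hy i hi, zero_smul]; exact C.zero_mem
  obtain ⟨Φ, ⟨f, hf1, hf2⟩, -, hΦ⟩ := PolyAt.orbit (B := B) (u0 := u0) N hN hu0 (Finset.univ \ T).toList
    (by simp) (Finset.nodup_toList _)
  rw [← hxs] at hf2
  let d : MvPolynomial (Fin n) F :=
    ∏ i ∈ Finset.univ \ T, ∑ j ∈ T, MvPolynomial.C (α i (b j)) * MvPolynomial.X j
  have hsum : ∀ u : Fin n → F, ∑ j ∈ T, u j • b j ∈ C := fun u =>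
    sum_mem fun j hj => C.smul_mem _ ((hT j).mp hj)
  have hαs : ∀ (u : Fin n → F), ∀ i ∉ T, ∑ j ∈ T, α i (b j) * u j = α i (∑ j ∈ T, u j • b j) := by
    intro u i hi
    have h1 := (hα i hi).2 _ (hsum u)
    have h2 : ⁅∑ j ∈ T, u j • b j, b i⁆ = (∑ j ∈ T, α i (b j) * u j) • b i := by
      rw [sum_lie, Finset.sum_smul]
      refine Finset.sum_congr rfl fun j hj => ?_
      rw [smul_lie, (hα i hi).2 _ ((hT j).mp hj), smul_smul, mul_comm]
    rw [h1] at h2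
    exact (smul_left_injective F (b.ne_zero i) h2).symm
  have hdev : ∀ u, MvPolynomial.eval u d = ∏ i ∈ Finset.univ \ T, α i (∑ j ∈ T, u j • b j) := by
    intro u
    simp only [d, map_prod, map_sum, map_mul, MvPolynomial.eval_C, MvPolynomial.eval_X]
    exact Finset.prod_congr rfl fun i hi => hαs u i (by simpa using hi)
  refine ⟨f, d, ?_, ?_, ?_⟩
  · apply jac_indep f u0
    let w : Fin n → F := fun j => if j ∈ T then 1 else -α j x
    have hw : ∀ j, IsUnit (w j) := fun j => by
      simp only [w]
      split_ifs with hj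
      · exact isUnit_one
      · exact (neg_ne_zero.mpr (hα j hj).1).isUnit
    have hM : (Matrix.of fun j k => MvPolynomial.eval u0 (MvPolynomial.pderiv j (f k))) =
        (B.toMatrix (b.isUnitSMul hw)).transpose := by
      ext j k
      rw [Matrix.of_apply, hf2, Matrix.transpose_apply, Module.Basis.toMatrix_apply,
        Module.Basis.isUnitSMul_apply]
      congr 2
      by_cases hj : j ∈ T
      · simp [w, hj]
      · simp only [w, hj, if_false, Finset.mem_toList, Finset.mem_sdiff, Finset.mem_univ, true_and,
          not_false_eq_true, if_true, zero_add]
        rw [← lie_skew, (hα j hj).2 x hx, neg_smul]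
    rw [hM, Matrix.det_transpose]
    have := (Module.Basis.is_basis_iff_det B).mp ⟨(b.isUnitSMul hw).linearIndependent, (b.isUnitSMul hw).span_eq⟩
    exact this.ne_zero
  · intro h0
    have := hdev u0
    rw [h0, map_zero, ← hxs] at this
    exact Finset.prod_ne_zero_iff.mpr (fun i hi => (hα i (by simpa using hi)).1) this.symm
  · intro u hu
    obtain ⟨g, hg⟩ := hΦ u
    refine ⟨g, _, fun k => by rw [hf1, hg], ?_⟩
    rw [hdev] at hu
    have hne : ∀ i ∉ T, α i (∑ j ∈ T, u j • b j) ≠ 0 := fun i hi =>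
      Finset.prod_ne_zero_iff.mp hu i (by simpa using hi)
    have hh := hsum u
    generalize (∑ j ∈ T, u j • b j) = h at *
    ext y
    rw [LieSubalgebra.mem_engel_iff]
    constructor
    · rintro ⟨m, hm⟩
      apply hC
      intro i hi
      have : ∀ m, b.repr ((ad F L h ^ m) y) i = α i h ^ m * b.repr y i := by
        intro m
        induction m with
        | zero => simp
        | succ m ih => rw [pow_succ', Module.End.mul_apply, ad_apply, act h hh, if_neg hi, ih]; ring
      have h2 := this m
      rw [hm, map_zero] at h2
      simpa [hne i hi] using h2
    · intro hy
      exact ⟨1, by rw [pow_one, ad_apply, hab h hh y hy]⟩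

/-- conjugacy of Cartan subalgebras -/
theorem csa_conj [CharZero F] [IsAlgClosed F] [FiniteDimensional F L] {C C' : LieSubalgebra F L} {x x' : L}
    (h : Spl C x) (h' : Spl C' x') : ∃ g : lieAut F L, ∀ y, y ∈ C → g.1 y ∈ C' := by
  obtain ⟨b, hb⟩ := h.exists_frame
  obtain ⟨b', hb'⟩ := h'.exists_frame
  obtain ⟨f, d, h1, h2, h3⟩ := h.data b b hb
  obtain ⟨f', d', h1', h2', h3'⟩ := h'.data b b' hb'
  obtain ⟨u, u', hu, hu', he⟩ := common_value f f' h1 h1' d d' h2 h2'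
  obtain ⟨g, y, hg, hy⟩ := h3 u hu
  obtain ⟨g', y', hg', hy'⟩ := h3' u' hu'
  have : g.1 y = g'.1 y' := b.repr.injective (Finsupp.ext fun k => by rw [← hg, ← hg', he])
  have h4 : (g'⁻¹ * g).1 y = y' := by
    show (g'⁻¹).1 (g.1 y) = y'
    rw [this]
    show (g'⁻¹ * g').1 y' = y'
    rw [inv_mul_cancel]; rfl
  refine ⟨g'⁻¹ * g, fun z hz => ?_⟩
  rw [← hy, LieSubalgebra.mem_engel_iff] at hz
  rw [← hy', LieSubalgebra.mem_engel_iff]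
  obtain ⟨m, hm⟩ := hz
  refine ⟨m, ?_⟩
  rw [← h4, ← aut_ad_pow, hm, map_zero]
end
end E8

namespace E8

section
variable {F L : Type} [Field F] [LieRing L] [LieAlgebra F L] [CharZero F]

theorem spl_engel [IsAlgClosed F] [FiniteDimensional F L] [IsKilling F L] {x : L}
    (h : (LieSubalgebra.engel F x).IsCartanSubalgebra) : Spl (LieSubalgebra.engel F x) x := by
  have hab : ∀ a ∈ LieSubalgebra.engel F x, ∀ b ∈ LieSubalgebra.engel F x, ⁅a, b⁆ = 0 := by
    intro a ha b hb
    have := trivial_lie_zero (LieSubalgebra.engel F x) (LieSubalgebra.engel F x) ⟨a, ha⟩ ⟨b, hb⟩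
    exact congrArg Subtype.val this
  refine ⟨LieSubalgebra.self_mem_engel F x, hab, ?_⟩
  rw [eq_top_iff, ← LieSubmodule.top_toSubmodule (R := F) (L := LieSubalgebra.engel F x) (M := L),
    ← LieModule.iSup_genWeightSpace_eq_top' F (LieSubalgebra.engel F x) L,
    LieSubmodule.iSup_toSubmodule, iSup_le_iff]
  intro χ y hy
  apply Submodule.subset_span
  have hy' : y ∈ rootSpace (LieSubalgebra.engel F x) χ := hy
  have hl : ∀ c : LieSubalgebra.engel F x, ⁅c.1, y⁆ = χ c • y := fun c =>
    LieAlgebra.IsKilling.lie_eq_smul_of_mem_rootSpace hy' c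
  by_cases hx : χ ⟨x, LieSubalgebra.self_mem_engel F x⟩ = 0
  · left
    show y ∈ LieSubalgebra.engel F x
    rw [LieSubalgebra.mem_engel_iff]
    refine ⟨1, ?_⟩
    rw [pow_one, ad_apply]
    exact (hl ⟨x, LieSubalgebra.self_mem_engel F x⟩).trans (by rw [hx, zero_smul])
  · right
    have hne : (χ : LieSubalgebra.engel F x → F) ≠ 0 := fun h0 => hx (by rw [h0]; rfl)
    classical
    refine ⟨LieAlgebra.isNilpotent_ad_of_mem_rootSpace (LieSubalgebra.engel F x) hne hy',
      fun c => if hc : c ∈ LieSubalgebra.engel F x then χ ⟨c, hc⟩ else 0, ?_, ?_⟩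
    · beta_reduce; rw [dif_pos (LieSubalgebra.self_mem_engel F x)]; exact hx
    · intro c hc
      beta_reduce; rw [dif_pos hc]
      exact hl ⟨c, hc⟩

/-- value of a root on a diagonal element -/
def evl (a : Fin 8 → F) (l : V) : F := ∑ j, ((l j : ℤ) : F) * a j

theorem evl_add (a : Fin 8 → F) (l m : V) : evl a (l + m) = evl a l + evl a m := by
  simp [evl, add_mul, Finset.sum_add_distrib]
theorem evl_neg (a : Fin 8 → F) (l : V) : evl a (-l) = -evl a l := by
  simp [evl]
theorem evl_al (a : Fin 8 → F) (i : Fin 8) : evl a (al i) = a i := by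
  simp [evl, Pi.single_apply]

namespace Gen
theorem H_act (G : Gen F L) {h : L} (hh : h ∈ G.W 0) :
    ∃ a : Fin 8 → F, ∀ l, ∀ y ∈ G.W l, ⁅h, y⁆ = evl a l • y := by
  rw [G.W_zero, Hs] at hh
  induction hh using Submodule.span_induction with
  | mem x hx =>
    obtain ⟨i, rfl⟩ := hx
    refine ⟨fun j => ((CartanMatrix.E₈ i j : ℤ) : F), fun l y hy => ?_⟩
    rw [mem_W.mp hy i]
    congr 1
    simp [evl, ca, mul_comm]
  | zero => exact ⟨0, by simp [evl]⟩
  | add x y _ _ hx hy =>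
    obtain ⟨a, ha⟩ := hx
    obtain ⟨b, hb⟩ := hy
    refine ⟨a + b, fun l z hz => ?_⟩
    rw [add_lie, ha l z hz, hb l z hz, ← add_smul]
    congr 1
    simp [evl, mul_add, Finset.sum_add_distrib]
  | smul c x _ hx =>
    obtain ⟨a, ha⟩ := hx
    refine ⟨c • a, fun l z hz => ?_⟩
    rw [smul_lie, ha l z hz, smul_smul]
    congr 1
    simp only [evl, Finset.mul_sum, Pi.smul_apply, smul_eq_mul]
    exact Finset.sum_congr rfl fun j _ => by ring

theorem rho_exists (G : Gen F L) : ∃ h ∈ G.W 0, ∀ l, ∀ y ∈ G.W l, ⁅h, y⁆ = evl (fun _ => (2 : F)) l • y := by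
  let c : Fin 8 → ℤ := ![92, 136, 182, 270, 220, 168, 114, 58]
  refine ⟨∑ i, ((c i : ℤ) : F) • G.h i, sum_mem fun i _ => Submodule.smul_mem _ _ (G.h_mem i), fun l y hy => ?_⟩
  rw [sum_lie]
  simp only [smul_lie, mem_W.mp hy, smul_smul, ← Finset.sum_smul]
  congr 1
  have : ∑ i, c i * ca i l = ∑ j, l j * 2 := by
    simp only [ca, Fin.sum_univ_eight, c]
    simp [CartanMatrix.E₈]
    ring
  have h2 := congrArg (Int.cast : ℤ → F) this
  push_cast at h2
  exact h2

variable [Nontrivial L]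

theorem spl_H0 (G : Gen F L) : ∃ x, Spl G.H0 x := by
  classical
  obtain ⟨x, hx, hxl⟩ := G.rho_exists
  refine ⟨x, mem_H0.mpr hx, fun a ha b hb => G.H0_comm ha hb, ?_⟩
  rw [eq_top_iff, ← G.W_top, iSup_le_iff]
  intro l y hy
  by_cases hy0 : y = 0
  · rw [hy0]; exact zero_mem _
  apply Submodule.subset_span
  by_cases hl : l = 0
  · left; subst hl; exact mem_H0.mpr hy
  right
  choose a ha using fun (c : G.W 0) => G.H_act c.2
  refine ⟨G.ad_nilp hl hy, fun c => if hc : c ∈ G.W 0 then evl (a ⟨c, hc⟩) l else 0, ?_, ?_⟩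
  · beta_reduce; rw [dif_pos hx]
    have h1 := ha ⟨x, hx⟩ l y hy
    rw [hxl l y hy] at h1
    rw [← smul_left_injective F hy0 h1]
    have hs := G.W_sign (l := l) (fun h => hy0 (by rw [h] at hy; simpa using hy))
    have he : evl (fun _ => (2 : F)) l = ((∑ j, l j * 2 : ℤ) : F) := by simp [evl]
    rw [he]
    intro h0
    have h0' : ∑ j, l j * 2 = 0 := by exact_mod_cast h0
    rw [← Finset.sum_mul] at h0'
    have h3 : ∑ j, l j = 0 := by omega
    apply hl
    rcases hs with hs | hs
    · funext j
      exact (Finset.sum_eq_zero_iff_of_nonneg fun i _ => hs i).mp h3 j (Finset.mem_univ j)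
    · funext j
      exact (Finset.sum_eq_zero_iff_of_nonpos fun i _ => hs i).mp h3 j (Finset.mem_univ j)
  · intro c hc
    beta_reduce; rw [dif_pos (mem_H0.mp hc)]
    exact ha ⟨c, _⟩ l y hy

theorem W_ne (G : Gen F L) {l : V} (hl : q l = 2) : ∃ v ∈ G.W l, v ≠ 0 := by
  obtain ⟨v, hv, h⟩ := G.W_root hl
  exact ⟨v, by rw [h]; exact Submodule.mem_span_singleton_self v, hv⟩

theorem W_unique (G : Gen F L) {l m : V} {x : L} (hx : x ≠ 0) (h : x ∈ G.W l) (h' : x ∈ G.W m) : l = m := by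
  apply ca_inj
  intro i
  have := (mem_W.mp h i).symm.trans (mem_W.mp h' i)
  exact_mod_cast smul_left_injective F hx this

/-- after conjugation, `θ` stabilizes the standard Cartan and fixes a regular element of it -/
theorem step_cartan [IsAlgClosed F] (G : Gen F L) {θ : lieAut F L} (hθ : θ ^ 6 = 1) :
    ∃ g : lieAut F L, ∃ x ∈ G.W 0, (g * θ * g⁻¹).1 x = x ∧
      (∀ y, ⁅x, y⁆ = 0 → y ∈ G.W 0) := by
  have := G.finDim
  have := G.killing
  obtain ⟨x, hx, hC⟩ := exists_fixed_cartan hθ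
  obtain ⟨x', hx'⟩ := G.spl_H0
  obtain ⟨g, hg⟩ := csa_conj (spl_engel hC) hx'
  refine ⟨g, g.1 x, mem_H0.mp (hg x (LieSubalgebra.self_mem_engel F x)), ?_, ?_⟩
  · show g.1 (θ.1 ((g⁻¹ * g).1 x)) = g.1 x
    rw [inv_mul_cancel]
    show g.1 (θ.1 x) = g.1 x
    rw [hx]
  · intro y hy
    have h1 : g.1 ((g⁻¹).1 y) = y := by
      show (g * g⁻¹).1 y = y
      rw [mul_inv_cancel]; rfl
    rw [← h1, ← mem_H0]
    apply hg
    rw [LieSubalgebra.mem_engel_iff]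
    refine ⟨1, ?_⟩
    rw [pow_one, ad_apply]
    apply g.1.injective
    have := g.2 x ((g⁻¹).1 y)
    rw [this, h1, hy, map_zero]
end Gen
end
end E8

namespace E8

theorem sr_add (i) (l m : V) : sr i (l + m) = sr i l + sr i m := by
  simp only [sr, ca_add, add_smul]; abel

/-- simple reflection as an additive equivalence -/
def srE (i : Fin 8) : V ≃+ V where
  toFun := sr i
  invFun := sr i
  left_inv := sr_sr i
  right_inv := sr_sr i
  map_add' := sr_add i

theorem root_sign {l : V} (h : q l = 2) : (∀ i, 0 ≤ l i) ∨ (∀ i, l i ≤ 0) := by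
  rw [← mem_rootL, rootL, List.mem_append, List.mem_map, List.mem_map] at h
  rcases h with ⟨n, _, rfl⟩ | ⟨n, _, rfl⟩
  · exact Or.inl fun i => posN_nonneg n i
  · right; intro i; have := posN_nonneg n i; simp [this]

theorem q_al (i : Fin 8) : q (al i) = 2 := by
  rw [q_bl, bl_al, ca_al_self]

section
variable {F L : Type} [Field F] [LieRing L] [LieAlgebra F L] [CharZero F] [Nontrivial L]
namespace Gen

theorem weyl_dom (G : Gen F L) (p : V →+ ℚ) : ∃ (g : lieAut F L) (w : V ≃+ V),
    (∀ l, q (w l) = q l) ∧ (∀ l, ∀ x ∈ G.W l, g.1 x ∈ G.W (w l)) ∧ ∀ i, 0 ≤ p (w (al i)) := by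
  classical
  let S : (V →+ ℚ) → Finset V := fun p => rootF.filter fun l => (∀ i, 0 ≤ l i) ∧ p l < 0
  suffices H : ∀ n, ∀ p : V →+ ℚ, (S p).card ≤ n → ∃ (g : lieAut F L) (w : V ≃+ V),
    (∀ l, q (w l) = q l) ∧ (∀ l, ∀ x ∈ G.W l, g.1 x ∈ G.W (w l)) ∧ ∀ i, 0 ≤ p (w (al i)) from H _ p le_rfl
  intro n
  induction n with
  | zero =>
    intro p hp
    refine ⟨1, AddEquiv.refl V, fun l => rfl, fun l x hx => hx, fun i => ?_⟩
    by_contra hi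
    have : al i ∈ S p := by
      refine Finset.mem_filter.mpr ⟨mem_rootF.mpr (q_al i), fun k => ?_, not_le.mp hi⟩
      show (0:ℤ) ≤ (Pi.single i 1 : V) k
      rw [Pi.single_apply]; split_ifs <;> norm_num
    rw [Nat.le_zero, Finset.card_eq_zero] at hp
    rw [hp] at this
    simp at this
  | succ n ih =>
    intro p hp
    by_cases h : ∀ i, 0 ≤ p (al i)
    · exact ⟨1, AddEquiv.refl V, fun l => rfl, fun l x hx => hx, h⟩
    push Not at h
    obtain ⟨i, hi⟩ := h
    have hali : al i ∈ S p := by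
      refine Finset.mem_filter.mpr ⟨mem_rootF.mpr (q_al i), fun k => ?_, hi⟩
      show (0:ℤ) ≤ (Pi.single i 1 : V) k
      rw [Pi.single_apply]; split_ifs <;> norm_num
    have hsal : sr i (al i) = -al i := by
      rw [sr, ca_al_self]; simp [two_smul]
    have hc : (S (p.comp (srE i).toAddMonoidHom)).card ≤ n := by
      have : (S (p.comp (srE i).toAddMonoidHom)).card ≤ ((S p).erase (al i)).card := by
        refine Finset.card_le_card_of_injOn (sr i) ?_ ?_
        · intro l hl
          rw [Finset.mem_coe, Finset.mem_filter, mem_rootF] at hl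
          obtain ⟨hq, h0, hpl⟩ := hl
          have hpl : p (sr i l) < 0 := hpl
          have hne : l ≠ al i := by
            rintro rfl
            rw [hsal, map_neg] at hpl
            linarith
          rw [Finset.mem_coe, Finset.mem_erase, Finset.mem_filter, mem_rootF, q_sr]
          have hk : ∃ k, k ≠ i ∧ l k ≠ 0 := by
            by_contra hcon
            push Not at hcon
            have hl : l = l i • al i := by
              funext k
              by_cases hk : k = i
              · subst hk; simp
              · simp [hcon k hk, hk]
            have h2 : q l = 2 * (l i * l i) := by
              conv_lhs => rw [hl]
              rw [q_bl, bl_smul, smul_bl, bl_al, ca_al_self]; ring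
            rw [hq] at h2
            have h3 := h0 i
            have h4 : l i = 1 := by nlinarith
            rw [h4, one_smul] at hl
            exact hne hl
          obtain ⟨k, hki, hk⟩ := hk
          refine ⟨?_, hq, ?_, hpl⟩
          · intro h
            have := congrArg (sr i) h
            rw [sr_sr, hsal] at this
            have h1 := h0 i
            rw [this] at h1
            simp at h1
          · rcases root_sign ((q_sr i l).trans hq) with hs | hs
            · exact hs
            · have h1 := hs k
              rw [sr_apply_ne hki] at h1
              have := h0 k
              omega
        · intro a _ b _ hab
          have := congrArg (sr i) hab
          simpa [sr_sr] using this
      rw [Finset.card_erase_of_mem hali] at this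
      omega
    obtain ⟨g, w, h1, h2, h3⟩ := ih _ hc
    refine ⟨G.nn i * g, w.trans (srE i), fun l => (q_sr i _).trans (h1 l), fun l x hx => G.nn_W i (h2 l x hx), h3⟩
end Gen
end
end E8

namespace E8

set_option synthInstance.maxSize 4000 in
set_option synthInstance.maxHeartbeats 400000 in
theorem diag_rigid_aux : ∀ a3 a1 : Fin 8, CartanMatrix.E₈ a1 a3 = -1 → ∀ a2, CartanMatrix.E₈ a2 a3 = -1 → a2 ≠ a1 →
    ∀ a4, CartanMatrix.E₈ a4 a3 = -1 → a4 ≠ a1 → a4 ≠ a2 → ∀ a0, CartanMatrix.E₈ a0 a2 = -1 → a0 ≠ a3 →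
    ∀ a5, CartanMatrix.E₈ a5 a4 = -1 → a5 ≠ a3 → ∀ a6, CartanMatrix.E₈ a6 a5 = -1 → a6 ≠ a4 →
    ∀ a7, CartanMatrix.E₈ a7 a6 = -1 → a7 ≠ a5 →
    a0 = 0 ∧ a1 = 1 ∧ a2 = 2 ∧ a3 = 3 ∧ a4 = 4 ∧ a5 = 5 ∧ a6 = 6 ∧ a7 = 7 := by
  decide +kernel

theorem diag_rigid (π : Fin 8 → Fin 8) (hi : Function.Injective π)
    (h : ∀ i j, CartanMatrix.E₈ i j = -1 → CartanMatrix.E₈ (π i) (π j) = -1) : ∀ i, π i = i := by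
  have := diag_rigid_aux (π 3) (π 1) (h _ _ (by decide +kernel)) (π 2) (h _ _ (by decide +kernel)) (hi.ne (by decide))
    (π 4) (h _ _ (by decide +kernel)) (hi.ne (by decide)) (hi.ne (by decide))
    (π 0) (h _ _ (by decide +kernel)) (hi.ne (by decide)) (π 5) (h _ _ (by decide +kernel)) (hi.ne (by decide))
    (π 6) (h _ _ (by decide +kernel)) (hi.ne (by decide)) (π 7) (h _ _ (by decide +kernel)) (hi.ne (by decide))
  obtain ⟨h0, h1, h2, h3, h4, h5, h6, h7⟩ := this
  intro i
  fin_cases i <;> assumption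

theorem chr_al {F : Type} [Field F] (c : Fin 8 → F) (i : Fin 8) : Gen.chr c (al i) = c i := by
  rw [Gen.chr, Finset.prod_eq_single i]
  · simp
  · intro j _ hj; simp [hj]
  · simp

section
variable {F L : Type} [Field F] [LieRing L] [LieAlgebra F L] [CharZero F] [Nontrivial L]
namespace Gen

theorem aut_inv_apply (φ : lieAut F L) (y : L) : φ.1 ((φ⁻¹).1 y) = y := by
  show (φ * φ⁻¹).1 y = y
  rw [mul_inv_cancel]; rfl

theorem aut_inv_apply' (φ : lieAut F L) (y : L) : (φ⁻¹).1 (φ.1 y) = y := by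
  show (φ⁻¹ * φ).1 y = y
  rw [inv_mul_cancel]; rfl

theorem act_data (G : Gen F L) (φ : lieAut F L) {x : L} (hx0 : x ∈ G.W 0) (hx : φ.1 x = x)
    (hreg : ∀ y, ⁅x, y⁆ = 0 → y ∈ G.W 0) {a : Fin 8 → F} (ha : ∀ l, ∀ y ∈ G.W l, ⁅x, y⁆ = evl a l • y) :
    ∃ (σ : V → V) (b : Fin 8 → Fin 8 → F), ∀ l, q l = 2 → q (σ l) = 2 ∧ (∀ y ∈ G.W l, φ.1 y ∈ G.W (σ l)) ∧
      (∀ i, ((ca i (σ l) : ℤ) : F) = evl (b i) l) ∧ evl a (σ l) = evl a l := by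
  have hh : ∀ i, (φ⁻¹).1 (G.h i) ∈ G.W 0 := by
    intro i
    apply hreg
    apply φ.1.injective
    rw [φ.2, hx, aut_inv_apply, map_zero, ← lie_skew, mem_W.mp hx0 i]
    simp [ca_zero]
  choose b hb using fun i => G.H_act (hh i)
  have key : ∀ l, q l = 2 → ∃ m, q m = 2 ∧ (∀ y ∈ G.W l, φ.1 y ∈ G.W m) ∧
      (∀ i, ((ca i m : ℤ) : F) = evl (b i) l) ∧ evl a m = evl a l := by
    intro l hl
    obtain ⟨v, hv, hW⟩ := G.W_root hl
    have hvW : v ∈ G.W l := by rw [hW]; exact Submodule.mem_span_singleton_self v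
    have hv' : φ.1 v ≠ 0 := by simpa using hv
    have hch : ∀ i, ⁅G.h i, φ.1 v⁆ = evl (b i) l • φ.1 v := by
      intro i
      rw [← map_smul, ← hb i l v hvW, φ.2, aut_inv_apply]
    obtain ⟨m, hm⟩ := G.joint_eig hv' hch
    have hxe : ⁅x, φ.1 v⁆ = evl a l • φ.1 v := by
      rw [← map_smul, ← ha l v hvW, φ.2, hx]
    have hae : evl a m = evl a l :=
      smul_left_injective F hv' ((ha m _ hm).symm.trans hxe)
    have hm2 : q m = 2 := by
      by_contra hcon
      by_cases hm0 : m = 0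
      · subst hm0
        have h0 : evl a l = 0 := by rw [← hae]; simp [evl]
        have := hreg v (by rw [ha l v hvW, h0, zero_smul])
        have := G.W_unique hv hvW this
        subst this
        simp [q] at hl
      · rw [G.W_bot hm0 hcon, Submodule.mem_bot] at hm
        exact hv' hm
    refine ⟨m, hm2, ?_, fun i => smul_left_injective F hv' ((mem_W.mp hm i).symm.trans (hch i)), hae⟩
    intro y hy
    rw [hW] at hy
    obtain ⟨c, rfl⟩ := Submodule.mem_span_singleton.mp hy
    rw [map_smul]
    exact Submodule.smul_mem _ _ hm
  choose! σ hσ using key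
  exact ⟨σ, b, hσ⟩

theorem evl_zero (a : Fin 8 → F) : evl a 0 = 0 := by simp [evl]

theorem act_add (G : Gen F L) {σ : V → V} {b : Fin 8 → Fin 8 → F}
    (h : ∀ l, q l = 2 → ∀ i, ((ca i (σ l) : ℤ) : F) = evl (b i) l) {l m : V} (hl : q l = 2) (hm : q m = 2)
    (hlm : q (l + m) = 2) : σ (l + m) = σ l + σ m := by
  apply ca_inj
  intro i
  have : ((ca i (σ (l + m)) : ℤ) : F) = ((ca i (σ l + σ m) : ℤ) : F) := by
    rw [ca_add, Int.cast_add, h _ hlm, h _ hl, h _ hm, evl_add]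
  exact_mod_cast this

theorem act_neg (G : Gen F L) {σ : V → V} {b : Fin 8 → Fin 8 → F}
    (h : ∀ l, q l = 2 → ∀ i, ((ca i (σ l) : ℤ) : F) = evl (b i) l) {l : V} (hl : q l = 2) :
    σ (-l) = - σ l := by
  apply ca_inj
  intro i
  have : ((ca i (σ (-l)) : ℤ) : F) = ((ca i (-σ l) : ℤ) : F) := by
    rw [ca_neg, Int.cast_neg, h _ (by rw [q_neg, hl]), h _ hl, evl_neg]
  exact_mod_cast this

theorem root_sum_pos {l : V} (hl : q l = 2) (h : ∀ i, 0 ≤ l i) : 1 ≤ ∑ i, l i := by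
  by_contra hc
  have h1 : ∑ i, l i = 0 := le_antisymm (by omega) (Finset.sum_nonneg fun i _ => h i)
  rw [Finset.sum_eq_zero_iff_of_nonneg (fun i _ => h i)] at h1
  have : l = 0 := funext fun i => h1 i (Finset.mem_univ i)
  subst this
  simp [q] at hl

/-- A positive automorphism fixing a dominant regular element of the Cartan acts as a torus element. -/
theorem torus_of_dom (G : Gen F L) (φ : lieAut F L) {x : L} (hx0 : x ∈ G.W 0) (hx : φ.1 x = x)
    (hreg : ∀ y, ⁅x, y⁆ = 0 → y ∈ G.W 0) {a : Fin 8 → F} (ha : ∀ l, ∀ y ∈ G.W l, ⁅x, y⁆ = evl a l • y)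
    (P : F →+ ℚ) (hP : ∀ i, 0 < P (evl a (al i))) :
    ∃ c : Fin 8 → F, (∀ i, c i ≠ 0) ∧ ∀ l, ∀ y ∈ G.W l, φ.1 y = chr c l • y := by
  have hP0 : ∀ l : V, P (evl a l) = ∑ i, (l i : ℚ) * P (evl a (al i)) := by
    intro l
    rw [evl, map_sum]
    refine Finset.sum_congr rfl fun i _ => ?_
    rw [evl_al, ← zsmul_eq_mul, map_zsmul, zsmul_eq_mul]
  have hpos : ∀ l : V, q l = 2 → 0 < P (evl a l) → ∀ i, 0 ≤ l i := by
    intro l hl h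
    rcases root_sign hl with h1 | h1
    · exact h1
    · exfalso
      rw [hP0] at h
      have : ∑ i, (l i : ℚ) * P (evl a (al i)) ≤ 0 := Finset.sum_nonpos fun i _ =>
        mul_nonpos_of_nonpos_of_nonneg (by exact_mod_cast h1 i) (hP i).le
      linarith
  have hposP : ∀ l : V, q l = 2 → (∀ i, 0 ≤ l i) → 0 < P (evl a l) := by
    intro l hl h
    rw [hP0]
    have hnn : ∀ i ∈ Finset.univ, 0 ≤ (l i : ℚ) * P (evl a (al i)) := fun i _ =>
      mul_nonneg (by exact_mod_cast h i) (hP i).le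
    refine lt_of_le_of_ne (Finset.sum_nonneg hnn) fun h0 => ?_
    have h0 := (Finset.sum_eq_zero_iff_of_nonneg hnn).mp h0.symm
    have : l = 0 := by
      funext i
      have := h0 i (Finset.mem_univ i)
      rcases mul_eq_zero.mp this with h | h
      · exact_mod_cast h
      · exact absurd h (hP i).ne'
    subst this
    simp [q] at hl
  have hx' : (φ⁻¹).1 x = x := by
    conv_lhs => rw [← hx]
    exact aut_inv_apply' φ x
  obtain ⟨σ, b, hσ⟩ := G.act_data φ hx0 hx hreg ha
  obtain ⟨τ, b', hτ⟩ := G.act_data φ⁻¹ hx0 hx' hreg ha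
  have hτσ : ∀ l, q l = 2 → τ (σ l) = l := by
    intro l hl
    obtain ⟨v, hv, hv0⟩ := G.W_ne hl
    have h1 := (hτ _ (hσ l hl).1).2.1 _ ((hσ l hl).2.1 v hv)
    rw [aut_inv_apply'] at h1
    exact G.W_unique hv0 h1 hv
  have hal : ∀ (i k : Fin 8), 0 ≤ al i k := fun i k => by
    show (0:ℤ) ≤ (Pi.single i 1 : V) k
    rw [Pi.single_apply]; split_ifs <;> norm_num
  have hτpos : ∀ l, q l = 2 → (∀ i, 0 ≤ l i) → ∀ i, 0 ≤ τ l i := fun l hl h =>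
    hpos _ (hτ l hl).1 (by rw [(hτ l hl).2.2.2]; exact hposP l hl h)
  have hσpos : ∀ l, q l = 2 → (∀ i, 0 ≤ l i) → ∀ i, 0 ≤ σ l i := fun l hl h =>
    hpos _ (hσ l hl).1 (by rw [(hσ l hl).2.2.2]; exact hposP l hl h)
  have hsimple : ∀ i, ∃ j, σ (al i) = al j := by
    intro i
    by_contra hcon
    simp only [not_exists] at hcon
    obtain ⟨β, hβ⟩ : ∃ β, β = σ (al i) := ⟨_, rfl⟩
    rw [← hβ] at hcon
    have hβ2 : q β = 2 := by rw [hβ]; exact (hσ _ (q_al i)).1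
    have hβ0 : β ≠ 0 := by intro h; rw [h] at hβ2; simp [q] at hβ2
    have hβp : ∀ k, 0 ≤ β k := by rw [hβ]; exact hσpos _ (q_al i) (hal i)
    obtain ⟨j, hj, hcj⟩ := exists_ca_pos hβp hβ0
    have hd : β - al j ≠ 0 := sub_ne_zero.mpr (hcon j)
    have hq1 : q (β - al j) = 4 - 2 * ca j β := by
      rw [q_bl, bl_sub, sub_bl, sub_bl, ← q_bl, ← q_bl, q_al, hβ2, bl_comm β (al j), bl_al]; ring
    have hq2 := q_ge_two hd
    have hq3 : q (β - al j) = 2 := by omega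
    have hsum : q ((β - al j) + al j) = 2 := by rw [sub_add_cancel]; exact hβ2
    have h1 := G.act_add (fun l hl => (hτ l hl).2.2.1) hq3 (q_al j) hsum
    rw [sub_add_cancel, hβ, hτσ _ (q_al i), ← hβ] at h1
    have hp1 : ∀ k, 0 ≤ (β - al j) k := by
      intro k
      show 0 ≤ β k - (Pi.single j 1 : V) k
      rw [Pi.single_apply]
      split_ifs with h
      · subst h; omega
      · have := hβp k; omega
    have s1 := root_sum_pos (hτ _ hq3).1 (hτpos _ hq3 hp1)
    have s2 := root_sum_pos (hτ _ (q_al j)).1 (hτpos _ (q_al j) (hal j))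
    have s3 : ∑ k, al i k = 1 := by simp [al]
    rw [h1] at s3
    simp only [Pi.add_apply, Finset.sum_add_distrib] at s3
    omega
  choose π hπ using hsimple
  have hπi : Function.Injective π := by
    intro i j hij
    have : al i = al j := by rw [← hτσ _ (q_al i), ← hτσ _ (q_al j), hπ, hπ, hij]
    by_contra hne
    have := congrFun this i
    simp [al, hne] at this
  have hqs : ∀ i j, q (al i + al j) = 4 + 2 * CartanMatrix.E₈ i j := by
    intro i j
    rw [q_bl, bl_add, add_bl, add_bl, ← q_bl, ← q_bl, q_al, q_al, bl_comm (al j) (al i), bl_al, ca_al]; ring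
  have hid := diag_rigid π hπi (fun i j hij => by
    have h1 : q (al i + al j) = 2 := by rw [hqs, hij]; norm_num
    have h2 := G.act_add (fun l hl => (hσ l hl).2.2.1) (q_al i) (q_al j) h1
    have h3 := (hσ _ h1).1
    rw [h2, hπ, hπ, hqs] at h3
    omega)
  have hσi : ∀ i, σ (al i) = al i := fun i => by rw [hπ, hid]
  have he : ∀ i, ∃ c : F, φ.1 (G.e i) = c • G.e i := by
    intro i
    have := (hσ _ (q_al i)).2.1 _ (G.e_mem i)
    rw [hσi, G.W_al, Submodule.mem_span_singleton] at this
    obtain ⟨c, hc⟩ := this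
    exact ⟨c, hc.symm⟩
  have hf : ∀ i, ∃ c : F, φ.1 (G.f i) = c • G.f i := by
    intro i
    have hfm : G.f i ∈ G.W (-al i) := G.f_mem i
    have := (hσ _ (by rw [q_neg, q_al])).2.1 _ hfm
    rw [G.act_neg (fun l hl => (hσ l hl).2.2.1) (q_al i), hσi] at this
    have h2 := G.swap.W_al i
    rw [swap_W] at h2
    rw [h2, Submodule.mem_span_singleton] at this
    obtain ⟨c, hc⟩ := this
    exact ⟨c, hc.symm⟩
  choose c hc using he
  choose d hd using hf
  have hcne : ∀ i, c i ≠ 0 := by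
    intro i h
    have := hc i
    rw [h, zero_smul] at this
    exact G.e_ne i (by simpa using this)
  have hcd : ∀ i, d i = (c i)⁻¹ := by
    intro i
    have h1 : φ.1 (G.h i) = (c i * d i) • G.h i := by
      rw [← G.ef, φ.2, hc, hd, smul_lie, lie_smul, smul_smul]
    have h2 : φ.1 ⁅G.h i, G.e i⁆ = ⁅φ.1 (G.h i), φ.1 (G.e i)⁆ := φ.2 _ _
    have h22 : CartanMatrix.E₈ i i = 2 := by rw [← ca_al, ca_al_self]
    rw [h1, hc, G.he, map_smul, hc, smul_lie, lie_smul, G.he, h22, smul_smul, smul_smul, smul_smul] at h2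
    have h3 := smul_left_injective F (G.e_ne i) h2
    have h4 := hcne i
    push_cast at h3
    have h5 : c i * (c i * d i - 1) * 2 = 0 := by linear_combination -h3
    have h6 : c i * d i - 1 = 0 := by simpa [h4] using h5
    field_simp
    linear_combination h6
  refine ⟨c, hcne, ?_⟩
  obtain ⟨t, ht⟩ := exists_torus G c hcne
  suffices h : φ = t by rw [h]; exact ht
  have hte : ∀ i, t.1 (G.e i) = φ.1 (G.e i) := fun i => by
    rw [hc, ht _ _ (G.e_mem i), chr_al]
  have htf : ∀ i, t.1 (G.f i) = φ.1 (G.f i) := fun i => by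
    rw [hd, ht (-al i) _ (G.f_mem i), hcd]
    congr 1
    have h0 := chr_add hcne (al i) (-al i)
    rw [add_neg_cancel, chr_al] at h0
    have h1 : chr c 0 = 1 := by simp [chr]
    rw [h1] at h0
    exact eq_inv_of_mul_eq_one_right h0.symm
  have htop : fixedSubalgebra (φ⁻¹ * t) = ⊤ := by
    rw [eq_top_iff, ← G.gen, LieSubalgebra.lieSpan_le]
    rintro y (⟨i, rfl⟩ | ⟨i, rfl⟩)
    · show (φ⁻¹).1 (t.1 (G.e i)) = G.e i
      rw [hte, aut_inv_apply']
    · show (φ⁻¹).1 (t.1 (G.f i)) = G.f i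
      rw [htf, aut_inv_apply']
  apply aut_ext
  intro y
  have : y ∈ fixedSubalgebra (φ⁻¹ * t) := by rw [htop]; trivial
  have h1 : (φ⁻¹).1 (t.1 y) = y := this
  conv_lhs => rw [← h1]
  exact aut_inv_apply φ _
end Gen
end
end E8

namespace E8

theorem V_sum (l : V) : l = ∑ i, l i • al i := by
  funext k
  simp [Finset.sum_apply, Pi.single_apply, al]

section
variable {F L : Type} [Field F] [LieRing L] [LieAlgebra F L] [CharZero F] [Nontrivial L]
namespace Gen

/-- `evl a` as an additive map -/
def evlH (a : Fin 8 → F) : V →+ F := AddMonoidHom.mk' (evl a) (evl_add a)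

theorem hom_evl (f : V →+ F) (l : V) : f l = evl (fun i => f (al i)) l := by
  conv_lhs => rw [V_sum l]
  rw [map_sum, evl]
  refine Finset.sum_congr rfl fun i _ => ?_
  rw [map_zsmul, zsmul_eq_mul]

theorem W_zero_inv (G : Gen F L) {g : lieAut F L} {w : V ≃+ V} (h : ∀ l, ∀ x ∈ G.W l, g.1 x ∈ G.W (w l))
    {z : L} (hz : z ∈ G.W 0) : (g⁻¹).1 z ∈ G.W 0 := by
  rw [mem_W]
  intro i
  apply g.1.injective
  have h1 := h 0 _ (G.h_mem i)
  rw [map_zero] at h1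
  obtain ⟨a, ha⟩ := G.H_act h1
  rw [g.2, aut_inv_apply, ha 0 z hz, evl_zero, ca_zero]
  simp

theorem step_torus [IsAlgClosed F] (G : Gen F L) {θ : lieAut F L} (hθ : θ ^ 6 = 1) :
    ∃ g : lieAut F L, ∃ c : Fin 8 → F, (∀ i, c i ≠ 0) ∧ ∀ l, ∀ y ∈ G.W l, (g * θ * g⁻¹).1 y = chr c l • y := by
  obtain ⟨g0, x, hx0, hx, hreg⟩ := G.step_cartan hθ
  obtain ⟨a, ha⟩ := G.H_act hx0
  have hne : ∀ l : V, q l = 2 → evl a l ≠ 0 := by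
    intro l hl h
    obtain ⟨v, hv, hv0⟩ := G.W_ne hl
    have := G.W_unique hv0 hv (hreg v (by rw [ha l v hv, h, zero_smul]))
    subst this
    simp [q] at hl
  obtain ⟨ℓ, hℓ⟩ := Module.exists_dual_forall_apply_ne_zero (K := ℚ) (M := F) (fun l : rootF => evl a l.1)
    (fun l => hne _ (mem_rootF.mp l.2))
  obtain ⟨g1, w, hw, hg, hpos⟩ := G.weyl_dom (ℓ.toAddMonoidHom.comp (evlH a))
  have e : g1⁻¹ * (g0 * θ * g0⁻¹) * g1 = (g1⁻¹ * g0) * θ * (g1⁻¹ * g0)⁻¹ := by group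
  obtain ⟨c, hc, hc2⟩ := G.torus_of_dom (g1⁻¹ * (g0 * θ * g0⁻¹) * g1) (x := (g1⁻¹).1 x) (G.W_zero_inv hg hx0)
    (by
      show (g1⁻¹).1 ((g0 * θ * g0⁻¹).1 (g1.1 ((g1⁻¹).1 x))) = _
      rw [aut_inv_apply, hx])
    (by
      intro y hy
      rw [← aut_inv_apply' g1 y]
      apply G.W_zero_inv hg
      apply hreg
      have := congrArg g1.1 hy
      rwa [g1.2, aut_inv_apply, map_zero] at this)
    (a := fun i => evl a (w (al i)))
    (by
      intro l y hy
      apply g1.1.injective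
      rw [g1.2, aut_inv_apply, map_smul, ha _ _ (hg l y hy)]
      congr 1
      exact hom_evl ((evlH a).comp w.toAddMonoidHom) l)
    ℓ.toAddMonoidHom
    (by
      intro i
      rw [evl_al]
      refine lt_of_le_of_ne (hpos i) (Ne.symm ?_)
      exact hℓ ⟨w (al i), mem_rootF.mpr (by rw [hw, q_al])⟩)
  rw [e] at hc2
  exact ⟨_, c, hc, hc2⟩
end Gen
end
end E8

namespace E8

/-- inverse Cartan matrix applied to a vector -/
def lam (n : V) : V := ![4*n 0+5*n 1+7*n 2+10*n 3+8*n 4+6*n 5+4*n 6+2*n 7,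
    5*n 0+8*n 1+10*n 2+15*n 3+12*n 4+9*n 5+6*n 6+3*n 7,
    7*n 0+10*n 1+14*n 2+20*n 3+16*n 4+12*n 5+8*n 6+4*n 7,
    10*n 0+15*n 1+20*n 2+30*n 3+24*n 4+18*n 5+12*n 6+6*n 7,
    8*n 0+12*n 1+16*n 2+24*n 3+20*n 4+15*n 5+10*n 6+5*n 7,
    6*n 0+9*n 1+12*n 2+18*n 3+15*n 4+12*n 5+8*n 6+4*n 7,
    4*n 0+6*n 1+8*n 2+12*n 3+10*n 4+8*n 5+6*n 6+3*n 7,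
    2*n 0+3*n 1+4*n 2+6*n 3+5*n 4+4*n 5+3*n 6+2*n 7]

/-- dot product -/
def dt (n l : V) : ℤ := ∑ i, n i * l i

theorem dt_eq (n l : V) : dt n l = n 0 * l 0 + n 1 * l 1 + n 2 * l 2 + n 3 * l 3 + n 4 * l 4 + n 5 * l 5 + n 6 * l 6 + n 7 * l 7 := by
  rw [dt, Fin.sum_univ_eight]

theorem bl_lam (n l : V) : bl (lam n) l = dt n l := by
  rw [bl_eq, dt_eq]
  have h0 : lam n 0 = _ := rfl
  simp only [lam, Matrix.cons_val]
  ring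

theorem dt_add (n l m : V) : dt n (l + m) = dt n l + dt n m := by
  simp [dt, mul_add, Finset.sum_add_distrib]

theorem dt_hom (f : V →+ ℤ) (l : V) : f l = dt (fun i => f (al i)) l := by
  conv_lhs => rw [V_sum l]
  rw [map_sum, dt]
  refine Finset.sum_congr rfl fun i _ => ?_
  rw [map_zsmul, smul_eq_mul, mul_comm]

/-- the highest root -/
def hiR : V := ![2, 3, 4, 6, 5, 4, 3, 2]

theorem q_hiR : q hiR = 2 := by decide +kernel

section
variable {F L : Type} [Field F] [LieRing L] [LieAlgebra F L] [CharZero F] [Nontrivial L]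
namespace Gen

theorem chr_zpow {ζ : F} (hζ : ζ ≠ 0) (n l : V) : chr (fun i => ζ ^ n i) l = ζ ^ dt n l := by
  rw [chr, dt]
  simp only [← zpow_mul]
  have : ∀ s : Finset (Fin 8), ∏ i ∈ s, ζ ^ (n i * l i) = ζ ^ (∑ i ∈ s, n i * l i) := by
    classical
    intro s
    induction s using Finset.induction_on with
    | empty => simp
    | insert i s hi ih => rw [Finset.prod_insert hi, Finset.sum_insert hi, ih, zpow_add₀ hζ]
  exact this _

theorem kac [IsAlgClosed F] (G : Gen F L) {θ : lieAut F L} (hθ : θ ^ 6 = 1) {ζ : F} (hζ : IsPrimitiveRoot ζ 6) :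
    ∃ g : lieAut F L, ∃ n : V, (∀ i, 0 ≤ n i) ∧ dt n hiR ≤ 6 ∧
      ∀ l, ∀ y ∈ G.W l, (g * θ * g⁻¹).1 y = ζ ^ dt n l • y := by
  have hζ0 : ζ ≠ 0 := hζ.ne_zero (by norm_num)
  let D : V → Prop := fun m => ∃ g : lieAut F L, ∀ l, ∀ y ∈ G.W l, (g * θ * g⁻¹).1 y = ζ ^ bl m l • y
  have hD : ∃ m, D m := by
    obtain ⟨g, c, hc, h⟩ := G.step_torus hθ
    have hc6 : ∀ i, c i ^ 6 = 1 := by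
      intro i
      have hp : ∀ k : ℕ, ((g * θ * g⁻¹) ^ k).1 (G.e i) = c i ^ k • G.e i := by
        intro k
        induction k with
        | zero => simp
        | succ k ih =>
          rw [pow_succ]
          show ((g * θ * g⁻¹) ^ k).1 ((g * θ * g⁻¹).1 (G.e i)) = _
          rw [h _ _ (G.e_mem i), chr_al, map_smul, ih, smul_smul, pow_succ, mul_comm]
      have h1 := hp 6
      rw [conj_pow, hθ, mul_one, mul_inv_cancel] at h1
      have h2 : (1 : F) • G.e i = c i ^ 6 • G.e i := by rw [← h1, one_smul]; rfl
      exact (smul_left_injective F (G.e_ne i) h2).symm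
    choose k hk hk2 using fun i => hζ.eq_pow_of_pow_eq_one (hc6 i)
    refine ⟨lam (fun i => (k i : ℤ)), g, fun l y hy => ?_⟩
    rw [h l y hy, bl_lam, ← chr_zpow hζ0]
    congr 2
    funext i
    rw [← hk2 i, zpow_natCast]
  obtain ⟨m, ⟨g, hg⟩, hmin⟩ : ∃ m, D m ∧ ∀ m', D m' → q m ≤ q m' := by
    have hwf := (measure (fun m : V => (q m).toNat)).wf
    obtain ⟨m, hm, h⟩ := hwf.has_min {m | D m} hD
    refine ⟨m, hm, fun m' hm' => ?_⟩
    have h1 := h m' hm'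
    have h2 := q_nonneg m
    have h3 := q_nonneg m'
    have h4 : ¬ ((q m').toNat < (q m).toNat) := h1
    omega
  have hle : ∀ β, q β = 2 → bl m β ≤ 6 := by
    intro β hβ
    have h1 := hmin (m - (6:ℤ) • β) ⟨g, fun l y hy => by
      rw [hg l y hy, sub_bl, smul_bl, zpow_sub₀ hζ0, zpow_mul]
      have : ζ ^ (6:ℤ) = 1 := by exact_mod_cast hζ.pow_eq_one
      rw [this, one_zpow, div_one]⟩
    have h2 : q (m - (6:ℤ) • β) = q m - 12 * bl m β + 72 := by
      rw [q_bl, bl_sub, sub_bl, sub_bl, bl_smul, smul_bl, smul_bl, bl_smul, bl_comm β m, ← q_bl β, hβ, ← q_bl]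
      ring
    omega
  let p : V →+ ℤ := AddMonoidHom.mk' (bl m) (bl_add m)
  obtain ⟨g1, w, hw, hg1, hpos⟩ := G.weyl_dom ((Int.castAddHom ℚ).comp p)
  have hpp : ∀ l, bl m (w l) = dt (fun i => bl m (w (al i))) l := fun l =>
    dt_hom (p.comp w.toAddMonoidHom) l
  refine ⟨g1⁻¹ * g, fun i => bl m (w (al i)), fun i => ?_, ?_, ?_⟩
  · have : (0:ℚ) ≤ ((bl m (w (al i)) : ℤ) : ℚ) := hpos i
    exact_mod_cast this
  · rw [← hpp]
    exact hle _ (by rw [hw, q_hiR])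
  · intro l y hy
    have e : (g1⁻¹ * g) * θ * (g1⁻¹ * g)⁻¹ = g1⁻¹ * (g * θ * g⁻¹) * g1 := by group
    rw [e]
    show (g1⁻¹).1 ((g * θ * g⁻¹).1 (g1.1 y)) = _
    rw [hg _ _ (hg1 l y hy), map_smul, aut_inv_apply', hpp]
end Gen
end
end E8

namespace E8

/-- decimal encoding -/
def enc (l : V) : ℤ := (((((((l 0 * 10 + l 1) * 10 + l 2) * 10 + l 3) * 10 + l 4) * 10 + l 5) * 10 + l 6) * 10 + l 7)

theorem rootL_enc : rootL.map enc = posN.map (fun n => (n : ℤ)) ++ posN.map (fun n => -(n : ℤ)) := by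
  decide +kernel

theorem rootL_nodup : rootL.Nodup := by
  apply List.Nodup.of_map enc
  rw [rootL_enc]
  decide +kernel

/-- the sum of `ca i l` over roots of degree `k` mod 6 -/
def vk (n : V) (k : ℤ) (i : Fin 8) : ℤ := ((rootL.filter (fun l => (dt n l - k) % 6 = 0)).map (ca i)).sum

theorem vk_eq (n : V) (k : ℤ) (i : Fin 8) : vk n k i = ∑ l ∈ rootF, if (dt n l - k) % 6 = 0 then ca i l else 0 := by
  have h : rootF.filter (fun l => (dt n l - k) % 6 = 0) = (rootL.filter (fun l => (dt n l - k) % 6 = 0)).toFinset := by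
    ext l; simp [rootF]
  rw [vk, ← Finset.sum_filter, h, List.sum_toFinset _ (rootL_nodup.filter _)]

/-- boolean check for the enumeration of Kac coordinates -/
def kacB (a0 a1 a2 a3 a4 a5 a6 a7 : ℕ) : Bool :=
  !decide (2 * a0 + 3 * a1 + 4 * a2 + 6 * a3 + 5 * a4 + 4 * a5 + 3 * a6 + 2 * a7 ≤ 6) ||
  !decide (∀ i, vk ![(a0 : ℕ), (a1 : ℕ), (a2 : ℕ), (a3 : ℕ), (a4 : ℕ), (a5 : ℕ), (a6 : ℕ), (a7 : ℕ)] 1 i = 0) ||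
  !decide (∀ i, vk ![(a0 : ℕ), (a1 : ℕ), (a2 : ℕ), (a3 : ℕ), (a4 : ℕ), (a5 : ℕ), (a6 : ℕ), (a7 : ℕ)] 2 i = 0) ||
  decide (a0 = 0 ∧ a1 = 0 ∧ a2 = 0 ∧ a3 = 1 ∧ a4 = 0 ∧ a5 = 0 ∧ a6 = 0 ∧ a7 = 0) ||
  decide (a0 % 2 = 0 ∧ a1 % 2 = 0 ∧ a2 % 2 = 0 ∧ a3 % 2 = 0 ∧ a4 % 2 = 0 ∧ a5 % 2 = 0 ∧ a6 % 2 = 0 ∧ a7 % 2 = 0) ||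
  decide (a0 % 3 = 0 ∧ a1 % 3 = 0 ∧ a2 % 3 = 0 ∧ a3 % 3 = 0 ∧ a4 % 3 = 0 ∧ a5 % 3 = 0 ∧ a6 % 3 = 0 ∧ a7 % 3 = 0)

theorem kac_list : ∀ (a0 : Fin 4) (a1 : Fin 3) (a2 a3 a4 a5 : Fin 2) (a6 : Fin 3) (a7 : Fin 4),
    kacB a0 a1 a2 a3 a4 a5 a6 a7 = true := by
  decide +kernel

theorem kac_list' {n : V} (h0 : ∀ i, 0 ≤ n i) (h6 : dt n hiR ≤ 6) (hv : ∀ k i, vk n k i = 0) :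
    n = al 3 ∨ (∀ i, (2:ℤ) ∣ n i) ∨ (∀ i, (3:ℤ) ∣ n i) := by
  have hn : ∃ a : Fin 8 → ℕ, n = ![(a 0 : ℤ), (a 1 : ℤ), (a 2 : ℤ), (a 3 : ℤ), (a 4 : ℤ), (a 5 : ℤ), (a 6 : ℤ), (a 7 : ℤ)] := by
    refine ⟨fun i => (n i).toNat, ?_⟩
    simp only [Int.toNat_of_nonneg (h0 _)]
    funext i
    fin_cases i <;> rfl
  obtain ⟨a, rfl⟩ := hn
  rw [dt_eq] at h6
  simp only [hiR, Matrix.cons_val] at h6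
  have := kac_list ⟨a 0, by omega⟩ ⟨a 1, by omega⟩ ⟨a 2, by omega⟩ ⟨a 3, by omega⟩ ⟨a 4, by omega⟩
    ⟨a 5, by omega⟩ ⟨a 6, by omega⟩ ⟨a 7, by omega⟩
  have h7 : 2 * a 0 + 3 * a 1 + 4 * a 2 + 6 * a 3 + 5 * a 4 + 4 * a 5 + 3 * a 6 + 2 * a 7 ≤ 6 := by omega
  have e1 := decide_eq_true (hv 1)
  have e2 := decide_eq_true (hv 2)
  rw [kacB, e1, e2, decide_eq_true h7] at this
  simp only [Bool.not_true, Bool.false_or, Bool.or_eq_true, decide_eq_true_eq, or_assoc] at this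
  rcases this with ⟨b0, b1, b2, b3, b4, b5, b6, b7⟩ | ⟨b0, b1, b2, b3, b4, b5, b6, b7⟩ | ⟨b0, b1, b2, b3, b4, b5, b6, b7⟩
  · left
    rw [b0, b1, b2, b3, b4, b5, b6, b7]
    decide +kernel
  · right; left
    intro i
    fin_cases i <;> simp only [Matrix.cons_val, Fin.reduceFinMk, Fin.zero_eta, Fin.mk_one, Fin.isValue] <;> omega
  · right; right
    intro i
    fin_cases i <;> simp only [Matrix.cons_val, Fin.reduceFinMk, Fin.zero_eta, Fin.mk_one, Fin.isValue] <;> omega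

section
variable {F L : Type} [Field F] [LieRing L] [LieAlgebra F L] [CharZero F] [Nontrivial L]
namespace Gen

theorem tr_fixed [IsAlgClosed F] (G : Gen F L) {Q : Subgroup (lieAut F L)} (hQ : IsMaximalFiniteAbelian Q)
    (T : Module.End F L) (hT : ∀ a ∈ Q, ∀ y, T (a.1 y) = a.1 (T y)) (x : L) :
    LinearMap.trace F L (T ∘ₗ ad F L x) = 0 := by
  have := G.finDim
  have := G.killing
  let φ : Module.Dual F L :=
    { toFun := fun x => LinearMap.trace F L (T ∘ₗ ad F L x)
      map_add' := fun x y => by rw [map_add, LinearMap.comp_add, map_add]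
      map_smul' := fun c x => by rw [map_smul, LinearMap.comp_smul, map_smul]; rfl }
  have hφ : ∀ x, φ x = LinearMap.trace F L (T ∘ₗ ad F L x) := fun x => rfl
  have hinj : Function.Injective (killingForm F L) := by
    rw [← LinearMap.ker_eq_bot]
    exact LieAlgebra.IsKilling.ker_killingForm_eq_bot F L
  have hsurj : Function.Surjective (killingForm F L) :=
    (LinearMap.injective_iff_surjective_of_finrank_eq_finrank (Subspace.dual_finrank_eq (K := F) (V := L)).symm).mp hinj
  obtain ⟨z, hz⟩ := hsurj φ
  have hz0 : z = 0 := by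
    refine fixed_zero (fun x h => ad_inj x h) hQ fun a ha => ?_
    rw [← sub_eq_zero]
    apply killing_nd (F := F)
    intro y
    rw [map_sub, LinearMap.sub_apply, sub_eq_zero]
    have h1 := aut_killing a z ((a⁻¹).1 y)
    rw [aut_inv_apply] at h1
    rw [h1, hz, hφ, hφ]
    have h2 : T ∘ₗ ad F L y = a.1.conj (T ∘ₗ ad F L ((a⁻¹).1 y)) := by
      ext u
      rw [LinearEquiv.conj_apply_apply]
      show T ⁅y, u⁆ = a.1 (T ⁅(a⁻¹).1 y, (a⁻¹).1 u⁆)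
      rw [← hT a ha, a.2, aut_inv_apply, aut_inv_apply]
    rw [h2, LinearMap.trace_conj']
  rw [← hφ, ← hz, hz0]
  simp

theorem trace_W (G : Gen F L) (T : Module.End F L) (τ : V → F) (hT : ∀ l, ∀ y ∈ G.W l, T y = τ l • y) (h0 : τ 0 = 0) :
    LinearMap.trace F L T = ∑ l ∈ rootF, τ l := by
  have := G.finDim
  have hne : ∀ l, G.W l ≠ ⊥ → l ∈ insert 0 rootF := by
    intro l hl
    by_contra hc
    rw [Finset.mem_insert, mem_rootF, not_or] at hc
    exact hl (G.W_bot hc.1 hc.2)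
  have hfin : {l | G.W l ≠ ⊥}.Finite := (Finset.finite_toSet (insert 0 rootF)).subset fun l hl => hne l hl
  have hinternal : DirectSum.IsInternal G.W :=
    DirectSum.isInternal_submodule_of_iSupIndep_of_iSup_eq_top G.W_indep G.W_top
  have hm : ∀ l, Set.MapsTo T (G.W l) (G.W l) := fun l y hy => by
    rw [hT l y hy]; exact Submodule.smul_mem _ _ hy
  rw [LinearMap.trace_eq_sum_trace_restrict' hinternal hfin hm]
  have hr : ∀ l, LinearMap.trace F (G.W l) (T.restrict (hm l)) = τ l * Module.finrank F (G.W l) := by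
    intro l
    have : T.restrict (hm l) = τ l • LinearMap.id := by
      ext y
      exact hT l y.1 y.2
    rw [this, map_smul, LinearMap.trace_id, smul_eq_mul]
  have hsub : hfin.toFinset ⊆ insert 0 rootF := fun l hl => hne l (by simpa using hl)
  rw [Finset.sum_subset hsub, Finset.sum_insert]
  · rw [hr, h0, zero_mul, zero_add]
    refine Finset.sum_congr rfl fun l hl => ?_
    rw [mem_rootF] at hl
    have hl0 : l ≠ 0 := by rintro rfl; simp [q] at hl
    have h1 := G.rank_W l hl0
    rw [if_pos hl] at h1
    rw [hr, Module.finrank_eq_of_rank_eq (n := 1) (by simpa using h1)]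
    simp
  · rw [mem_rootF]; simp [q]
  · intro l _ hl
    have : G.W l = ⊥ := by simpa using hl
    rw [hr]
    rw [this]
    simp

theorem vk_zero [IsAlgClosed F] (G : Gen F L) {Q : Subgroup (lieAut F L)} (hQ : IsMaximalFiniteAbelian Q)
    {θ : lieAut F L} (hθ : θ ∈ Q) {ζ : F} (hζ : IsPrimitiveRoot ζ 6) {n : V}
    (h : ∀ l, ∀ y ∈ G.W l, θ.1 y = ζ ^ dt n l • y) (k : ℤ) (i : Fin 8) : vk n k i = 0 := by
  have hζ0 : ζ ≠ 0 := hζ.ne_zero (by norm_num)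
  have hζ6 : ζ ^ (6:ℤ) = 1 := by exact_mod_cast hζ.pow_eq_one
  have hp : ∀ (j : ℕ) l, ∀ y ∈ G.W l, (θ ^ j).1 y = (ζ ^ dt n l) ^ j • y := by
    intro j l y hy
    induction j with
    | zero => simp
    | succ j ih =>
      rw [pow_succ]
      show (θ ^ j).1 (θ.1 y) = _
      rw [h l y hy, map_smul, ih, smul_smul, pow_succ, mul_comm]
  let T : Module.End F L := ∑ j ∈ Finset.range 6, (ζ ^ (-k)) ^ j • ((θ ^ j).1 : L ≃ₗ[F] L).toLinearMap
  have hTa : ∀ y, T y = ∑ j ∈ Finset.range 6, (ζ ^ (-k)) ^ j • (θ ^ j).1 y := by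
    intro y
    simp [T, LinearMap.sum_apply]
  have hTW : ∀ l, ∀ y ∈ G.W l, T y = (if (dt n l - k) % 6 = 0 then (6:F) else 0) • y := by
    intro l y hy
    rw [hTa]
    have : ∀ j ∈ Finset.range 6, (ζ ^ (-k)) ^ j • (θ ^ j).1 y = (ζ ^ (dt n l - k)) ^ j • y := by
      intro j _
      rw [hp j l y hy, smul_smul, ← mul_pow, ← zpow_add₀ hζ0, sub_eq_neg_add]
    rw [Finset.sum_congr rfl this, ← Finset.sum_smul]
    congr 1
    have h1 : ζ ^ (dt n l - k) = 1 ↔ (dt n l - k) % 6 = 0 := by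
      rw [hζ.zpow_eq_one_iff_dvd]
      push_cast
      omega
    split_ifs with h2
    · rw [h1.mpr h2]; simp
    · have h3 : ζ ^ (dt n l - k) - 1 ≠ 0 := sub_ne_zero.mpr (fun h => h2 (h1.mp h))
      have h4 := geom_sum_mul (ζ ^ (dt n l - k)) 6
      have h5 : (ζ ^ (dt n l - k)) ^ 6 = 1 := by
        rw [← zpow_natCast, ← zpow_mul, mul_comm, zpow_mul]
        push_cast
        rw [hζ6, one_zpow]
      rw [h5, sub_self] at h4
      exact (mul_eq_zero.mp h4).resolve_right h3
  have h1 := G.tr_fixed hQ T (by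
    intro a ha y
    rw [hTa, hTa, map_sum]
    refine Finset.sum_congr rfl fun j _ => ?_
    rw [map_smul]
    congr 1
    have : θ ^ j * a = a * θ ^ j := hQ.2.1 _ _ (Q.pow_mem hθ j) ha
    exact congrArg (fun g : lieAut F L => g.1 y) this) (G.h i)
  rw [G.trace_W _ (fun l => ((ca i l : ℤ) : F) * (if (dt n l - k) % 6 = 0 then (6:F) else 0))] at h1
  · rw [vk_eq]
    have h2 : ((6 * ∑ l ∈ rootF, (if (dt n l - k) % 6 = 0 then ca i l else 0) : ℤ) : F) = 0 := by
      rw [← h1]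
      push_cast
      rw [Finset.mul_sum]
      refine Finset.sum_congr rfl fun l _ => ?_
      split_ifs <;> simp [mul_comm]
    have h3 : (6 * ∑ l ∈ rootF, (if (dt n l - k) % 6 = 0 then ca i l else 0) : ℤ) = 0 := by exact_mod_cast h2
    omega
  · intro l y hy
    show T ⁅G.h i, y⁆ = _
    rw [mem_W.mp hy i, map_smul, hTW l y hy, smul_smul]
  · simp [ca_zero]
end Gen
end
end E8

namespace E8

theorem maxab_conj {A : Type*} [Group A] {Q : Subgroup A} (hQ : IsMaximalFiniteAbelian Q) (g : A) :
    IsMaximalFiniteAbelian (Q.map (MulAut.conj g).toMonoidHom) := by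
  obtain ⟨h1, h2, h3⟩ := hQ
  refine ⟨?_, ?_, ?_⟩
  · have : Finite (Q : Set A) := h1
    have h := (Set.toFinite (Q : Set A)).image (MulAut.conj g).toMonoidHom
    exact h.to_subtype
  · rintro _ _ ⟨a, ha, rfl⟩ ⟨b, hb, rfl⟩
    rw [← map_mul, ← map_mul, h2 a b ha hb]
  · intro Q' hab hle
    have h4 : Q'.comap (MulAut.conj g).toMonoidHom = Q := by
      apply h3
      · intro a b ha hb
        apply (MulAut.conj g).injective
        rw [map_mul, map_mul]
        exact hab _ _ ha hb
      · rwa [← Subgroup.map_le_iff_le_comap]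
    rw [← h4]
    exact (Subgroup.map_comap_eq_self_of_surjective (MulAut.conj g).surjective _).symm

theorem dt_al (i : Fin 8) (l : V) : dt (al i) l = l i := by
  simp [dt, al, Pi.single_apply]

section
variable {F L : Type} [Field F] [LieRing L] [LieAlgebra F L] [CharZero F] [Nontrivial L]
namespace Gen

/-- the standard automorphism of order 6 -/
def IsStd (G : Gen F L) (ζ : F) (θ : lieAut F L) : Prop := ∀ l, ∀ y ∈ G.W l, θ.1 y = ζ ^ l 3 • y

theorem torus_pow_one (G : Gen F L) {θ : lieAut F L} {ζ : F} {n : V} {k : ℕ}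
    (h : ∀ l, ∀ y ∈ G.W l, θ.1 y = ζ ^ dt n l • y) (hk : ∀ i, (ζ ^ n i) ^ k = 1) (hζ : ζ ≠ 0) : θ ^ k = 1 := by
  have hp : ∀ (j : ℕ) l, ∀ y ∈ G.W l, (θ ^ j).1 y = (ζ ^ dt n l) ^ j • y := by
    intro j l y hy
    induction j with
    | zero => simp
    | succ j ih =>
      rw [pow_succ]
      show (θ ^ j).1 (θ.1 y) = _
      rw [h l y hy, map_smul, ih, smul_smul, pow_succ, mul_comm]
  apply aut_ext
  intro y
  have hy : y ∈ iSup G.W := by rw [G.W_top]; trivial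
  induction hy using Submodule.iSup_induction' with
  | mem l y hy =>
    rw [hp k l y hy, ← chr_zpow hζ, chr, ← Finset.prod_pow]
    have : ∀ i ∈ Finset.univ, ((ζ ^ n i) ^ l i) ^ k = 1 := by
      intro i _
      rw [← zpow_natCast, ← zpow_mul, mul_comm, zpow_mul, zpow_natCast, hk, one_zpow]
    rw [Finset.prod_eq_one this, one_smul]; rfl
  | zero => simp
  | add x y _ _ h1 h2 => rw [map_add, map_add, h1, h2]

theorem step_std [IsAlgClosed F] (G : Gen F L) {Q : Subgroup (lieAut F L)} (hQ : IsMaximalFiniteAbelian Q)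
    {θ : lieAut F L} (hθ : θ ∈ Q) (ho : orderOf θ = 6) {ζ : F} (hζ : IsPrimitiveRoot ζ 6) :
    ∃ g : lieAut F L, ∃ θ' ∈ Q.map (MulAut.conj g).toMonoidHom, G.IsStd ζ θ' := by
  have hζ0 : ζ ≠ 0 := hζ.ne_zero (by norm_num)
  have h6 : θ ^ 6 = 1 := by rw [← ho]; exact pow_orderOf_eq_one θ
  obtain ⟨g, n, hn0, hn6, hg⟩ := G.kac h6 hζ
  have hmem : g * θ * g⁻¹ ∈ Q.map (MulAut.conj g).toMonoidHom := ⟨θ, hθ, rfl⟩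
  have hcon : ∀ k, 0 < k → k < 6 → (∀ i, (ζ ^ n i) ^ k = 1) → False := by
    intro k hk hk6 h
    have h1 := G.torus_pow_one hg h hζ0
    rw [conj_pow] at h1
    have h2 : θ ^ k = 1 := by
      have := congrArg (fun a => g⁻¹ * a * g) h1
      simpa [mul_assoc] using this
    have := orderOf_dvd_of_pow_eq_one h2
    rw [ho] at this
    exact absurd (Nat.le_of_dvd hk this) (by omega)
  have hz : ∀ m : ℤ, (6:ℤ) ∣ m → ζ ^ m = 1 := fun m hm => by
    rw [hζ.zpow_eq_one_iff_dvd]; exact_mod_cast hm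
  rcases kac_list' hn0 hn6 (fun k i => G.vk_zero (maxab_conj hQ g) hmem hζ hg k i) with h | h | h
  · refine ⟨g, _, hmem, fun l y hy => ?_⟩
    rw [hg l y hy, h, dt_al]
  · exact (hcon 3 (by norm_num) (by norm_num) (fun i => by
      rw [← zpow_natCast, ← zpow_mul]
      apply hz
      have := h i
      push_cast
      omega)).elim
  · exact (hcon 2 (by norm_num) (by norm_num) (fun i => by
      rw [← zpow_natCast, ← zpow_mul]
      apply hz
      have := h i
      push_cast
      omega)).elim

/-- every root is in the Weyl orbit of a simple root -/
theorem weyl_root (G : Gen F L) {l : V} (hl : q l = 2) : ∃ (g : lieAut F L) (w : V ≃+ V) (i : Fin 8),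
    (∀ m, q (w m) = q m) ∧ (∀ m, ∀ x ∈ G.W m, g.1 x ∈ G.W (w m)) ∧ w (al i) = l := by
  suffices H : ∀ n : ℕ, ∀ l : V, q l = 2 → (∀ i, 0 ≤ l i) → ∑ i, l i ≤ n → ∃ (g : lieAut F L) (w : V ≃+ V) (i : Fin 8),
    (∀ m, q (w m) = q m) ∧ (∀ m, ∀ x ∈ G.W m, g.1 x ∈ G.W (w m)) ∧ w (al i) = l by
    rcases root_sign hl with h | h
    · exact H (∑ i, l i).toNat l hl h (by omega)
    · obtain ⟨g, w, i, h1, h2, h3⟩ := H (∑ i, (-l) i).toNat (-l) (by rw [q_neg, hl]) (fun i => by simpa using h i) (by omega)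
      refine ⟨g * G.nn i, (srE i).trans w, i, fun m => (h1 _).trans (q_sr i m), fun m x hx => h2 _ _ (G.nn_W i hx), ?_⟩
      show w (sr i (al i)) = l
      have hsal : sr i (al i) = -al i := by
        rw [sr, ca_al_self]; simp [two_smul]
      rw [hsal, map_neg, h3, neg_neg]
  intro n
  induction n with
  | zero =>
    intro l hl h0 hs
    have := root_sum_pos hl h0
    push_cast at hs
    omega
  | succ n ih =>
    intro l hl h0 hs
    by_cases hsim : ∃ i, l = al i
    · obtain ⟨i, rfl⟩ := hsim
      exact ⟨1, AddEquiv.refl V, i, fun _ => rfl, fun _ _ hx => hx, rfl⟩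
    simp only [not_exists] at hsim
    have hl0 : l ≠ 0 := by rintro rfl; simp [q] at hl
    obtain ⟨j, hj, hcj⟩ := exists_ca_pos h0 hl0
    have hd : l - al j ≠ 0 := sub_ne_zero.mpr (hsim j)
    have hq1 : q (l - al j) = 4 - 2 * ca j l := by
      rw [q_bl, bl_sub, sub_bl, sub_bl, ← q_bl, ← q_bl, q_al, hl, bl_comm l (al j), bl_al]; ring
    have hq2 := q_ge_two hd
    have hc1 : ca j l = 1 := by omega
    have hsr : sr j l = l - al j := by rw [sr, hc1, one_smul]
    have hp1 : ∀ k, 0 ≤ (l - al j) k := by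
      intro k
      show 0 ≤ l k - (Pi.single j 1 : V) k
      rw [Pi.single_apply]
      split_ifs with h
      · subst h; omega
      · have := h0 k; omega
    have hsum : ∑ i, (l - al j) i = ∑ i, l i - 1 := by
      simp [al, Finset.sum_sub_distrib]
    obtain ⟨g, w, i, h1, h2, h3⟩ := ih (l - al j) (by omega) hp1 (by rw [hsum]; push_cast at hs; omega)
    refine ⟨G.nn j * g, w.trans (srE j), i, fun m => (q_sr j _).trans (h1 m), fun m x hx => G.nn_W j (h2 m x hx), ?_⟩
    show sr j (w (al i)) = l
    rw [h3, ← hsr, sr_sr]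

theorem bl_iso {w : V ≃+ V} (h : ∀ m, q (w m) = q m) (l m : V) : bl (w l) (w m) = bl l m := by
  have h1 := h (l + m)
  rw [map_add, q_bl, q_bl, bl_add, bl_add, add_bl, add_bl, add_bl, add_bl, ← q_bl, ← q_bl, ← q_bl, ← q_bl, h, h,
    bl_comm (w m) (w l), bl_comm m l] at h1
  omega

/-- sl2-triple attached to a root -/
theorem root_sl2 (G : Gen F L) {l : V} (hl : q l = 2) : ∃ e ∈ G.W l, ∃ f ∈ G.W (-l), e ≠ 0 ∧ f ≠ 0 ∧
    ∀ m, ∀ y ∈ G.W m, ⁅⁅e, f⁆, y⁆ = ((bl l m : ℤ) : F) • y := by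
  obtain ⟨g, w, i, h1, h2, h3⟩ := G.weyl_root hl
  refine ⟨g.1 (G.e i), h3 ▸ h2 _ _ (G.e_mem i), g.1 (G.f i), ?_, by simpa using G.e_ne i, ?_, ?_⟩
  · have := h2 _ _ (G.f_mem i)
    rwa [map_neg, h3] at this
  · have h : G.f i ≠ 0 := G.swap.e_ne i
    simpa using h
  intro m y hy
  rw [← g.2, G.ef]
  obtain ⟨b, hb⟩ := G.H_act (h := g.1 (G.h i)) (by
    have := h2 _ _ (G.h_mem i)
    rwa [map_zero] at this)
  rw [hb m y hy]
  congr 1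
  have key : ∀ k, q k = 2 → evl b (w k) = ((bl l (w k) : ℤ) : F) := by
    intro k hk
    obtain ⟨x, hx, hx0⟩ := G.W_ne hk
    have e1 := hb (w k) (g.1 x) (h2 k x hx)
    rw [← g.2, (G.mem_W.1 hx) i, map_smul] at e1
    have e2 := smul_left_injective F (show g.1 x ≠ 0 by simpa using hx0) e1
    rw [← e2, ← h3, bl_iso h1, bl_al]
  let f1 : V →+ F := { toFun := fun k => evl b (w k), map_zero' := by simp [evl_zero], map_add' := fun x y => by rw [map_add, evl_add] }
  let f2 : V →+ F := { toFun := fun k => ((bl l (w k) : ℤ) : F), map_zero' := by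
                        have := bl_smul 0 l 0
                        simp at this
                        simp [this], map_add' := fun x y => by rw [map_add, bl_add]; push_cast; rfl }
  have e3 : f1 (w.symm m) = f2 (w.symm m) := by
    rw [hom_evl f1, hom_evl f2]
    congr 1
    funext j
    exact key _ (q_al j)
  have e4 : evl b (w (w.symm m)) = ((bl l (w (w.symm m)) : ℤ) : F) := e3
  rwa [w.apply_symm_apply] at e4

theorem W_span (G : Gen F L) {l : V} (hl : q l = 2) {x y : L} (hx : x ∈ G.W l) (hx0 : x ≠ 0) (hy : y ∈ G.W l) :
    ∃ c : F, y = c • x := by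
  obtain ⟨v, hv, he⟩ := G.W_root hl
  rw [he, Submodule.mem_span_singleton] at hx hy
  obtain ⟨a, rfl⟩ := hx
  obtain ⟨b, rfl⟩ := hy
  have ha : a ≠ 0 := by rintro rfl; simp at hx0
  exact ⟨b / a, by rw [smul_smul, div_mul_cancel₀ _ ha]⟩

theorem lie_ne (G : Gen F L) {l m : V} (hl : q l = 2) (hm : q m = 2) (hlm : q (l + m) = 2) {x y : L}
    (hx : x ∈ G.W l) (hx0 : x ≠ 0) (hy : y ∈ G.W m) (hy0 : y ≠ 0) : ⁅x, y⁆ ≠ 0 := by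
  obtain ⟨e, he, f, hf, he0, hf0, hact⟩ := G.root_sl2 hl
  obtain ⟨c, rfl⟩ := G.W_span hl hx hx0 he
  have hb : bl l m = -1 := by
    rw [q_bl, bl_add, add_bl, add_bl, ← q_bl, ← q_bl, hl, hm, bl_comm m l] at hlm
    omega
  intro h0
  have h6 : q (-l + m) = 6 := by
    rw [q_bl, bl_add, add_bl, add_bl, bl_neg, neg_bl, neg_bl, bl_neg, ← q_bl, ← q_bl, hl, hm, bl_comm m l, hb]; norm_num
  have h1 : ⁅f, y⁆ = 0 := by
    have := G.lie_mem_W hf hy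
    rw [G.W_bot (l := -l + m) (by intro h; rw [h] at h6; simp [q] at h6) (by omega)] at this
    simpa using this
  have h2 := hact m y hy
  rw [lie_lie, h1, lie_zero, smul_lie, h0, smul_zero, lie_zero, hb] at h2
  simp at h2
  exact hy0 h2
end Gen
end
end E8

namespace E8

section tens
variable {F : Type} [Field F] {N : Type} [Fintype N] [DecidableEq N] {d : N → ℕ}

abbrev Ix (d : N → ℕ) : Type := ∀ n, Fin (d n)
abbrev Mt (F : Type) (d : N → ℕ) (n : N) := Matrix (Fin (d n)) (Fin (d n)) F
abbrev MI (F : Type) (d : N → ℕ) := Matrix (Ix d) (Ix d) F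

/-- external tensor product of matrices -/
def tens (A : ∀ n, Mt F d n) : MI F d := Matrix.of fun x y => ∏ n, A n (x n) (y n)

theorem tens_mul (A B : ∀ n, Mt F d n) : tens A * tens B = tens (fun n => A n * B n) := by
  ext x y
  simp only [tens, Matrix.mul_apply, Matrix.of_apply]
  rw [Fintype.prod_sum]
  refine Finset.sum_congr rfl fun z _ => ?_
  rw [Finset.prod_mul_distrib]

theorem tens_one : tens (fun n => (1 : Mt F d n)) = 1 := by
  ext x y
  simp only [tens, Matrix.of_apply, Matrix.one_apply]
  by_cases h : x = y
  · subst h; simp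
  · rw [if_neg h]
    obtain ⟨n, hn⟩ := Function.ne_iff.mp h
    exact Finset.prod_eq_zero (Finset.mem_univ n) (if_neg hn)

theorem tens_smul (c : N → F) (A : ∀ n, Mt F d n) : tens (fun n => c n • A n) = (∏ n, c n) • tens A := by
  ext x y
  simp [tens, Finset.prod_mul_distrib]

theorem tens_single (x y : Ix d) : tens (fun n => Matrix.single (x n) (y n) (1 : F)) = Matrix.single x y 1 := by
  ext a b
  simp only [tens, Matrix.of_apply, Matrix.single_apply]
  by_cases h : x = a ∧ y = b
  · obtain ⟨rfl, rfl⟩ := h; simp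
  · rw [if_neg h]
    have : ∃ n, ¬ (x n = a n ∧ y n = b n) := by
      by_contra hc
      push Not at hc
      exact h ⟨funext fun n => (hc n).1, funext fun n => (hc n).2⟩
    obtain ⟨n, hn⟩ := this
    exact Finset.prod_eq_zero (Finset.mem_univ n) (if_neg hn)

theorem tens_update (n : N) (a : Mt F d n) (A : ∀ n, Mt F d n) (x y : Ix d) :
    tens (Function.update A n a) x y = a (x n) (y n) * ∏ m ∈ Finset.univ.erase n, A m (x m) (y m) := by
  simp only [tens, Matrix.of_apply]
  rw [← Finset.mul_prod_erase _ _ (Finset.mem_univ n)]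
  congr 1
  · simp
  · refine Finset.prod_congr rfl fun m hm => ?_
    rw [Function.update_of_ne (Finset.ne_of_mem_erase hm)]

/-- the n-th factor -/
def iot (n : N) : Mt F d n →ₐ[F] MI F d :=
  AlgHom.ofLinearMap
    { toFun := fun a => tens (Function.update (fun n => (1 : Mt F d n)) n a)
      map_add' := fun a b => by
        ext x y
        rw [Matrix.add_apply, tens_update, tens_update, tens_update, Matrix.add_apply, add_mul]
      map_smul' := fun c a => by
        ext x y
        rw [Matrix.smul_apply, tens_update, tens_update, Matrix.smul_apply, RingHom.id_apply, smul_mul_assoc] }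
    (by
      show tens (Function.update (fun n => (1 : Mt F d n)) n 1) = 1
      rw [Function.update_eq_self n (fun n => (1 : Mt F d n)), tens_one])
    (by
      intro a b
      show tens _ = tens _ * tens _
      rw [tens_mul]
      congr 1
      funext m
      by_cases h : m = n
      · subst h; simp
      · simp [Function.update_of_ne h])

theorem iot_def (n : N) (a : Mt F d n) : iot n a = tens (Function.update (fun n => (1 : Mt F d n)) n a) := rfl

theorem iot_apply (n : N) (a : Mt F d n) (x y : Ix d) :
    iot n a x y = if ∀ m, m ≠ n → x m = y m then a (x n) (y n) else 0 := by
  rw [iot_def, tens_update]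
  split_ifs with h
  · rw [Finset.prod_eq_one, mul_one]
    intro m hm
    rw [h m (Finset.ne_of_mem_erase hm), Matrix.one_apply_eq]
  · push Not at h
    obtain ⟨m, hm, hx⟩ := h
    exact mul_eq_zero_of_right _ (Finset.prod_eq_zero (Finset.mem_erase.mpr ⟨hm, Finset.mem_univ m⟩) (Matrix.one_apply_ne hx))

theorem iot_comm {n m : N} (h : n ≠ m) (a : Mt F d n) (b : Mt F d m) : Commute (iot n a) (iot m b) := by
  show _ * _ = _ * _
  rw [iot_def, iot_def, tens_mul, tens_mul]
  congr 1
  funext k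
  by_cases h1 : k = n
  · subst h1
    simp [Function.update_of_ne h]
  · simp [Function.update_of_ne h1]

theorem iot_tens (n : N) (a : Mt F d n) (A : ∀ n, Mt F d n) :
    iot n a * tens A = tens (Function.update A n (a * A n)) := by
  rw [iot_def, tens_mul]
  congr 1
  funext k
  by_cases h1 : k = n
  · subst h1; simp
  · simp [Function.update_of_ne h1]

theorem tens_iot (n : N) (a : Mt F d n) (A : ∀ n, Mt F d n) :
    tens A * iot n a = tens (Function.update A n (A n * a)) := by
  rw [iot_def, tens_mul]
  congr 1
  funext k
  by_cases h1 : k = n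
  · subst h1; simp
  · simp [Function.update_of_ne h1]

/-- something commuting with every factor commutes with every pure tensor -/
theorem comm_tens {Z : MI F d} (h : ∀ n a, Commute (iot n a) Z) (A : ∀ n, Mt F d n) : Commute (tens A) Z := by
  have : ∀ s : Finset N, Commute (tens (fun n => if n ∈ s then A n else 1)) Z := by
    intro s
    induction s using Finset.induction_on with
    | empty => simpa [tens_one] using Commute.one_left Z
    | insert n s hn ih =>
      have : (fun k => if k ∈ insert n s then A k else (1 : Mt F d k))
          = Function.update (fun n => if n ∈ s then A n else 1) n (A n * (fun n => if n ∈ s then A n else (1 : Mt F d n)) n) := by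
        funext k
        by_cases hk : k = n
        · subst hk; simp [hn]
        · simp [Function.update_of_ne hk, hk]
      rw [this, ← iot_tens]
      exact (h n _).mul_left ih
  simpa using this Finset.univ

theorem scalar_of_comm {Z : MI F d} (h : ∀ n a, Commute (iot n a) Z) : ∃ c : F, Z = c • 1 := by
  have := Matrix.mem_range_scalar_of_commute_single (M := Z) (fun x y _ => by
    show Commute (Matrix.single x y 1) Z
    rw [← tens_single]; exact comm_tens h _)
  obtain ⟨c, hc⟩ := this
  exact ⟨c, by rw [← hc, Matrix.scalar_apply, Matrix.smul_one_eq_diagonal]⟩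

theorem sum_single_one {k : ℕ} : ∑ i : Fin k, Matrix.single i i (1 : F) = 1 := by
  ext a b
  rw [Matrix.sum_apply, Matrix.one_apply]
  simp [Matrix.single_apply, ite_and]

variable [∀ n, NeZero (d n)]

theorem iot_inj (n : N) : Function.Injective (iot (F := F) (d := d) n) := by
  intro a b h
  ext i j
  have := congrFun (congrFun h (Function.update (fun _ => 0) n i)) (Function.update (fun _ => 0) n j)
  rw [iot_apply, iot_apply] at this
  have h' : ∀ m, m ≠ n → (Function.update (fun _ => 0) n i : Ix d) m = (Function.update (fun _ => 0) n j : Ix d) m := by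
    intro m hm
    simp [Function.update_of_ne hm]
  rw [if_pos h', if_pos h'] at this
  simpa using this

/-- slice operator -/
noncomputable def slc (n : N) (i j : Fin (d n)) (Z : MI F d) : MI F d :=
  ∑ k, iot n (Matrix.single k i 1) * Z * iot n (Matrix.single j k 1)

theorem slc_add (n : N) (i j : Fin (d n)) (Z Z' : MI F d) : slc n i j (Z + Z') = slc n i j Z + slc n i j Z' := by
  simp [slc, mul_add, add_mul, Finset.sum_add_distrib]

theorem slc_zero (n : N) (i j : Fin (d n)) : slc n i j (0 : MI F d) = 0 := by
  simp [slc]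

theorem slc_mul (n : N) (i j : Fin (d n)) (a : Mt F d n) {W : MI F d} (hW : ∀ b, Commute (iot n b) W) :
    slc n i j (iot n a * W) = a i j • W := by
  have : ∀ k, iot n (Matrix.single k i 1) * (iot n a * W) * iot n (Matrix.single j k 1)
      = iot n (a i j • Matrix.single k k 1) * W := by
    intro k
    rw [mul_assoc, mul_assoc, ← (hW _).eq, ← mul_assoc, ← mul_assoc, ← map_mul, ← map_mul, Matrix.single_mul_mul_single]
    simp [Matrix.smul_single]
  rw [slc, Finset.sum_congr rfl fun k _ => this k, ← Finset.sum_mul, ← map_sum, ← Finset.smul_sum,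
    sum_single_one, map_smul, map_one, smul_mul_assoc, one_mul]

theorem slc_comm (n : N) (i j : Fin (d n)) (Z : MI F d) (b : Mt F d n) : Commute (iot n b) (slc n i j Z) := by
  have h1 : ∀ p r, Commute (iot n (Matrix.single p r (1 : F))) (slc n i j Z) := by
    intro p r
    show _ * _ = _ * _
    rw [slc, Finset.mul_sum, Finset.sum_mul, Finset.sum_eq_single r, Finset.sum_eq_single p]
    · simp only [← mul_assoc]
      rw [← map_mul, Matrix.single_mul_single_same, one_mul, mul_assoc (iot n (Matrix.single p i 1) * Z), ← map_mul,
        Matrix.single_mul_single_same, one_mul]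
    · intro k _ hk
      rw [mul_assoc, ← map_mul, Matrix.single_mul_single_of_ne _ _ _ _ hk]; simp
    · simp
    · intro k _ hk
      rw [← mul_assoc, ← mul_assoc, ← map_mul, Matrix.single_mul_single_of_ne _ _ _ _ hk.symm]; simp
    · simp
  rw [Matrix.matrix_eq_sum_single b, map_sum]
  refine Commute.sum_left _ _ _ fun p _ => ?_
  rw [map_sum]
  refine Commute.sum_left _ _ _ fun r _ => ?_
  have : Matrix.single p r (b p r) = b p r • Matrix.single p r (1 : F) := by simp [Matrix.smul_single]
  rw [this, map_smul]
  exact (h1 p r).smul_left _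

theorem slc_recover (n : N) (Z : MI F d) : Z = ∑ i, ∑ j, iot n (Matrix.single i j 1) * slc n i j Z := by
  have : ∀ i j, iot n (Matrix.single i j 1) * slc n i j Z
      = iot n (Matrix.single i i 1) * Z * iot n (Matrix.single j j 1) := by
    intro i j
    rw [slc, Finset.mul_sum, Finset.sum_eq_single j]
    · simp only [← mul_assoc]
      rw [← map_mul, Matrix.single_mul_single_same, one_mul]
    · intro k _ hk
      rw [← mul_assoc, ← mul_assoc, ← map_mul, Matrix.single_mul_single_of_ne _ _ _ _ hk.symm]; simp
    · simp
  simp only [this]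
  simp only [← Finset.mul_sum, ← Finset.sum_mul, ← map_sum, sum_single_one, map_one, one_mul, mul_one]

/-- commutant of the other factors -/
theorem mem_factor (n : N) {Z : MI F d} (h : ∀ m, m ≠ n → ∀ a, Commute (iot m a) Z) : ∃ a, Z = iot n a := by
  have h1 : ∀ i j, ∃ c : F, slc n i j Z = c • 1 := by
    intro i j
    apply scalar_of_comm
    intro m a
    by_cases hm : m = n
    · subst hm; exact slc_comm _ _ _ _ _
    · refine Commute.sum_right _ _ _ fun k _ => ?_
      exact ((iot_comm hm _ _).mul_right (h m hm a)).mul_right (iot_comm hm _ _)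
  choose c hc using h1
  refine ⟨Matrix.of c, ?_⟩
  conv_lhs => rw [slc_recover n Z]
  conv_rhs => rw [Matrix.matrix_eq_sum_single (Matrix.of c), map_sum]
  refine Finset.sum_congr rfl fun i _ => ?_
  rw [map_sum]
  refine Finset.sum_congr rfl fun j _ => ?_
  rw [hc, mul_smul_comm, mul_one, ← map_smul]
  simp [Matrix.smul_single]

/-- a square-zero element of the sum of the factors lies in a single factor -/
theorem sq_zero_factor [CharZero F] [Nonempty N] (a : ∀ n, Mt F d n) (h : (∑ n, iot n (a n)) * (∑ n, iot n (a n)) = 0) :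
    ∃ n, ∃ b, ∑ n, iot n (a n) = iot n b := by
  by_cases hall : ∀ n, ∃ c : F, a n = c • 1
  · choose c hc using hall
    obtain ⟨n⟩ := ‹Nonempty N›
    refine ⟨n, (∑ m, c m) • 1, ?_⟩
    rw [map_smul, map_one, Finset.sum_smul]
    refine Finset.sum_congr rfl fun m _ => ?_
    rw [hc, map_smul, map_one]
  push Not at hall
  obtain ⟨n, hn⟩ := hall
  obtain ⟨Y, hY⟩ : ∃ Y, Y = ∑ m ∈ Finset.univ.erase n, iot m (a m) := ⟨_, rfl⟩
  have hX : ∑ n, iot n (a n) = iot n (a n) + Y := by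
    rw [hY, Finset.add_sum_erase _ (fun n => iot n (a n)) (Finset.mem_univ n)]
  have hc : ∀ b, Commute (iot n b) Y := by
    intro b
    rw [hY]
    exact Commute.sum_right _ _ _ fun m hm => iot_comm (Finset.ne_of_mem_erase hm).symm _ _
  have h2 : iot n (a n * a n) * 1 + iot n ((2 : F) • a n) * Y + iot n 1 * (Y * Y) = 0 := by
    rw [hX] at h
    rw [← h, map_one, map_mul, map_smul, add_mul, mul_add, mul_add, ← (hc (a n)).eq, mul_one, one_mul, smul_mul_assoc, two_smul]
    abel
  have h3 : ∀ i j, (a n * a n) i j • (1 : MI F d) + (2 * a n i j) • Y + ((1 : Mt F d n) i j) • (Y * Y) = 0 := by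
    intro i j
    have := congrArg (slc n i j) h2
    rw [slc_add, slc_add, slc_zero, slc_mul n i j _ (fun b => Commute.one_right _), slc_mul n i j _ hc,
      slc_mul n i j _ (fun b => (hc b).mul_right (hc b))] at this
    simpa using this
  have h4 : ∃ t : F, Y = t • 1 := by
    by_cases hd : ∃ i j, i ≠ j ∧ a n i j ≠ 0
    · obtain ⟨i, j, hij, h0⟩ := hd
      have := h3 i j
      rw [Matrix.one_apply_ne hij, zero_smul, add_zero] at this
      have h5 : (2 * a n i j) • Y = -((a n * a n) i j • (1 : MI F d)) := by
        rw [eq_neg_iff_add_eq_zero, add_comm]; exact this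
      refine ⟨-((2 * a n i j)⁻¹ * (a n * a n) i j), ?_⟩
      have h6 : (2 * a n i j) ≠ 0 := by simpa using h0
      rw [neg_smul, mul_smul, ← smul_neg, ← h5, smul_smul, inv_mul_cancel₀ h6, one_smul]
    · push Not at hd
      have : ∃ i j, a n i i ≠ a n j j := by
        by_contra hc'
        push Not at hc'
        apply hn (a n 0 0)
        ext i j
        by_cases hij : i = j
        · subst hij; simp [hc' i 0]
        · simp [hd i j hij, Matrix.one_apply_ne hij]
      obtain ⟨i, j, hij⟩ := this
      have e1 := h3 i i
      have e2 := h3 j j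
      rw [Matrix.one_apply_eq] at e1 e2
      have h6 : (2 * (a n i i - a n j j)) ≠ 0 := by simpa [sub_eq_zero] using hij
      have h5 : (2 * (a n i i - a n j j)) • Y = -(((a n * a n) i i - (a n * a n) j j) • (1 : MI F d)) := by
        have := congrArg₂ (· - ·) e1 e2
        simp only [sub_zero] at this
        rw [eq_neg_iff_add_eq_zero, ← this, mul_sub, sub_smul, sub_smul]
        abel
      refine ⟨-((2 * (a n i i - a n j j))⁻¹ * ((a n * a n) i i - (a n * a n) j j)), ?_⟩
      rw [neg_smul, mul_smul, ← smul_neg, ← h5, smul_smul, inv_mul_cancel₀ h6, one_smul]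
  obtain ⟨t, ht⟩ := h4
  exact ⟨n, a n + t • 1, by rw [hX, ht, map_add, map_smul, map_one]⟩

end tens
end E8

namespace E8

section tens
variable {F : Type} [Field F]

theorem skolem {k : ℕ} [NeZero k] (f : Matrix (Fin k) (Fin k) F →ₐ[F] Matrix (Fin k) (Fin k) F) :
    ∃ P : Matrix (Fin k) (Fin k) F, P.det ≠ 0 ∧ ∀ M, f M * P = P * M := by
  have h0 : f (Matrix.single 0 0 1) ≠ 0 := by
    intro h
    have h1 : ∀ i : Fin k, f (Matrix.single i i 1) = 0 := by
      intro i
      have : (Matrix.single i i 1 : Matrix (Fin k) (Fin k) F) = Matrix.single i 0 1 * Matrix.single 0 0 1 * Matrix.single 0 i 1 := by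
        rw [Matrix.single_mul_single_same, Matrix.single_mul_single_same]; simp
      rw [this, map_mul, map_mul, h]; simp
    have h2 : f 1 = 0 := by
      rw [← sum_single_one, map_sum]
      exact Finset.sum_eq_zero fun i _ => h1 i
    rw [map_one] at h2
    exact one_ne_zero h2
  obtain ⟨p, r, hpr⟩ : ∃ p r, f (Matrix.single 0 0 1) p r ≠ 0 := by
    by_contra hc
    push Not at hc
    exact h0 (by ext i j; exact hc i j)
  obtain ⟨P, hP⟩ : ∃ P : Matrix (Fin k) (Fin k) F, ∀ i j, P i j = f (Matrix.single j 0 1) i r :=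
    ⟨Matrix.of fun i j => f (Matrix.single j 0 1) i r, fun _ _ => rfl⟩
  have key : ∀ M, f M * P = P * M := by
    intro M
    ext i j
    rw [Matrix.mul_apply, Matrix.mul_apply]
    simp only [hP]
    have h1 : ∑ x, f M i x * f (Matrix.single j 0 1) x r = f (M * Matrix.single j 0 1) i r := by
      rw [map_mul, Matrix.mul_apply]
    have h2 : M * Matrix.single j 0 1 = ∑ x, M x j • Matrix.single x 0 1 := by
      ext a b
      rw [Matrix.sum_apply]
      by_cases hb : b = 0
      · subst hb; simp [Matrix.single_apply]
      · rw [Matrix.mul_single_apply_of_ne _ _ _ _ _ hb]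
        symm
        refine Finset.sum_eq_zero fun x _ => ?_
        rw [Matrix.smul_apply, Matrix.single_apply_of_col_ne _ _ (Ne.symm hb)]; simp
    rw [h1, h2, map_sum, Matrix.sum_apply]
    refine Finset.sum_congr rfl fun x _ => ?_
    rw [map_smul, Matrix.smul_apply, smul_eq_mul, mul_comm]
  refine ⟨P, ?_, key⟩
  intro hdet
  obtain ⟨w, hw0, hw⟩ := Matrix.exists_mulVec_eq_zero_iff.mpr hdet
  obtain ⟨j, hj⟩ := Function.ne_iff.mp hw0
  have h1 : P.mulVec ((Matrix.single 0 j 1 : Matrix (Fin k) (Fin k) F).mulVec w) = 0 := by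
    rw [Matrix.mulVec_mulVec, ← key, ← Matrix.mulVec_mulVec, hw, Matrix.mulVec_zero]
  have h2 := congrFun h1 p
  have h3 : (Matrix.single 0 j 1 : Matrix (Fin k) (Fin k) F).mulVec w = Pi.single 0 (w j) := by
    funext a
    rw [Matrix.mulVec, dotProduct]
    by_cases ha : a = 0
    · subst ha; simp [Matrix.single_apply]
    · simp [Matrix.single_apply, ha, Ne.symm ha]
  rw [h3] at h2
  simp [hP] at h2
  rcases h2 with h2 | h2
  · exact hpr h2
  · exact hj h2

section
variable {N : Type} [Fintype N] [DecidableEq N] {d : N → ℕ}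

theorem tens_eq {A B : ∀ n, Mt F d n} (hA : ∀ n, ∃ i j, A n i j ≠ 0) (h : tens A = tens B) :
    ∃ c : N → F, (∀ n, A n = c n • B n) ∧ ∏ n, c n = 1 := by
  choose p r hpr using hA
  have h1 : ∀ n, ∃ c : F, A n = c • B n := by
    intro n
    have h2 : ∀ i j, A n i j * ∏ m ∈ Finset.univ.erase n, A m (p m) (r m)
        = B n i j * ∏ m ∈ Finset.univ.erase n, B m (p m) (r m) := by
      intro i j
      have e : ∀ C : ∀ n, Mt F d n, tens C (Function.update p n i) (Function.update r n j)
          = C n i j * ∏ m ∈ Finset.univ.erase n, C m (p m) (r m) := by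
        intro C
        simp only [tens, Matrix.of_apply]
        rw [← Finset.mul_prod_erase _ _ (Finset.mem_univ n)]
        congr 1
        · simp
        · refine Finset.prod_congr rfl fun m hm => ?_
          rw [Function.update_of_ne (Finset.ne_of_mem_erase hm), Function.update_of_ne (Finset.ne_of_mem_erase hm)]
      rw [← e, ← e, h]
    have h3 : ∏ m ∈ Finset.univ.erase n, A m (p m) (r m) ≠ 0 := Finset.prod_ne_zero_iff.mpr fun m _ => hpr m
    refine ⟨(∏ m ∈ Finset.univ.erase n, B m (p m) (r m)) / ∏ m ∈ Finset.univ.erase n, A m (p m) (r m), ?_⟩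
    ext i j
    have := h2 i j
    rw [Matrix.smul_apply, smul_eq_mul]
    field_simp
    linear_combination this
  choose c hc using h1
  refine ⟨c, hc, ?_⟩
  have h4 : tens A = (∏ n, c n) • tens A := by
    conv_rhs => rw [h, ← tens_smul]
    congr 1
    funext n
    exact hc n
  have h5 := congrFun (congrFun h4 p) r
  have h6 : tens A p r ≠ 0 := Finset.prod_ne_zero_iff.mpr fun m _ => hpr m
  rw [Matrix.smul_apply, smul_eq_mul] at h5
  exact (mul_eq_right₀ h6).mp h5.symm

variable [∀ n, NeZero (d n)]

/-- normalizing each factor forces being a pure tensor -/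
theorem tens_of_norm {T T' : MI F d} (hTT : T * T' = 1) (hT'T : T' * T = 1)
    (h : ∀ n a, ∃ b, T * iot n a * T' = iot n b) : ∃ A : ∀ n, Mt F d n, ∃ c : F, (∀ n, (A n).det ≠ 0) ∧ T = c • tens A := by
  choose f hf using h
  have hmul : ∀ X Y : MI F d, T * (X * Y) * T' = (T * X * T') * (T * Y * T') := by
    intro X Y
    calc T * (X * Y) * T' = T * X * 1 * Y * T' := by simp [mul_assoc]
      _ = _ := by rw [← hT'T]; simp [mul_assoc]
  have hsk : ∀ n, ∃ P : Mt F d n, P.det ≠ 0 ∧ ∀ M, f n M * P = P * M := by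
    intro n
    let g : Mt F d n →ₐ[F] Mt F d n := AlgHom.ofLinearMap
      { toFun := f n
        map_add' := fun a b => by
          apply iot_inj n
          rw [map_add, ← hf, ← hf, ← hf, map_add, mul_add, add_mul]
        map_smul' := fun c a => by
          apply iot_inj n
          rw [RingHom.id_apply, map_smul, ← hf, ← hf, map_smul, mul_smul_comm, smul_mul_assoc] }
      (by
        apply iot_inj n
        show iot n (f n 1) = _
        rw [← hf, map_one, mul_one, hTT])
      (by
        intro a b
        apply iot_inj n
        show iot n (f n (a * b)) = iot n (f n a * f n b)
        rw [map_mul, ← hf, ← hf, ← hf, map_mul, hmul])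
    exact skolem g
  choose P hP hfP using hsk
  have hinv : ∀ n, P n * (P n)⁻¹ = 1 := fun n => Matrix.mul_nonsing_inv _ (isUnit_iff_ne_zero.mpr (hP n))
  have hinv' : ∀ n, (P n)⁻¹ * P n = 1 := fun n => Matrix.nonsing_inv_mul _ (isUnit_iff_ne_zero.mpr (hP n))
  have h1 : ∀ n a, Commute (iot n a) (tens (fun n => (P n)⁻¹) * T) := by
    intro n a
    have e1 : T * iot n a = iot n (f n a) * T := by
      rw [← hf, mul_assoc, hT'T, mul_one]
    show _ * _ = _ * _
    rw [mul_assoc, e1, ← mul_assoc, ← mul_assoc, iot_tens, tens_iot]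
    congr 3
    calc a * (P n)⁻¹ = (P n)⁻¹ * (P n * a) * (P n)⁻¹ := by rw [← mul_assoc, hinv', one_mul]
      _ = _ := by rw [← hfP, ← mul_assoc, mul_assoc, hinv, mul_one]
  obtain ⟨c, hc⟩ := scalar_of_comm h1
  refine ⟨P, c, hP, ?_⟩
  have h2 : tens P * tens (fun n => (P n)⁻¹) = 1 := by
    rw [tens_mul, ← tens_one]; congr 1; funext n; exact hinv n
  calc T = tens P * (tens (fun n => (P n)⁻¹) * T) := by rw [← mul_assoc, h2, one_mul]
    _ = _ := by rw [hc, mul_smul_comm, mul_one]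

end

/-- sizes of the three factors -/
def dd : Fin 3 → ℕ := ![6, 3, 2]
theorem dd_ge (n : Fin 3) : 2 ≤ dd n := by revert n; decide
instance (n : Fin 3) : NeZero (dd n) := ⟨by have := dd_ge n; omega⟩

theorem single_not_comm {k : ℕ} {i j l : Fin k} (hij : i ≠ j) :
    ¬ Commute (Matrix.single i j (1 : F)) (Matrix.single j l 1) := by
  intro h
  have h1 := congrFun (congrFun h.eq i) l
  rw [Matrix.single_mul_single_same] at h1
  by_cases hl : l = i
  · subst hl
    rw [Matrix.single_mul_single_same] at h1
    simp [Matrix.single_apply, hij.symm] at h1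
  · rw [Matrix.single_mul_single_of_ne _ _ _ _ hl] at h1
    simp at h1

theorem tens_of_sum [CharZero F] {T T' : MI F dd} (hTT : T * T' = 1) (hT'T : T' * T = 1)
    (h : ∀ n (i j : Fin (dd n)), i ≠ j → ∃ a : ∀ n, Mt F dd n, T * iot n (Matrix.single i j 1) * T' = ∑ m, iot m (a m)) :
    ∃ A : ∀ n, Mt F dd n, ∃ c : F, (∀ n, (A n).det ≠ 0) ∧ T = c • tens A := by
  have hmul : ∀ X Y : MI F dd, T * (X * Y) * T' = (T * X * T') * (T * Y * T') := by
    intro X Y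
    calc T * (X * Y) * T' = T * X * 1 * Y * T' := by simp [mul_assoc]
      _ = _ := by rw [← hT'T]; simp [mul_assoc]
  have hinj : ∀ X Y : MI F dd, T * X * T' = T * Y * T' → X = Y := by
    intro X Y hXY
    have := congrArg (fun Z => T' * Z * T) hXY
    simp only [← mul_assoc, hT'T, one_mul] at this
    simpa only [mul_assoc, hT'T, mul_one] using this
  have hone : ∀ n (i j : Fin (dd n)), i ≠ j → ∃ m, ∃ b, T * iot n (Matrix.single i j 1) * T' = iot m b := by
    intro n i j hij
    obtain ⟨a, ha⟩ := h n i j hij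
    rw [ha]
    apply sq_zero_factor
    rw [← ha, ← hmul, ← map_mul, Matrix.single_mul_single_of_ne _ _ _ _ hij.symm]
    simp
  choose! σ b hσ using hone
  have hstep : ∀ n (i j l : Fin (dd n)), i ≠ j → j ≠ l → σ n i j = σ n j l := by
    intro n i j l hij hjl
    by_contra hne
    have := iot_comm hne (b n i j) (b n j l)
    rw [← hσ _ _ _ hij, ← hσ _ _ _ hjl] at this
    have e := this.eq
    rw [← hmul, ← hmul] at e
    have e2 := hinj _ _ e
    rw [← map_mul, ← map_mul] at e2
    exact single_not_comm hij (iot_inj n e2)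
  have hfac : ∀ n, ∃ m, ∀ a, ∃ c, T * iot n a * T' = iot m c := by
    intro n
    have h01 : (⟨0, by have := dd_ge n; omega⟩ : Fin (dd n)) ≠ ⟨1, by have := dd_ge n; omega⟩ := by simp
    obtain ⟨o, ho⟩ : ∃ o : Fin (dd n), o = ⟨0, by have := dd_ge n; omega⟩ := ⟨_, rfl⟩
    obtain ⟨o', ho'⟩ : ∃ o : Fin (dd n), o = ⟨1, by have := dd_ge n; omega⟩ := ⟨_, rfl⟩
    rw [← ho, ← ho'] at h01
    have hall : ∀ i j, i ≠ j → σ n i j = σ n o o' := by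
      intro i j hij
      by_cases hjo : j = o
      · subst hjo; exact hstep n _ _ _ hij h01
      · rw [hstep n _ _ _ hij hjo, hstep n _ _ _ hjo h01]
    let S : Subalgebra F (MI F dd) := (iot (F := F) (d := dd) (σ n o o')).range
    have hoff : ∀ i j, i ≠ j → T * iot n (Matrix.single i j 1) * T' ∈ S := by
      intro i j hij
      rw [hσ n i j hij]
      have := hall i j hij
      generalize b n i j = z at *
      generalize σ n i j = s at *
      subst this
      exact ⟨z, rfl⟩
    have hon : ∀ i j, T * iot n (Matrix.single i j 1) * T' ∈ S := by
      intro i j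
      by_cases hij : i = j
      · subst hij
        obtain ⟨k, hk⟩ : ∃ k, k ≠ i := by
          by_cases h : i = o
          · exact ⟨o', h ▸ h01.symm⟩
          · exact ⟨o, Ne.symm h⟩
        have : (Matrix.single i i 1 : Mt F dd n) = Matrix.single i k 1 * Matrix.single k i 1 := by
          rw [Matrix.single_mul_single_same]; simp
        rw [this, map_mul, hmul]
        exact S.mul_mem (hoff _ _ hk.symm) (hoff _ _ hk)
      · exact hoff _ _ hij
    refine ⟨σ n o o', fun a => ?_⟩
    have : T * iot n a * T' ∈ S := by
      rw [Matrix.matrix_eq_sum_single a, map_sum, Finset.mul_sum, Finset.sum_mul]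
      refine S.sum_mem fun i _ => ?_
      rw [map_sum, Finset.mul_sum, Finset.sum_mul]
      refine S.sum_mem fun j _ => ?_
      have : Matrix.single i j (a i j) = a i j • Matrix.single i j (1 : F) := by simp [Matrix.smul_single]
      rw [this, map_smul, mul_smul_comm, smul_mul_assoc]
      exact S.smul_mem (hon i j) _
    obtain ⟨c, hc⟩ := this
    exact ⟨c, hc.symm⟩
  choose τ hf using hfac
  have hfl : ∀ n m, (∀ a : Mt F dd n, ∃ c, T * iot n a * T' = iot m c) →
      ∃ g : Mt F dd n →ₗ[F] Mt F dd m, (∀ a, T * iot n a * T' = iot m (g a)) ∧ Function.Injective g := by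
    intro n m hnm
    choose f hf using hnm
    refine ⟨{ toFun := f
              map_add' := fun a b => by
                apply iot_inj m
                rw [map_add, ← hf, ← hf, ← hf, map_add, mul_add, add_mul]
              map_smul' := fun c a => by
                apply iot_inj m
                rw [RingHom.id_apply, map_smul, ← hf, ← hf, map_smul, mul_smul_comm, smul_mul_assoc] }, hf, ?_⟩
    intro a b hab
    have : iot m (f a) = iot m (f b) := congrArg _ hab
    rw [← hf, ← hf] at this
    exact iot_inj n (hinj _ _ this)
  have hle : ∀ n, dd n ≤ dd (τ n) := by
    intro n
    obtain ⟨g, -, hg⟩ := hfl n _ (hf n)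
    have := LinearMap.finrank_le_finrank_of_injective hg
    rw [Module.finrank_matrix, Module.finrank_matrix] at this
    simp at this
    nlinarith
  have hstab : ∀ n n', n ≠ n' → τ n = n → τ n' ≠ n := by
    intro n n' hne h1 h2
    have f1 := hf n
    rw [h1] at f1
    have f2 := hf n'
    rw [h2] at f2
    obtain ⟨g, hg, hgi⟩ := hfl n n f1
    have hsurj := LinearMap.surjective_of_injective hgi
    have h01 : (⟨0, by have := dd_ge n'; omega⟩ : Fin (dd n')) ≠ ⟨1, by have := dd_ge n'; omega⟩ := by simp
    generalize (⟨0, by have := dd_ge n'; omega⟩ : Fin (dd n')) = o at h01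
    generalize (⟨1, by have := dd_ge n'; omega⟩ : Fin (dd n')) = o' at h01
    obtain ⟨x, hx⟩ := f2 (Matrix.single o o' 1)
    have hxc : ∀ y, Commute y x := by
      intro y
      obtain ⟨z, rfl⟩ := hsurj y
      apply iot_inj n
      rw [map_mul, map_mul, ← hx, ← hg, ← hmul, ← hmul, (iot_comm hne _ _).eq]
    obtain ⟨c, hc⟩ := Matrix.mem_range_scalar_of_commute_single (M := x) (fun p r _ => hxc _)
    have h3 : x = c • 1 := by rw [← hc, Matrix.scalar_apply, Matrix.smul_one_eq_diagonal]
    have h4 : T * iot n' (Matrix.single o o' 1) * T' = T * iot n' (c • 1) * T' := by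
      rw [hx, h3, map_smul, map_smul, map_one, map_one, mul_smul_comm, smul_mul_assoc, mul_one, hTT]
    have h5 := iot_inj n' (hinj _ _ h4)
    have h6 := congrFun (congrFun h5 o) o'
    simp [Matrix.one_apply_ne h01] at h6
  have hτ : ∀ n, τ n = n := by
    have t0 : τ 0 = 0 := by
      have := hle 0
      generalize τ 0 = s at *
      revert s; decide
    have t1 : τ 1 = 1 := by
      have h1 := hle 1
      have h2 := hstab 0 1 (by decide) t0
      generalize τ 1 = s at *
      revert s; decide
    have t2 : τ 2 = 2 := by
      have h2 := hstab 0 2 (by decide) t0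
      have h3 := hstab 1 2 (by decide) t1
      generalize τ 2 = s at *
      revert s; decide
    intro n
    fin_cases n
    · exact t0
    · exact t1
    · exact t2
  refine tens_of_norm hTT hT'T fun n a => ?_
  have := hf n a
  rwa [hτ n] at this

end tens
end E8

namespace E8

section pairs
variable {F : Type} [Field F] {k : ℕ} [NeZero k]

def Shm (F : Type) [Field F] (k : ℕ) [NeZero k] : Matrix (Fin k) (Fin k) F := Matrix.of fun i j => if i = j + 1 then 1 else 0
def Dgm (ω : F) (k : ℕ) : Matrix (Fin k) (Fin k) F := Matrix.diagonal fun i => ω ^ i.val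

theorem mul_Shm (P : Matrix (Fin k) (Fin k) F) (i j : Fin k) : (P * Shm F k) i j = P i (j + 1) := by
  simp [Matrix.mul_apply, Shm]

theorem Shm_mul (P : Matrix (Fin k) (Fin k) F) (i j : Fin k) : (Shm F k * P) (i + 1) j = P i j := by
  simp [Matrix.mul_apply, Shm]

theorem mul_Dgm (ω : F) (P : Matrix (Fin k) (Fin k) F) (i j : Fin k) : (P * Dgm ω k) i j = P i j * ω ^ j.val := by
  simp [Dgm]

theorem Dgm_mul (ω : F) (P : Matrix (Fin k) (Fin k) F) (i j : Fin k) : (Dgm ω k * P) i j = ω ^ i.val * P i j := by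
  simp [Dgm]

theorem omega_inj {ω : F} (hω : IsPrimitiveRoot ω k) {i j : Fin k} (h : ω ^ i.val = ω ^ j.val) : i = j :=
  Fin.ext (hω.pow_inj i.2 j.2 h)

theorem DS_comm {ω : F} (hω : IsPrimitiveRoot ω k) {M : Matrix (Fin k) (Fin k) F}
    (h1 : M * Dgm ω k = Dgm ω k * M) (h2 : M * Shm F k = Shm F k * M) : ∃ c : F, M = c • 1 := by
  have hd : ∀ i j, i ≠ j → M i j = 0 := by
    intro i j hij
    have := congrFun (congrFun h1 i) j
    rw [mul_Dgm, Dgm_mul] at this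
    by_contra h0
    apply hij
    apply omega_inj hω
    have h3 : M i j * ω ^ i.val = M i j * ω ^ j.val := by rw [this, mul_comm]
    exact mul_left_cancel₀ h0 h3
  have hs : ∀ i : Fin k, M (i + 1) (i + 1) = M i i := by
    intro i
    have := congrFun (congrFun h2 (i + 1)) i
    rwa [mul_Shm, Shm_mul] at this
  have hc : ∀ n : ℕ, ∀ i : Fin k, i.val = n → M i i = M 0 0 := by
    intro n
    induction n with
    | zero =>
      intro i hi
      have : i = 0 := Fin.ext (by simp [hi])
      rw [this]
    | succ n ih =>
      intro i hi
      have hn : n < k := by have := i.2; omega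
      have e : (⟨n, hn⟩ : Fin k) + 1 = i := by
        apply Fin.ext
        rw [Fin.val_add, hi]
        have h1k : 1 < k := by have := i.2; omega
        have : ((1 : Fin k) : ℕ) = 1 := by
          rw [Fin.val_one', Nat.mod_eq_of_lt h1k]
        rw [this]
        show (n + 1) % k = n + 1
        exact Nat.mod_eq_of_lt (hi ▸ i.2)
      rw [← e, hs, ih ⟨n, hn⟩ rfl]
  refine ⟨M 0 0, ?_⟩
  ext i j
  by_cases h : i = j
  · subst h; simp [hc _ i rfl]
  · simp [hd i j h, Matrix.one_apply_ne h]

theorem qc_pow {ω : F} {X Y : Matrix (Fin k) (Fin k) F} (h : X * Y = ω • (Y * X)) (n : ℕ) :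
    X * Y ^ n = ω ^ n • (Y ^ n * X) := by
  induction n with
  | zero => simp
  | succ n ih =>
    rw [pow_succ, ← mul_assoc, ih, smul_mul_assoc, mul_assoc (Y ^ n), h, mul_smul_comm, smul_smul, mul_assoc, pow_succ]

theorem pair_normal [IsAlgClosed F] {ω : F} (hω : IsPrimitiveRoot ω k) {X Y : Matrix (Fin k) (Fin k) F}
    (hX : X.det ≠ 0) (hY : Y.det ≠ 0) (h : X * Y = ω • (Y * X)) :
    ∃ (P : Matrix (Fin k) (Fin k) F) (a b : F), P.det ≠ 0 ∧ a ≠ 0 ∧ b ≠ 0 ∧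
      X * P = a • (P * Dgm ω k) ∧ Y * P = b • (P * Shm F k) := by
  have hk : 0 < k := Nat.pos_of_ne_zero (NeZero.ne k)
  have hω0 : ω ≠ 0 := hω.ne_zero hk.ne'
  -- common eigenvector
  have hcomm : Commute X (Y ^ k) := by
    have := qc_pow h k
    rw [hω.pow_eq_one, one_smul] at this
    exact this
  haveI : Nonempty (Fin k) := ⟨0⟩
  obtain ⟨a, ha⟩ := Module.End.exists_eigenvalue (Matrix.toLin' X)
  have hinv : ∀ y ∈ Module.End.eigenspace (Matrix.toLin' X) a, Matrix.toLin' (Y ^ k) y ∈ Module.End.eigenspace (Matrix.toLin' X) a := by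
    intro y hy
    rw [Module.End.mem_eigenspace_iff] at hy ⊢
    rw [Matrix.toLin'_apply] at hy
    rw [Matrix.toLin'_apply, Matrix.toLin'_apply, Matrix.mulVec_mulVec, hcomm.eq, ← Matrix.mulVec_mulVec, hy, Matrix.mulVec_smul]
  haveI : Nontrivial (Module.End.eigenspace (Matrix.toLin' X) a) := Submodule.nontrivial_iff_ne_bot.mpr ha
  obtain ⟨β, hβ⟩ := Module.End.exists_eigenvalue ((Matrix.toLin' (Y ^ k)).restrict hinv)
  obtain ⟨u', hu'⟩ := hβ.exists_hasEigenvector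
  obtain ⟨u, hu⟩ := u'
  have hu0 : u ≠ 0 := fun h0 => hu'.2 (Subtype.ext h0)
  have hXu : X.mulVec u = a • u := by
    rw [Module.End.mem_eigenspace_iff, Matrix.toLin'_apply] at hu
    exact hu
  have hYu : (Y ^ k).mulVec u = β • u := by
    have := congrArg Subtype.val hu'.apply_eq_smul
    rw [LinearMap.restrict_apply] at this
    exact this
  have hinjv : ∀ {Z : Matrix (Fin k) (Fin k) F}, Z.det ≠ 0 → ∀ {v}, Z.mulVec v = 0 → v = 0 := by
    intro Z hZ v hv
    by_contra hv0
    exact hZ (Matrix.exists_mulVec_eq_zero_iff.mp ⟨v, hv0, hv⟩)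
  have ha0 : a ≠ 0 := by
    rintro rfl
    exact hu0 (hinjv hX (by rw [hXu, zero_smul]))
  have hYn : ∀ n, (Y ^ n).det ≠ 0 := fun n => by rw [Matrix.det_pow]; exact pow_ne_zero _ hY
  have hβ0 : β ≠ 0 := by
    rintro rfl
    exact hu0 (hinjv (hYn k) (by rw [hYu, zero_smul]))
  obtain ⟨b, hb⟩ := IsAlgClosed.exists_pow_nat_eq β hk
  have hb0 : b ≠ 0 := by
    rintro rfl
    exact hβ0 (by rw [← hb, zero_pow hk.ne'])
  obtain ⟨w, hw⟩ : ∃ w : ℕ → Fin k → F, ∀ n, w n = (b⁻¹) ^ n • (Y ^ n).mulVec u := ⟨_, fun _ => rfl⟩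
  have hYw : ∀ n, Y.mulVec (w n) = b • w (n + 1) := by
    intro n
    rw [hw, hw, Matrix.mulVec_smul, Matrix.mulVec_mulVec, smul_smul, ← pow_succ' Y]
    congr 1
    rw [pow_succ', ← mul_assoc, mul_inv_cancel₀ hb0, one_mul]
  have hwk : w k = w 0 := by
    rw [hw, hw, hYu, smul_smul, ← hb, ← mul_pow, inv_mul_cancel₀ hb0]; simp
  have hXw : ∀ n, X.mulVec (w n) = (a * ω ^ n) • w n := by
    intro n
    rw [hw, Matrix.mulVec_smul, Matrix.mulVec_mulVec, qc_pow h, Matrix.smul_mulVec, ← Matrix.mulVec_mulVec, hXu,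
      Matrix.mulVec_smul, smul_smul, smul_smul, smul_smul]
    congr 1; ring
  have hw0 : ∀ n, w n ≠ 0 := by
    intro n h0
    rw [hw, smul_eq_zero] at h0
    rcases h0 with h0 | h0
    · exact pow_ne_zero n (inv_ne_zero hb0) h0
    · exact hu0 (hinjv (hYn n) h0)
  obtain ⟨P, hP⟩ : ∃ P : Matrix (Fin k) (Fin k) F, ∀ i j, P i j = w j.val i := ⟨Matrix.of fun i j => w j.val i, fun _ _ => rfl⟩
  refine ⟨P, a, b, ?_, ha0, hb0, ?_, ?_⟩
  · have hli : LinearIndependent F P.col := by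
      apply Module.End.eigenvectors_linearIndependent' (Matrix.toLin' X) (fun j : Fin k => a * ω ^ j.val)
      · intro i j hij
        exact omega_inj hω (mul_left_cancel₀ ha0 hij)
      · intro j
        have : P.col j = w j.val := by funext i; exact hP i j
        rw [this]
        refine ⟨?_, hw0 _⟩
        rw [Module.End.mem_eigenspace_iff, Matrix.toLin'_apply, hXw]
    have := Matrix.linearIndependent_cols_iff_isUnit.mp hli
    rw [Matrix.isUnit_iff_isUnit_det] at this
    exact this.ne_zero
  · ext i j
    have := congrFun (hXw j.val) i
    rw [Matrix.smul_apply, mul_Dgm, hP, Matrix.mul_apply]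
    simp only [hP]
    rw [Matrix.mulVec, dotProduct] at this
    rw [this]
    simp; ring
  · ext i j
    have := congrFun (hYw j.val) i
    rw [Matrix.smul_apply, mul_Shm, hP, Matrix.mul_apply]
    simp only [hP]
    rw [Matrix.mulVec, dotProduct] at this
    rw [this]
    have e : w (j + 1 : Fin k).val = w (j.val + 1) := by
      rw [Fin.val_add, Fin.val_one', Nat.add_mod_mod]
      rcases Nat.lt_or_ge (j.val + 1) k with hlt | hge
      · rw [Nat.mod_eq_of_lt hlt]
      · have : j.val + 1 = k := by have := j.2; omega
        rw [this, Nat.mod_self, hwk]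
    rw [e]; rfl

theorem pair_conj [IsAlgClosed F] {ω : F} (hω : IsPrimitiveRoot ω k) {X Y X' Y' : Matrix (Fin k) (Fin k) F}
    (hX : X.det ≠ 0) (hY : Y.det ≠ 0) (h : X * Y = ω • (Y * X))
    (hX' : X'.det ≠ 0) (hY' : Y'.det ≠ 0) (h' : X' * Y' = ω • (Y' * X')) :
    ∃ (P : Matrix (Fin k) (Fin k) F) (s t : F), P.det ≠ 0 ∧ P * X = s • (X' * P) ∧ P * Y = t • (Y' * P) := by
  obtain ⟨P, a, b, hP, ha, hb, e1, e2⟩ := pair_normal hω hX hY h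
  obtain ⟨P', a', b', hP', ha', hb', e1', e2'⟩ := pair_normal hω hX' hY' h'
  have i1 : P * P⁻¹ = 1 := Matrix.mul_nonsing_inv _ (isUnit_iff_ne_zero.mpr hP)
  have i2 : P⁻¹ * P = 1 := Matrix.nonsing_inv_mul _ (isUnit_iff_ne_zero.mpr hP)
  have key : ∀ {X X' D : Matrix (Fin k) (Fin k) F} {a a' : F}, a' ≠ 0 → X * P = a • (P * D) → X' * P' = a' • (P' * D) →
      P' * P⁻¹ * X = (a / a') • (X' * (P' * P⁻¹)) := by
    intro X X' D a a' ha' e e'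
    calc P' * P⁻¹ * X = P' * P⁻¹ * (X * P) * P⁻¹ := by simp only [mul_assoc, i1, mul_one]
      _ = a • (P' * D * P⁻¹) := by
        rw [e, mul_smul_comm, smul_mul_assoc, ← mul_assoc, mul_assoc P', i2, mul_one]
      _ = (a / a') • (X' * P' * P⁻¹) := by
        rw [e', smul_mul_assoc, smul_smul, div_mul_cancel₀ _ ha']
      _ = _ := by rw [mul_assoc]
  refine ⟨P' * P⁻¹, a / a', b / b', ?_, key ha' e1 e1', key hb' e2 e2'⟩
  rw [Matrix.det_mul]
  refine mul_ne_zero hP' ?_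
  intro h0
  have := congrArg Matrix.det i1
  rw [Matrix.det_mul, h0, mul_zero, Matrix.det_one] at this
  exact zero_ne_one this

theorem pair_comm [IsAlgClosed F] {ω : F} (hω : IsPrimitiveRoot ω k) {X Y M : Matrix (Fin k) (Fin k) F}
    (hX : X.det ≠ 0) (hY : Y.det ≠ 0) (h : X * Y = ω • (Y * X)) (h1 : M * X = X * M) (h2 : M * Y = Y * M) :
    ∃ c : F, M = c • 1 := by
  obtain ⟨P, a, b, hP, ha, hb, e1, e2⟩ := pair_normal hω hX hY h
  have i1 : P * P⁻¹ = 1 := Matrix.mul_nonsing_inv _ (isUnit_iff_ne_zero.mpr hP)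
  have i2 : P⁻¹ * P = 1 := Matrix.nonsing_inv_mul _ (isUnit_iff_ne_zero.mpr hP)
  have key : ∀ {X D : Matrix (Fin k) (Fin k) F} {a : F}, a ≠ 0 → X * P = a • (P * D) → M * X = X * M →
      (P⁻¹ * M * P) * D = D * (P⁻¹ * M * P) := by
    intro X D a ha e hM
    have hD : D = a⁻¹ • (P⁻¹ * (X * P)) := by
      rw [e, mul_smul_comm, smul_smul, inv_mul_cancel₀ ha, one_smul, ← mul_assoc, i2, one_mul]
    rw [hD, mul_smul_comm, smul_mul_assoc]
    congr 1
    calc P⁻¹ * M * P * (P⁻¹ * (X * P)) = P⁻¹ * M * (P * P⁻¹) * X * P := by simp only [mul_assoc]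
      _ = P⁻¹ * (M * X) * P := by rw [i1]; simp only [mul_assoc, one_mul]
      _ = P⁻¹ * X * (P * P⁻¹) * M * P := by rw [hM, i1]; simp only [mul_assoc, one_mul]
      _ = _ := by simp only [mul_assoc]
  obtain ⟨c, hc⟩ := DS_comm hω (key ha e1 h1) (key hb e2 h2)
  refine ⟨c, ?_⟩
  calc M = P * (P⁻¹ * M * P) * P⁻¹ := by
        simp only [← mul_assoc, i1, one_mul]; rw [mul_assoc, i1, mul_one]
    _ = _ := by rw [hc, mul_smul_comm, smul_mul_assoc, mul_one, i1]

end pairs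
end E8

namespace E8

/-- weights of the three factors, relative to the lowest one -/
def DD (n : Fin 3) (i : ℕ) : V :=
  ((![[0, ![0,0,0,0,1,0,0,0], ![0,0,0,0,1,1,0,0], ![0,0,0,0,1,1,1,0], ![0,0,0,0,1,1,1,1], ![-2,-3,-4,-6,-4,-3,-2,-1]],
      [0, ![0,0,1,0,0,0,0,0], ![1,0,1,0,0,0,0,0]],
      [0, ![0,1,0,0,0,0,0,0]]] : Fin 3 → List V) n).getD i 0

/-- roots of the factors -/
def del (n : Fin 3) (i j : ℕ) : V := DD n i - DD n j

/-- weights of the degree one part -/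
def wt (x : Ix dd) : V := al 3 + ∑ n, DD n (x n)

theorem DD_zero (n : Fin 3) : DD n 0 = 0 := by revert n; decide +kernel

theorem DD_three : ∀ (n : Fin 3) (i : Fin (dd n)), DD n i 3 % 6 = 0 := by decide +kernel

theorem bl_al_DD : ∀ (n : Fin 3) (a i : Fin (dd n)),
    bl (al 3 + DD n a) (DD n i) = (if a = i then 1 else 0) - (if a.val = 0 then 1 else 0) := by decide +kernel

theorem bl_DD : ∀ (n m : Fin 3), n ≠ m → ∀ (a : Fin (dd n)) (i : Fin (dd m)), bl (DD n a) (DD m i) = 0 := by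
  decide +kernel

theorem q_del : ∀ (n : Fin 3) (i j : Fin (dd n)), i ≠ j → q (del n i j) = 2 := by decide +kernel

theorem bl_del_ne {n m : Fin 3} (h : n ≠ m) (i j : Fin (dd n)) (a b : Fin (dd m)) : bl (del n i j) (del m a b) = 0 := by
  simp only [del, bl_sub, sub_bl, bl_DD n m h]; norm_num

theorem q_add_bl (l m : V) : q (l + m) = q l + q m + 2 * bl l m := by
  rw [q_bl, bl_add, add_bl, add_bl, ← q_bl, ← q_bl, bl_comm m l]; ring

theorem bl_wt_DD (x : Ix dd) (n : Fin 3) (i : Fin (dd n)) :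
    bl (wt x) (DD n i) = (if x n = i then 1 else 0) - (if (x n).val = 0 then 1 else 0) := by
  have : wt x = (al 3 + DD n (x n)) + ∑ m ∈ Finset.univ.erase n, DD m (x m) := by
    rw [wt, ← Finset.add_sum_erase _ _ (Finset.mem_univ n), add_assoc]
  rw [this, add_bl, bl_al_DD, bl_comm _ (DD n i)]
  have h2 : ∀ s : Finset (Fin 3), n ∉ s → bl (DD n i) (∑ m ∈ s, DD m (x m)) = 0 := by
    intro s
    induction s using Finset.induction_on with
    | empty =>
      intro _
      have := bl_smul 0 (DD n i) 0
      simpa using this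
    | insert m s hm ih =>
      intro hn
      rw [Finset.mem_insert, not_or] at hn
      rw [Finset.sum_insert hm, bl_add, ih hn.2, bl_DD n m hn.1, add_zero]
  rw [h2 _ (Finset.notMem_erase _ _), add_zero]

theorem bl_wt_del (x : Ix dd) (n : Fin 3) (i j : Fin (dd n)) :
    bl (wt x) (del n i j) = (if x n = i then 1 else 0) - (if x n = j then 1 else 0) := by
  rw [del, bl_sub, bl_wt_DD, bl_wt_DD]; ring

theorem wt_update (x : Ix dd) (n : Fin 3) (i : Fin (dd n)) : wt (Function.update x n i) = wt x + del n i (x n) := by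
  rw [wt, wt, del, ← Finset.add_sum_erase _ _ (Finset.mem_univ n), ← Finset.add_sum_erase _ (fun n => DD n (x n)) (Finset.mem_univ n)]
  have : ∑ m ∈ Finset.univ.erase n, DD m ((Function.update x n i m : Fin (dd m)) : ℕ) = ∑ m ∈ Finset.univ.erase n, DD m (x m) :=
    Finset.sum_congr rfl fun m hm => by rw [Function.update_of_ne (Finset.ne_of_mem_erase hm)]
  rw [this, Function.update_self]
  abel

theorem q_wt_aux : ∀ (a : Fin (dd 0)) (b : Fin (dd 1)) (c : Fin (dd 2)), q (al 3 + (DD 0 a + DD 1 b + DD 2 c)) = 2 := by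
  decide +kernel

theorem wt_eq (x : Ix dd) : wt x = al 3 + (DD 0 (x 0) + DD 1 (x 1) + DD 2 (x 2)) := by
  rw [wt, Fin.sum_univ_three]

theorem q_wt (x : Ix dd) : q (wt x) = 2 := by
  rw [wt_eq]; exact q_wt_aux _ _ _

theorem wt_three (x : Ix dd) : wt x 3 % 6 = 1 := by
  have h0 := DD_three 0 (x 0)
  have h1 := DD_three 1 (x 1)
  have h2 := DD_three 2 (x 2)
  rw [wt_eq]
  show (1 + (DD 0 (x 0) 3 + DD 1 (x 1) 3 + DD 2 (x 2) 3)) % 6 = 1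
  omega

theorem del_three (n : Fin 3) (i j : Fin (dd n)) : del n i j 3 % 6 = 0 := by
  have h0 := DD_three n i
  have h1 := DD_three n j
  show (DD n i 3 - DD n j 3) % 6 = 0
  omega

theorem root_one' : ∀ l ∈ rootL, l 3 % 6 = 1 → ∃ (a : Fin (dd 0)) (b : Fin (dd 1)) (c : Fin (dd 2)),
    l = al 3 + (DD 0 a + DD 1 b + DD 2 c) := by decide +kernel

theorem root_one {l : V} (hl : q l = 2) (h : l 3 % 6 = 1) : ∃ x, l = wt x := by
  obtain ⟨a, b, c, h⟩ := root_one' l (mem_rootL.mpr hl) h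
  refine ⟨Fin.cons a (Fin.cons b (Fin.cons c (fun i => i.elim0))), ?_⟩
  rw [wt_eq]; exact h

theorem root_zero' : ∀ l ∈ rootL, l 3 % 6 = 0 → ∃ (n : Fin 3) (i j : Fin (dd n)), i ≠ j ∧ l = del n i j := by
  decide +kernel

theorem root_zero {l : V} (hl : q l = 2) (h : l 3 % 6 = 0) : ∃ (n : Fin 3) (i j : Fin (dd n)), i ≠ j ∧ l = del n i j :=
  root_zero' l (mem_rootL.mpr hl) h

theorem q_zero : q 0 = 0 := by decide

theorem wt_inj : Function.Injective wt := by
  intro x y h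
  funext n
  have h1 := bl_wt_DD x n (x n)
  have h2 := bl_wt_DD y n (x n)
  have h3 := bl_wt_DD x n (y n)
  have h4 := bl_wt_DD y n (y n)
  rw [h] at h1 h3
  rw [if_pos rfl] at h1 h4
  by_contra hne
  rw [if_neg (Ne.symm hne)] at h2
  rw [if_neg hne] at h3
  omega

section
variable {F L : Type} [Field F] [LieRing L] [LieAlgebra F L] [CharZero F] [Nontrivial L]
namespace Gen

/-- nice basis of the degree one part -/
def IsBas (G : Gen F L) (v : Ix dd → L) : Prop :=
  (∀ x, v x ∈ G.W (wt x) ∧ v x ≠ 0) ∧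
  ∀ (n : Fin 3) (i j : Fin (dd n)), i ≠ j → ∃ z ∈ G.W (del n i j), z ≠ 0 ∧
    ∀ x, ⁅z, v x⁆ = if x n = j then v (Function.update x n i) else 0

theorem W_zero_of_q (G : Gen F L) {l : V} (h : 4 ≤ q l) {y : L} (hy : y ∈ G.W l) : y = 0 := by
  rw [G.W_bot (l := l) (by rintro rfl; rw [q_zero] at h; omega) (by omega)] at hy
  simpa using hy

theorem exists_bas (G : Gen F L) : ∃ v, G.IsBas v := by
  have hX : ∀ (n : Fin 3) (i : Fin (dd n)), ∃ A : Module.End F L,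
      (∀ m, n ≠ m → ∀ (a b : Fin (dd m)), a ≠ b → ∀ z ∈ G.W (del m a b), Commute A (LieAlgebra.ad F L z)) ∧
      (∀ x : Ix dd, (x n).val = 0 → ∀ y ∈ G.W (wt x), y ≠ 0 → A y ∈ G.W (wt (Function.update x n i)) ∧ A y ≠ 0) ∧
      (A = 1 ∨ ∃ X, A = LieAlgebra.ad F L X ∧ ∃ j : Fin (dd n), i ≠ j ∧ X ∈ G.W (del n i j)) := by
    intro n i
    by_cases hi : i.val = 0
    · refine ⟨1, fun _ _ _ _ _ _ _ => Commute.one_left _, ?_, Or.inl rfl⟩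
      intro x hx y hy hy0
      have : Function.update x n i = x := by
        rw [Function.update_eq_self_iff]; exact Fin.ext (by omega)
      rw [this]
      exact ⟨hy, hy0⟩
    · obtain ⟨o, ho⟩ : ∃ o : Fin (dd n), o.val = 0 := ⟨0, rfl⟩
      have hio : i ≠ o := by rintro rfl; exact hi ho
      obtain ⟨X, hX, hX0⟩ := G.W_ne (q_del n i o hio)
      refine ⟨LieAlgebra.ad F L X, ?_, ?_, Or.inr ⟨X, rfl, o, hio, hX⟩⟩
      · intro m hm a b hab z hz
        have h0 : ⁅X, z⁆ = 0 := by
          refine G.W_zero_of_q ?_ (G.lie_mem_W hX hz)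
          rw [q_add_bl, q_del n i o hio, q_del m a b hab, bl_del_ne hm]; norm_num
        refine LinearMap.ext fun y => ?_
        show ⁅X, ⁅z, y⁆⁆ = ⁅z, ⁅X, y⁆⁆
        rw [leibniz_lie, h0, zero_lie, zero_add]
      · intro x hx y hy hy0
        have hxo : x n = o := Fin.ext (by omega)
        have hw : wt (Function.update x n i) = del n i o + wt x := by
          rw [wt_update, hxo, add_comm]
        rw [hw]
        refine ⟨G.lie_mem_W hX hy, ?_⟩
        exact G.lie_ne (q_del n i o hio) (q_wt x) (by rw [← hw]; exact q_wt _) hX hX0 hy hy0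
  choose A hA1 hA2 hA3 using hX
  have hcomm : ∀ n m, n ≠ m → ∀ i j, Commute (A n i) (A m j) := by
    intro n m hnm i j
    rcases hA3 m j with h | ⟨X, h, o, ho, hX⟩
    · rw [h]; exact Commute.one_right _
    · rw [h]; exact hA1 n i m hnm _ _ ho X hX
  obtain ⟨x0, hx0⟩ : ∃ x0 : Ix dd, ∀ n, (x0 n).val = 0 := ⟨fun n => 0, fun n => rfl⟩
  have hwt0 : wt x0 = al 3 := by
    rw [wt]
    simp [hx0, DD_zero]
  have he3 : G.e 3 ∈ G.W (wt x0) := hwt0 ▸ G.e_mem 3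
  -- one-step vectors
  let u : ∀ n : Fin 3, Fin (dd n) → L := fun n i => A n i (G.e 3)
  have hu : ∀ n i, u n i ∈ G.W (wt (Function.update x0 n i)) ∧ u n i ≠ 0 := fun n i =>
    hA2 n i x0 (hx0 n) _ he3 (G.e_ne 3)
  have hzu : ∀ n (i j : Fin (dd n)), i ≠ j → ∃ z ∈ G.W (del n i j), z ≠ 0 ∧ ⁅z, u n j⁆ = u n i := by
    intro n i j hij
    obtain ⟨z, hz, hz0⟩ := G.W_ne (q_del n i j hij)
    have hw : wt (Function.update x0 n i) = del n i j + wt (Function.update x0 n j) := by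
      rw [wt_update, wt_update, del, del, del]; abel
    have h1 := G.lie_mem_W hz (hu n j).1
    rw [← hw] at h1
    have h2 := G.lie_ne (q_del n i j hij) (q_wt _) (by rw [← hw]; exact q_wt _) hz hz0 (hu n j).1 (hu n j).2
    obtain ⟨c, hc⟩ := G.W_span (q_wt _) h1 h2 (hu n i).1
    have hc0 : c ≠ 0 := by rintro rfl; rw [zero_smul] at hc; exact (hu n i).2 hc
    exact ⟨c • z, Submodule.smul_mem _ _ hz, smul_ne_zero hc0 hz0, by rw [smul_lie, ← hc]⟩
  obtain ⟨v, hv⟩ : ∃ v : Ix dd → L, ∀ x, v x = A 0 (x 0) (A 1 (x 1) (A 2 (x 2) (G.e 3))) := ⟨_, fun _ => rfl⟩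
  refine ⟨v, ?_, ?_⟩
  · intro x
    have s2 := hA2 2 (x 2) x0 (hx0 2) _ he3 (G.e_ne 3)
    have s1 := hA2 1 (x 1) _ (by rw [Function.update_of_ne (by decide)]; exact hx0 1) _ s2.1 s2.2
    have s0 := hA2 0 (x 0) _ (by rw [Function.update_of_ne (by decide), Function.update_of_ne (by decide)]; exact hx0 0) _ s1.1 s1.2
    have : Function.update (Function.update (Function.update x0 2 (x 2)) 1 (x 1)) 0 (x 0) = x := by
      funext n
      fin_cases n <;> rfl
    rw [this] at s0
    rw [hv]
    exact s0
  have hO : ∀ n, ∃ O : Ix dd → Module.End F L, (∀ x, v x = O x (u n (x n))) ∧ (∀ x i, O (Function.update x n i) = O x) ∧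
      ∀ x (i j : Fin (dd n)), i ≠ j → ∀ z ∈ G.W (del n i j), Commute (O x) (LieAlgebra.ad F L z) := by
    intro n
    have ec : ∀ n m, n ≠ m → ∀ i j y, A n i (A m j y) = A m j (A n i y) := fun n m h i j y =>
      LinearMap.congr_fun (hcomm n m h i j).eq y
    fin_cases n
    · refine ⟨fun x => A 1 (x 1) * A 2 (x 2), ?_, ?_, ?_⟩
      · intro x
        show v x = A 1 (x 1) (A 2 (x 2) (A 0 (x 0) (G.e 3)))
        rw [hv, ec 0 1 (by decide), ec 0 2 (by decide)]
      · intro x i; rfl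
      · intro x i j hij z hz
        exact (hA1 1 _ 0 (by decide) i j hij z hz).mul_left (hA1 2 _ 0 (by decide) i j hij z hz)
    · refine ⟨fun x => A 0 (x 0) * A 2 (x 2), ?_, ?_, ?_⟩
      · intro x
        show v x = A 0 (x 0) (A 2 (x 2) (A 1 (x 1) (G.e 3)))
        rw [hv, ec 1 2 (by decide)]
      · intro x i; rfl
      · intro x i j hij z hz
        exact (hA1 0 _ 1 (by decide) i j hij z hz).mul_left (hA1 2 _ 1 (by decide) i j hij z hz)
    · refine ⟨fun x => A 0 (x 0) * A 1 (x 1), ?_, ?_, ?_⟩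
      · intro x
        show v x = A 0 (x 0) (A 1 (x 1) (A 2 (x 2) (G.e 3)))
        rw [hv]
      · intro x i; rfl
      · intro x i j hij z hz
        exact (hA1 0 _ 2 (by decide) i j hij z hz).mul_left (hA1 1 _ 2 (by decide) i j hij z hz)
  have hvW : ∀ x, v x ∈ G.W (wt x) := by
    intro x
    have s2 := hA2 2 (x 2) x0 (hx0 2) _ he3 (G.e_ne 3)
    have s1 := hA2 1 (x 1) _ (by rw [Function.update_of_ne (by decide)]; exact hx0 1) _ s2.1 s2.2
    have s0 := hA2 0 (x 0) _ (by rw [Function.update_of_ne (by decide), Function.update_of_ne (by decide)]; exact hx0 0) _ s1.1 s1.2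
    have : Function.update (Function.update (Function.update x0 2 (x 2)) 1 (x 1)) 0 (x 0) = x := by
      funext n
      fin_cases n <;> rfl
    rw [this] at s0
    rw [hv]
    exact s0.1
  intro n i j hij
  obtain ⟨z, hz, hz0, hzz⟩ := hzu n i j hij
  refine ⟨z, hz, hz0, fun x => ?_⟩
  split_ifs with hx
  · obtain ⟨O, hO1, hO2, hO3⟩ := hO n
    have e := LinearMap.congr_fun (hO3 x i j hij z hz).eq (u n j)
    rw [hO1 x, hO1 (Function.update x n i), hO2, hx, Function.update_self, ← hzz]
    exact e.symm
  · refine G.W_zero_of_q ?_ (G.lie_mem_W hz (hvW x))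
    rw [q_add_bl, q_del n i j hij, q_wt, bl_comm, bl_wt_del, if_neg hx]
    split_ifs <;> norm_num

end Gen
end
end E8

namespace E8

section
variable {F L : Type} [Field F] [LieRing L] [LieAlgebra F L] [CharZero F] [Nontrivial L]
namespace Gen

theorem std_pow {G : Gen F L} {ζ : F} {θ : lieAut F L} (hθ : G.IsStd ζ θ) (t : ℕ) {l : V} {y : L} (hy : y ∈ G.W l) :
    (θ ^ t).1 y = (ζ ^ l 3) ^ t • y := by
  induction t with
  | zero => simp
  | succ t ih =>
    rw [pow_succ]
    show (θ ^ t).1 (θ.1 y) = _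
    rw [hθ l y hy, map_smul, ih, smul_smul, pow_succ']

theorem zpow_eq_one {ζ : F} (hζ : IsPrimitiveRoot ζ 6) (a : ℤ) : ζ ^ a = 1 ↔ a % 6 = 0 := by
  rw [hζ.zpow_eq_one_iff_dvd]
  exact Int.dvd_iff_emod_eq_zero

theorem geom6 {ζ : F} (hζ : IsPrimitiveRoot ζ 6) (a : ℤ) :
    ∑ t ∈ Finset.range 6, (ζ ^ a) ^ t = if a % 6 = 0 then 6 else 0 := by
  split_ifs with h
  · rw [(zpow_eq_one hζ a).mpr h]; simp
  · have h1 : ζ ^ a ≠ 1 := fun h' => h ((zpow_eq_one hζ a).mp h')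
    have h2 := geom_sum_mul (ζ ^ a) 6
    have h3 : (ζ ^ a) ^ 6 = 1 := by
      rw [← zpow_natCast, ← zpow_mul, mul_comm, zpow_mul]
      simp [hζ.pow_eq_one]
    rw [h3, sub_self] at h2
    exact (mul_eq_zero.mp h2).resolve_right (sub_ne_zero.mpr h1)

theorem W_ind (G : Gen F L) {p : L → Prop} (hW : ∀ l, ∀ y ∈ G.W l, p y) (h0 : p 0) (ha : ∀ x y, p x → p y → p (x + y)) (y : L) : p y := by
  have : y ∈ iSup G.W := by rw [G.W_top]; trivial
  exact Submodule.iSup_induction G.W (motive := p) this hW h0 ha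

theorem deg_mem {G : Gen F L} {ζ : F} (hζ : IsPrimitiveRoot ζ 6) {θ : lieAut F L} (hθ : G.IsStd ζ θ) {y : L} {k : ℤ}
    (hy : θ.1 y = ζ ^ k • y) : y ∈ ⨆ l : {l : V // l 3 % 6 = k % 6}, G.W l := by
  have hζ0 : ζ ≠ 0 := hζ.ne_zero (by norm_num)
  obtain ⟨Pj, hPj⟩ : ∃ Pj : L → L, ∀ y, Pj y = (6 : F)⁻¹ • ∑ t ∈ Finset.range 6, (ζ ^ (-k)) ^ t • (θ ^ t).1 y := ⟨_, fun _ => rfl⟩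
  have h6 : (6 : F) ≠ 0 := by norm_num
  have hadd : ∀ x y, Pj (x + y) = Pj x + Pj y := by
    intro x y
    simp only [hPj, map_add, smul_add, Finset.sum_add_distrib]
  have h1 : ∀ l, ∀ y ∈ G.W l, Pj y = if (l 3 - k) % 6 = 0 then y else 0 := by
    intro l y hy
    have : ∀ t ∈ Finset.range 6, (ζ ^ (-k)) ^ t • (θ ^ t).1 y = (ζ ^ (l 3 - k)) ^ t • y := by
      intro t _
      rw [std_pow hθ t hy, smul_smul, ← mul_pow, ← zpow_add₀ hζ0]
      congr 3; ring
    rw [hPj, Finset.sum_congr rfl this, ← Finset.sum_smul, geom6 hζ]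
    split_ifs
    · rw [smul_smul, inv_mul_cancel₀ h6, one_smul]
    · simp
  have h2 : ∀ y, Pj y ∈ ⨆ l : {l : V // l 3 % 6 = k % 6}, G.W l := by
    refine G.W_ind ?_ ?_ ?_
    · intro l y hy
      rw [h1 l y hy]
      split_ifs with h
      · exact Submodule.mem_iSup_of_mem (⟨l, by omega⟩ : {l : V // l 3 % 6 = k % 6}) hy
      · exact Submodule.zero_mem _
    · have : Pj 0 = 0 := by simp [hPj]
      rw [this]; exact Submodule.zero_mem _
    · intro x y hx hy
      rw [hadd]; exact Submodule.add_mem _ hx hy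
  have h3 : Pj y = y := by
    have hp : ∀ t, (θ ^ t).1 y = (ζ ^ k) ^ t • y := by
      intro t
      induction t with
      | zero => simp
      | succ t ih =>
        rw [pow_succ]
        show (θ ^ t).1 (θ.1 y) = _
        rw [hy, map_smul, ih, smul_smul, pow_succ']
    rw [hPj]
    have : ∀ t ∈ Finset.range 6, (ζ ^ (-k)) ^ t • (θ ^ t).1 y = y := by
      intro t _
      rw [hp, smul_smul, ← mul_pow, ← zpow_add₀ hζ0]; simp
    rw [Finset.sum_congr rfl this, Finset.sum_const, Finset.card_range, ← Nat.cast_smul_eq_nsmul F, smul_smul]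
    norm_num
  rw [← h3]; exact h2 y

theorem W_of_one {G : Gen F L} {v : Ix dd → L} (hv : G.IsBas v) {l : V} (hl : l 3 % 6 = 1) {y : L} (hy : y ∈ G.W l) :
    y ∈ Submodule.span F (Set.range v) := by
  by_cases hq : q l = 2
  · obtain ⟨x, rfl⟩ := root_one hq hl
    obtain ⟨c, rfl⟩ := G.W_span hq (hv.1 x).1 (hv.1 x).2 hy
    exact Submodule.smul_mem _ _ (Submodule.subset_span ⟨x, rfl⟩)
  · rw [G.W_bot (l := l) (by rintro rfl; simp at hl) hq] at hy
    rw [(Submodule.mem_bot F).mp hy]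
    exact Submodule.zero_mem _

theorem span_one {G : Gen F L} {ζ : F} (hζ : IsPrimitiveRoot ζ 6) {θ : lieAut F L} (hθ : G.IsStd ζ θ)
    {v : Ix dd → L} (hv : G.IsBas v) {y : L} (hy : θ.1 y = ζ • y) : y ∈ Submodule.span F (Set.range v) := by
  have := deg_mem hζ hθ (k := 1) (by rw [zpow_one]; exact hy)
  have hle : (⨆ l : {l : V // l 3 % 6 = 1 % 6}, G.W l) ≤ Submodule.span F (Set.range v) :=
    iSup_le fun l y hy => W_of_one hv l.2 hy
  exact hle this

theorem v_deg {G : Gen F L} {ζ : F} (hζ : IsPrimitiveRoot ζ 6) {θ : lieAut F L} (hθ : G.IsStd ζ θ)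
    {v : Ix dd → L} (hv : G.IsBas v) (x : Ix dd) : θ.1 (v x) = ζ • v x := by
  have hζ0 : ζ ≠ 0 := hζ.ne_zero (by norm_num)
  rw [hθ _ _ (hv.1 x).1]
  congr 1
  have : ζ ^ (wt x 3 - 1) = 1 := (zpow_eq_one hζ _).mpr (by have := wt_three x; omega)
  have h2 : wt x 3 = (wt x 3 - 1) + 1 := by ring
  rw [h2, zpow_add₀ hζ0, this, zpow_one, one_mul]

theorem v_li {G : Gen F L} {v : Ix dd → L} (hv : G.IsBas v) : LinearIndependent F v :=
  iSupIndep.linearIndependent (fun x => G.W (wt x)) (G.W_indep.comp wt_inj) (fun x => (hv.1 x).1) (fun x => (hv.1 x).2)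

/-- `φ` acts on the span of `v` by the matrix `T` -/
def Rep (v : Ix dd → L) (φ : L → L) (T : MI F dd) : Prop := ∀ x, φ (v x) = ∑ y, T y x • v y

theorem rep_unique {G : Gen F L} {v : Ix dd → L} (hv : G.IsBas v) {φ : L → L} {T S : MI F dd} (h1 : Rep v φ T) (h2 : Rep v φ S) :
    T = S := by
  ext y x
  have := Fintype.linearIndependent_iff.mp (v_li hv) (fun y => T y x - S y x) (by
    simp only [sub_smul, Finset.sum_sub_distrib]
    rw [← h1 x, ← h2 x, sub_self]) y
  exact sub_eq_zero.mp this

theorem rep_comp {v : Ix dd → L} (φ : L →ₗ[F] L) {ψ : L → L} {T S : MI F dd} (h1 : Rep v φ T) (h2 : Rep v ψ S) :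
    Rep v (fun y => φ (ψ y)) (T * S) := by
  intro x
  show φ (ψ (v x)) = _
  rw [h2 x, map_sum]
  simp only [map_smul, h1 _, Finset.smul_sum, smul_smul, Matrix.mul_apply, Finset.sum_smul]
  rw [Finset.sum_comm]
  refine Finset.sum_congr rfl fun y _ => Finset.sum_congr rfl fun z _ => ?_
  rw [mul_comm]

theorem rep_mul {v : Ix dd → L} {g h : lieAut F L} {T S : MI F dd} (h1 : Rep v g.1 T) (h2 : Rep v h.1 S) :
    Rep v (g * h).1 (T * S) := rep_comp g.1.toLinearMap h1 h2

theorem rep_one (v : Ix dd → L) (F : Type) [Field F] [LieAlgebra F L] : Rep v (fun y => y) (1 : MI F dd) := by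
  intro x
  simp [Matrix.one_apply]

theorem rep_smul_id (v : Ix dd → L) (c : F) : Rep v (fun y => c • y) (c • (1 : MI F dd)) := by
  intro x
  simp [Matrix.one_apply]

theorem rep_sub {v : Ix dd → L} {φ ψ : L → L} {T S : MI F dd} (h1 : Rep v φ T) (h2 : Rep v ψ S) :
    Rep v (fun y => φ y - ψ y) (T - S) := by
  intro x
  show φ (v x) - ψ (v x) = _
  rw [h1 x, h2 x]; simp [sub_smul, Finset.sum_sub_distrib]

theorem rep_add {v : Ix dd → L} {φ ψ : L → L} {T S : MI F dd} (h1 : Rep v φ T) (h2 : Rep v ψ S) :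
    Rep v (fun y => φ y + ψ y) (T + S) := by
  intro x
  show φ (v x) + ψ (v x) = _
  rw [h1 x, h2 x]; simp [add_smul, Finset.sum_add_distrib]

theorem rep_smul {v : Ix dd → L} {φ : L → L} {T : MI F dd} (c : F) (h1 : Rep v φ T) :
    Rep v (fun y => c • φ y) (c • T) := by
  intro x
  show c • φ (v x) = _
  rw [h1 x]; simp [Finset.smul_sum, smul_smul]

theorem rep_exists {v : Ix dd → L} {φ : L → L} (h : ∀ x, φ (v x) ∈ Submodule.span F (Set.range v)) :
    ∃ T : MI F dd, Rep v φ T := by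
  have : ∀ x, ∃ c : Ix dd → F, φ (v x) = ∑ y, c y • v y := by
    intro x
    obtain ⟨c, hc⟩ := (Submodule.mem_span_range_iff_exists_fun F).mp (h x)
    exact ⟨c, hc.symm⟩
  choose c hc using this
  exact ⟨Matrix.of fun y x => c x y, hc⟩

theorem rep_aut {G : Gen F L} {ζ : F} (hζ : IsPrimitiveRoot ζ 6) {θ : lieAut F L} (hθ : G.IsStd ζ θ)
    {v : Ix dd → L} (hv : G.IsBas v) {g : lieAut F L} (hg : g * θ = θ * g) : ∃ T : MI F dd, Rep v g.1 T := by
  apply rep_exists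
  intro x
  apply span_one hζ hθ hv
  show (θ * g).1 (v x) = _
  rw [← hg]
  show g.1 (θ.1 (v x)) = _
  rw [v_deg hζ hθ hv, map_smul]

/-- action of the matrix unit elements -/
theorem rep_unit {v : Ix dd → L} {n : Fin 3} {i j : Fin (dd n)} {z : L}
    (h : ∀ x, ⁅z, v x⁆ = if x n = j then v (Function.update x n i) else 0) :
    Rep v (fun y => ⁅z, y⁆) (iot n (Matrix.single i j (1 : F))) := by
  intro x
  show ⁅z, v x⁆ = _
  rw [h x, Finset.sum_eq_single (Function.update x n i)]
  · rw [iot_apply, if_pos (fun m hm => Function.update_of_ne hm _ _), Function.update_self]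
    by_cases hx : x n = j
    · rw [if_pos hx, hx]; simp
    · rw [if_neg hx, Matrix.single_apply_of_col_ne _ _ (Ne.symm hx)]; simp
  · intro y _ hy
    rw [iot_apply]
    split_ifs with hc
    · have : y n ≠ i := by
        intro hi
        apply hy
        funext m
        by_cases hm : m = n
        · subst hm; rw [Function.update_self, hi]
        · rw [Function.update_of_ne hm, hc m hm]
      rw [Matrix.single_apply_of_row_ne (Ne.symm this)]; simp
    · simp
  · simp

theorem evl_sum (b : Fin 8 → F) (f : Fin 3 → V) : evl b (∑ n, f n) = ∑ n, evl b (f n) := by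
  rw [Fin.sum_univ_three, Fin.sum_univ_three, evl_add, evl_add]

theorem rep_ad {G : Gen F L} {ζ : F} (hζ : IsPrimitiveRoot ζ 6) {θ : lieAut F L} (hθ : G.IsStd ζ θ)
    {v : Ix dd → L} (hv : G.IsBas v) {z : L} (hz : θ.1 z = z) :
    ∃ a : ∀ n, Mt F dd n, Rep v (fun y => ⁅z, y⁆) (∑ n, iot n (a n)) := by
  have h1 := deg_mem hζ hθ (k := 0) (y := z) (by rw [zpow_zero, one_smul]; exact hz)
  refine Submodule.iSup_induction (fun l : {l : V // l 3 % 6 = 0 % 6} => G.W l)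
    (motive := fun z => ∃ a : ∀ n, Mt F dd n, Rep v (fun y => ⁅z, y⁆) (∑ n, iot n (a n))) h1 ?_ ?_ ?_
  · rintro ⟨l, hl⟩ z hz
    dsimp only at hz
    by_cases hl0 : l = 0
    · subst hl0
      obtain ⟨b, hb⟩ := G.H_act hz
      refine ⟨fun n => Matrix.diagonal fun i => evl b (DD n i) + if n = 0 then evl b (al 3) else 0, ?_⟩
      intro x
      show ⁅z, v x⁆ = _
      rw [hb _ _ (hv.1 x).1, Finset.sum_eq_single x]
      · congr 1
        rw [Matrix.sum_apply]
        simp only [iot_apply]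
        simp only [implies_true, if_true, Matrix.diagonal_apply_eq, Finset.sum_add_distrib]
        rw [wt, evl_add, evl_sum, add_comm]
        simp
      · intro y _ hy
        rw [Matrix.sum_apply, Finset.sum_eq_zero, zero_smul]
        intro n _
        rw [iot_apply]
        split_ifs with hc
        · apply Matrix.diagonal_apply_ne
          intro hn
          apply hy
          funext m
          by_cases hm : m = n
          · subst hm; exact hn
          · exact hc m hm
        · rfl
      · simp
    by_cases hq : q l = 2
    · obtain ⟨n, i, j, hij, rfl⟩ := root_zero hq hl
      obtain ⟨e, he, he0, hact⟩ := hv.2 n i j hij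
      obtain ⟨c, rfl⟩ := G.W_span hq he he0 hz
      refine ⟨Function.update (fun n => (0 : Mt F dd n)) n (c • Matrix.single i j 1), ?_⟩
      rw [Finset.sum_eq_single n]
      · rw [Function.update_self, map_smul]
        have := rep_smul c (rep_unit (F := F) hact)
        simpa only [← smul_lie] using this
      · intro m _ hm
        rw [Function.update_of_ne hm, map_zero]
      · simp
    · rw [G.W_bot hl0 hq] at hz
      rw [(Submodule.mem_bot F).mp hz]
      refine ⟨fun n => 0, fun x => ?_⟩
      simp
  · exact ⟨fun n => 0, fun x => by simp⟩
  · rintro z z' ⟨a, ha⟩ ⟨b, hb⟩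
    refine ⟨fun n => a n + b n, ?_⟩
    have := rep_add ha hb
    simp only [map_add, Finset.sum_add_distrib, add_lie]
    exact this

theorem del_fix {G : Gen F L} {ζ : F} (hζ : IsPrimitiveRoot ζ 6) {θ : lieAut F L} (hθ : G.IsStd ζ θ)
    {n : Fin 3} {i j : Fin (dd n)} {z : L} (hz : z ∈ G.W (del n i j)) : θ.1 z = z := by
  rw [hθ _ _ hz, (zpow_eq_one hζ _).mpr (del_three n i j), one_smul]

theorem rep_tens {G : Gen F L} {ζ : F} (hζ : IsPrimitiveRoot ζ 6) {θ : lieAut F L} (hθ : G.IsStd ζ θ)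
    {v : Ix dd → L} (hv : G.IsBas v) {g : lieAut F L} (hg : g * θ = θ * g) :
    ∃ A : ∀ n, Mt F dd n, (∀ n, (A n).det ≠ 0) ∧ Rep v g.1 (tens A) := by
  obtain ⟨T, hT⟩ := rep_aut hζ hθ hv hg
  have hg' : g⁻¹ * θ = θ * g⁻¹ := by
    have : Commute g θ := hg
    exact this.inv_left.eq
  obtain ⟨T', hT'⟩ := rep_aut hζ hθ hv hg'
  have hid : Rep v (1 : lieAut F L).1 (1 : MI F dd) := rep_one v F
  have h1 : T * T' = 1 := rep_unique hv (by have := rep_mul hT hT'; rwa [mul_inv_cancel] at this) hid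
  have h2 : T' * T = 1 := rep_unique hv (by have := rep_mul hT' hT; rwa [inv_mul_cancel] at this) hid
  obtain ⟨A, c, hA, hc⟩ := tens_of_sum h1 h2 (by
    intro n i j hij
    obtain ⟨z, hz, hz0, hact⟩ := hv.2 n i j hij
    have hfix : θ.1 (g.1 z) = g.1 z := by
      show (θ * g).1 z = _
      rw [← hg]
      show g.1 (θ.1 z) = _
      rw [del_fix hζ hθ hz]
    obtain ⟨a, ha⟩ := rep_ad hζ hθ hv hfix
    refine ⟨a, rep_unique hv ?_ ha⟩
    have r1 := rep_comp (LieAlgebra.ad F L z) (rep_unit (F := F) hact) hT'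
    have r2 := rep_comp g.1.toLinearMap hT r1
    rw [← mul_assoc] at r2
    convert r2 using 1
    funext y
    show ⁅g.1 z, y⁆ = g.1 ⁅z, (g⁻¹).1 y⁆
    rw [g.2, Gen.aut_inv_apply])
  have hc0 : c ≠ 0 := by
    rintro rfl
    rw [hc, zero_smul, zero_mul] at h1
    exact zero_ne_one h1
  refine ⟨fun n => (Function.update (fun _ => (1 : F)) 0 c : Fin 3 → F) n • A n, ?_, ?_⟩
  · intro n
    rw [Matrix.det_smul]
    refine mul_ne_zero (pow_ne_zero _ ?_) (hA n)
    by_cases hn : n = 0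
    · subst hn; simpa using hc0
    · simp [Function.update_of_ne hn]
  · rw [tens_smul]
    have : ∏ n, (Function.update (fun _ => (1 : F)) 0 c : Fin 3 → F) n = c := by
      simp [Fin.prod_univ_three]
    rw [this, ← hc]; exact hT

end Gen
end
end E8

namespace E8

theorem al_split : ∀ i : Fin 8, i ≠ 3 → ∃ l ∈ rootL, l 3 = 1 ∧ q (al i - l) = 2 := by decide +kernel

section
variable {F L : Type} [Field F] [LieRing L] [LieAlgebra F L] [CharZero F] [Nontrivial L]
namespace Gen

theorem gen_one (G : Gen F L) (K : LieSubalgebra F L) (h : ∀ l : V, l 3 = 1 ∨ l 3 = -1 → ∀ y ∈ G.W l, y ∈ K) : K = ⊤ := by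
  have key : ∀ l m : V, q l = 2 → q m = 2 → q (l + m) = 2 → (l 3 = 1 ∨ l 3 = -1) → (m 3 = 1 ∨ m 3 = -1) →
      ∀ y ∈ G.W (l + m), y ∈ K := by
    intro l m hl hm hlm h1 h2 y hy
    obtain ⟨u, hu, hu0⟩ := G.W_ne hl
    obtain ⟨w, hw, hw0⟩ := G.W_ne hm
    obtain ⟨c, rfl⟩ := G.W_span hlm (G.lie_mem_W hu hw) (G.lie_ne hl hm hlm hu hu0 hw hw0) hy
    exact K.smul_mem _ (K.lie_mem (h l h1 u hu) (h m h2 w hw))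
  have hs : ∀ l : V, l 3 = 1 → q l = 2 → ∀ i : Fin 8, i ≠ 3 → (al i - l) 3 = -1 := by
    intro l h3 _ i hi
    simp [h3, Ne.symm hi]
  rw [eq_top_iff, ← G.gen, LieSubalgebra.lieSpan_le]
  rintro _ (⟨i, rfl⟩ | ⟨i, rfl⟩)
  · by_cases hi : i = 3
    · subst hi
      exact h (al 3) (Or.inl (by simp)) _ (G.e_mem 3)
    · obtain ⟨l, hl, h3, hq⟩ := al_split i hi
      rw [mem_rootL] at hl
      refine key l (al i - l) hl hq ?_ (Or.inl h3) (Or.inr (hs l h3 hl i hi)) _ ?_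
      · rw [add_sub_cancel]; exact q_al i
      · rw [add_sub_cancel]; exact G.e_mem i
  · by_cases hi : i = 3
    · subst hi
      exact h (-al 3) (Or.inr (by simp)) _ (G.f_mem 3)
    · obtain ⟨l, hl, h3, hq⟩ := al_split i hi
      rw [mem_rootL] at hl
      have e : -l + -(al i - l) = -al i := by abel
      refine key (-l) (-(al i - l)) (by rw [q_neg]; exact hl) (by rw [q_neg]; exact hq) ?_ (Or.inr (by simp [h3])) (Or.inl (by rw [Pi.neg_apply, hs l h3 hl i hi]; norm_num)) _ ?_
      · rw [e, q_neg]; exact q_al i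
      · rw [e]; exact G.f_mem i

theorem dual_zero [IsAlgClosed F] {G : Gen F L} {ζ : F} (hζ : IsPrimitiveRoot ζ 6) {θ : lieAut F L} (hθ : G.IsStd ζ θ)
    {v : Ix dd → L} (hv : G.IsBas v) {y : L} (hy : θ.1 y = ζ⁻¹ • y) (h : ∀ x, killingForm F L y (v x) = 0) : y = 0 := by
  have := G.finDim
  have := G.killing
  have hζ0 : ζ ≠ 0 := hζ.ne_zero (by norm_num)
  apply killing_nd (F := F)
  refine G.W_ind ?_ ?_ ?_
  · intro m w hw
    by_cases hm : m 3 % 6 = 1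
    · have := W_of_one hv hm hw
      clear hw
      induction this using Submodule.span_induction with
      | mem w hw => obtain ⟨x, rfl⟩ := hw; exact h x
      | zero => simp
      | add a b _ _ ha hb => rw [map_add, ha, hb, add_zero]
      | smul c a _ ha => rw [map_smul, ha, smul_zero]
    · have h1 := aut_killing (F := F) θ y w
      rw [hy, hθ m w hw, map_smul, map_smul, LinearMap.smul_apply, smul_eq_mul, smul_eq_mul, ← mul_assoc] at h1
      by_contra hne
      have h2 : ζ ^ m 3 * ζ⁻¹ = 1 := by
        apply mul_right_cancel₀ hne
        rw [h1, one_mul]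
      rw [← zpow_sub_one₀ hζ0, zpow_eq_one hζ] at h2
      omega
  · simp
  · intro a b ha hb; rw [map_add, ha, hb, add_zero]

theorem inv_deg {G : Gen F L} {ζ : F} {θ : lieAut F L} (hθ : G.IsStd ζ θ) {l : V} (hl : l 3 = -1) {y : L} (hy : y ∈ G.W l) :
    θ.1 y = ζ⁻¹ • y := by rw [hθ l y hy, hl, zpow_neg_one]

theorem faithful [IsAlgClosed F] {G : Gen F L} {ζ : F} (hζ : IsPrimitiveRoot ζ 6) {θ : lieAut F L} (hθ : G.IsStd ζ θ)
    {v : Ix dd → L} (hv : G.IsBas v) {z : L} (hz : θ.1 z = z) (h : ∀ x, ⁅z, v x⁆ = 0) : z = 0 := by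
  have := G.finDim
  have := G.killing
  obtain ⟨K, hK⟩ : ∃ K : LieSubalgebra F L, ∀ y, y ∈ K ↔ ⁅z, y⁆ = 0 :=
    ⟨{ carrier := {y | ⁅z, y⁆ = 0}
       add_mem' := by intro a b ha hb; simp only [Set.mem_setOf_eq] at *; rw [lie_add, ha, hb, add_zero]
       zero_mem' := by simp
       smul_mem' := by intro c a ha; simp only [Set.mem_setOf_eq] at *; rw [lie_smul, ha, smul_zero]
       lie_mem' := by intro a b ha hb; simp only [Set.mem_setOf_eq] at *; rw [leibniz_lie, ha, hb]; simp }, fun y => Iff.rfl⟩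
  have ht := G.gen_one K (by
    rintro l (hl | hl) y hy
    · have := W_of_one hv (by omega) hy
      rw [hK]
      clear hy
      induction this using Submodule.span_induction with
      | mem w hw => obtain ⟨x, rfl⟩ := hw; exact h x
      | zero => simp
      | add a b _ _ ha hb => rw [lie_add, ha, hb, add_zero]
      | smul c a _ ha => rw [lie_smul, ha, smul_zero]
    · rw [hK]
      apply dual_zero hζ hθ hv
      · rw [θ.2, hz, inv_deg hθ hl hy, lie_smul]
      · intro x
        rw [← lie_skew, map_neg, LinearMap.neg_apply, LieModule.traceForm_apply_lie_apply, h x]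
        simp)
  apply ad_inj (F := F)
  ext y
  exact (hK y).mp (by rw [ht]; trivial)

theorem scalar_mem [IsAlgClosed F] {G : Gen F L} {ζ : F} (hζ : IsPrimitiveRoot ζ 6) {θ : lieAut F L} (hθ : G.IsStd ζ θ)
    {v : Ix dd → L} (hv : G.IsBas v) {h : lieAut F L} (hc : h * θ = θ * h) {s : F} (hs : ∀ x, h.1 (v x) = s • v x) :
    ∃ j : ℕ, h = θ ^ j := by
  have := G.finDim
  have := G.killing
  obtain ⟨x5, hx5⟩ : ∃ x : Ix dd, wt x 3 = -5 := ⟨fun n => if h : n = 0 then ⟨5, by subst h; decide⟩ else 0, by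
    rw [wt_eq]; decide +kernel⟩
  have hs0 : s ≠ 0 := by
    rintro rfl
    have h1 := hs x5
    rw [zero_smul] at h1
    exact (hv.1 x5).2 (h.1.injective (h1.trans (map_zero _).symm))
  obtain ⟨t, ht⟩ := G.exists_torus (fun i => if i = 3 then s else 1) (fun i => by split_ifs; exact hs0; exact one_ne_zero)
  have ht' : ∀ l : V, ∀ y ∈ G.W l, t.1 y = s ^ l 3 • y := by
    intro l y hy
    rw [ht l y hy]
    congr 1
    rw [chr, Finset.prod_eq_single 3]
    · simp
    · intro i _ hi; simp [hi]
    · simp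
  obtain ⟨K, hK⟩ : ∃ K : LieSubalgebra F L, ∀ y, y ∈ K ↔ h.1 y = t.1 y :=
    ⟨{ carrier := {y | h.1 y = t.1 y}
       add_mem' := by intro a b ha hb; simp only [Set.mem_setOf_eq] at *; rw [map_add, ha, hb, map_add]
       zero_mem' := by simp
       smul_mem' := by intro c a ha; simp only [Set.mem_setOf_eq] at *; rw [map_smul, ha, map_smul]
       lie_mem' := by intro a b ha hb; simp only [Set.mem_setOf_eq] at *; rw [h.2, ha, hb, t.2] }, fun y => Iff.rfl⟩
  have hK1 := G.gen_one K (by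
    rintro l (hl | hl) y hy
    · have := W_of_one hv (l := l) (by omega) hy
      rw [hK, ht' l y hy, hl, zpow_one]
      clear hy
      induction this using Submodule.span_induction with
      | mem w hw => obtain ⟨x, rfl⟩ := hw; exact hs x
      | zero => simp
      | add a b _ _ ha hb => rw [map_add, ha, hb, smul_add]
      | smul c a _ ha => rw [map_smul, ha, smul_comm]
    · rw [hK, ht' l y hy, hl, zpow_neg_one]
      have hd := inv_deg hθ hl hy
      rw [← sub_eq_zero]
      apply dual_zero hζ hθ hv
      · rw [map_sub, map_smul, hd]
        show (θ * h).1 y - _ = _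
        rw [← hc]
        show h.1 (θ.1 y) - _ = _
        rw [hd, map_smul, smul_sub, smul_comm s⁻¹]
      · intro x
        have h1 : v x = s⁻¹ • h.1 (v x) := by rw [hs, smul_smul, inv_mul_cancel₀ hs0, one_smul]
        rw [map_sub, LinearMap.sub_apply, map_smul, LinearMap.smul_apply]
        nth_rewrite 1 [h1]
        rw [map_smul, aut_killing, sub_self])
  have hht : ∀ y, h.1 y = t.1 y := fun y => (hK y).mp (by rw [hK1]; trivial)
  have h6 : s ^ 6 = 1 := by
    have h1 := hs x5
    rw [hht, ht' _ _ (hv.1 x5).1, hx5] at h1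
    have h2 := smul_left_injective F (hv.1 x5).2 h1
    have h3 : s ^ (-5 : ℤ) * s ^ (5 : ℤ) = s * s ^ (5 : ℤ) := by rw [h2]
    rw [← zpow_add₀ hs0, ← zpow_one_add₀ hs0] at h3
    norm_num at h3
    exact_mod_cast h3.symm
  obtain ⟨j, _, hj⟩ := hζ.eq_pow_of_pow_eq_one h6
  refine ⟨j, aut_ext fun y => ?_⟩
  refine G.W_ind (p := fun y => h.1 y = (θ ^ j).1 y) ?_ ?_ ?_ y
  · intro l y hy
    rw [hht, ht' l y hy, std_pow hθ j hy, ← hj, ← zpow_natCast, ← zpow_mul, ← zpow_natCast, ← zpow_mul, mul_comm]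
  · simp
  · intro a b ha hb; rw [map_add, ha, hb, map_add]

theorem rep_lie {v : Ix dd → L} {z w : L} {T S : MI F dd} (h1 : Rep v (fun y => ⁅z, y⁆) T) (h2 : Rep v (fun y => ⁅w, y⁆) S) :
    Rep v (fun y => ⁅⁅z, w⁆, y⁆) (T * S - S * T) := by
  have := rep_sub (rep_comp (LieAlgebra.ad F L z) h1 h2) (rep_comp (LieAlgebra.ad F L w) h2 h1)
  convert this using 1
  funext y
  exact lie_lie z w y

theorem sl_mem {G : Gen F L} {ζ : F} (hζ : IsPrimitiveRoot ζ 6) {θ : lieAut F L} (hθ : G.IsStd ζ θ)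
    {v : Ix dd → L} (hv : G.IsBas v) {n : Fin 3} {M : Mt F dd n} (hM : M.trace = 0) :
    ∃ z, θ.1 z = z ∧ Rep v (fun y => ⁅z, y⁆) (iot n M) := by
  obtain ⟨S, hS⟩ : ∃ S : Submodule F (Mt F dd n), ∀ M, M ∈ S ↔ ∃ z, θ.1 z = z ∧ Rep v (fun y => ⁅z, y⁆) (iot n M) :=
    ⟨{ carrier := {M | ∃ z, θ.1 z = z ∧ Rep v (fun y => ⁅z, y⁆) (iot n M)}
       add_mem' := by
        rintro a b ⟨z, hz, h1⟩ ⟨w, hw, h2⟩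
        refine ⟨z + w, by rw [map_add, hz, hw], ?_⟩
        have := rep_add h1 h2
        simp only [map_add, add_lie]
        exact this
       zero_mem' := ⟨0, by simp, fun x => by simp⟩
       smul_mem' := by
        rintro c a ⟨z, hz, h1⟩
        refine ⟨c • z, by rw [map_smul, hz], ?_⟩
        have := rep_smul c h1
        simp only [map_smul, smul_lie]
        exact this }, fun M => Iff.rfl⟩
  have h1 : ∀ i j, i ≠ j → Matrix.single i j (1 : F) ∈ S := by
    intro i j hij
    obtain ⟨z, hz, hz0, hact⟩ := hv.2 n i j hij
    exact (hS _).mpr ⟨z, del_fix hζ hθ hz, rep_unit hact⟩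
  have h2 : ∀ a b, a ∈ S → b ∈ S → a * b - b * a ∈ S := by
    intro a b ha hb
    obtain ⟨z, hz, r1⟩ := (hS _).mp ha
    obtain ⟨w, hw, r2⟩ := (hS _).mp hb
    refine (hS _).mpr ⟨⁅z, w⁆, by rw [θ.2, hz, hw], ?_⟩
    rw [map_sub, map_mul, map_mul]
    exact rep_lie r1 r2
  have h3 : ∀ i j : Fin (dd n), Matrix.single i i (1 : F) - Matrix.single j j 1 ∈ S := by
    intro i j
    by_cases hij : i = j
    · subst hij; rw [sub_self]; exact S.zero_mem
    · have := h2 _ _ (h1 i j hij) (h1 j i (Ne.symm hij))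
      simpa using this
  rw [← hS]
  have e : M = ∑ i, ∑ j, M i j • (Matrix.single i j (1 : F) - if i = j then Matrix.single 0 0 1 else 0) := by
    have : ∑ i, ∑ j, M i j • (if i = j then Matrix.single (0 : Fin (dd n)) (0 : Fin (dd n)) (1 : F) else 0) = 0 := by
      simp only [smul_ite, smul_zero, Finset.sum_ite_eq, Finset.mem_univ, if_true, ← Finset.sum_smul]
      have : ∑ i, M i i = 0 := hM
      rw [this, zero_smul]
    simp only [smul_sub, Finset.sum_sub_distrib]
    rw [this, sub_zero]
    simp only [Matrix.smul_single, smul_eq_mul, mul_one]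
    exact Matrix.matrix_eq_sum_single M
  rw [e]
  refine S.sum_mem fun i _ => S.sum_mem fun j _ => S.smul_mem _ ?_
  split_ifs with hij
  · subst hij; exact h3 i 0
  · rw [sub_zero]; exact h1 i j hij

end Gen
end
end E8

namespace E8

section
variable {F L : Type} [Field F] [LieRing L] [LieAlgebra F L] [CharZero F] [Nontrivial L]
namespace Gen

theorem exists_chr [IsAlgClosed F] (r : Fin 3 → ℕ → F) (hr : ∀ n i, r n i ≠ 0) (h0 : ∀ n, r n 0 = 1) :
    ∃ c : Fin 8 → F, (∀ i, c i ≠ 0) ∧ ∀ (n : Fin 3) (i : Fin (dd n)), chr c (DD n i) = r n i := by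
  obtain ⟨A, hA⟩ : ∃ A : F, A = (r 1 2 / r 1 1) ^ 2 * (r 2 1) ^ 3 * (r 1 1) ^ 4 * (r 0 1) ^ 4 * (r 0 2 / r 0 1) ^ 3 *
    (r 0 3 / r 0 2) ^ 2 * (r 0 4 / r 0 3) := ⟨_, rfl⟩
  have hA0 : A ≠ 0 := by
    rw [hA]
    have h1 := hr 1 2; have h2 := hr 1 1; have h3 := hr 2 1; have h4 := hr 0 1; have h5 := hr 0 2
    have h6 := hr 0 3; have h7 := hr 0 4
    positivity
  obtain ⟨c3, hc3⟩ := IsAlgClosed.exists_pow_nat_eq (A * r 0 5)⁻¹ (n := 6) (by norm_num)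
  have hc30 : c3 ≠ 0 := by
    rintro rfl
    rw [zero_pow (by norm_num)] at hc3
    exact inv_ne_zero (mul_ne_zero hA0 (hr 0 5)) hc3.symm
  refine ⟨![r 1 2 / r 1 1, r 2 1, r 1 1, c3, r 0 1, r 0 2 / r 0 1, r 0 3 / r 0 2, r 0 4 / r 0 3], ?_, ?_⟩
  · intro i
    fin_cases i
    all_goals first | exact hc30 | exact div_ne_zero (hr _ _) (hr _ _) | exact hr _ _
  · have e05 : (A * c3 ^ 6)⁻¹ = r 0 5 := by
      rw [hc3, mul_inv, inv_inv, inv_mul_cancel_left₀ hA0]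
    intro n i
    have h1 := hr 1 2; have h2 := hr 1 1; have h3 := hr 2 1; have h4 := hr 0 1; have h5 := hr 0 2
    have h6 := hr 0 3; have h7 := hr 0 4
    fin_cases n
    · change Fin 6 at i
      fin_cases i
      · simp [DD, chr, h0]
      · simp [DD, chr, Fin.prod_univ_eight]
      · simp [DD, chr, Fin.prod_univ_eight]; field_simp
      · simp [DD, chr, Fin.prod_univ_eight]; field_simp
      · simp [DD, chr, Fin.prod_univ_eight]; field_simp
      · rw [hA] at e05
        refine Eq.trans ?_ e05
        simp [DD, chr, Fin.prod_univ_eight, zpow_neg]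
        norm_cast
        field_simp
    · change Fin 3 at i
      fin_cases i
      · simp [DD, chr, h0]
      · simp [DD, chr, Fin.prod_univ_eight]
      · simp [DD, chr, Fin.prod_univ_eight]; field_simp
    · change Fin 2 at i
      fin_cases i
      · simp [DD, chr, h0]
      · simp [DD, chr, Fin.prod_univ_eight]

theorem chr_zero (c : Fin 8 → F) : chr c 0 = 1 := by simp [chr]

theorem chr_wt {c : Fin 8 → F} (hc : ∀ i, c i ≠ 0) (x : Ix dd) : chr c (wt x) = c 3 * ∏ n, chr c (DD n (x n)) := by
  rw [wt_eq, chr_add hc, chr_add hc, chr_add hc, chr_al, Fin.prod_univ_three]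

/-- realizable matrices -/
def Re (θ : lieAut F L) (v : Ix dd → L) (T : MI F dd) : Prop :=
  ∃ h : lieAut F L, h * θ = θ * h ∧ ∃ s : F, s ≠ 0 ∧ Rep v h.1 (s • T)

theorem re_mul {θ : lieAut F L} {v : Ix dd → L} {T S : MI F dd} (h1 : Re θ v T) (h2 : Re θ v S) : Re θ v (T * S) := by
  obtain ⟨h, hc, s, hs, hr⟩ := h1
  obtain ⟨h', hc', s', hs', hr'⟩ := h2
  refine ⟨h * h', ?_, s * s', mul_ne_zero hs hs', ?_⟩
  · exact (show Commute (h * h') θ from Commute.mul_left hc hc').eq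
  · have := rep_mul hr hr'
    rwa [smul_mul_smul_comm] at this

theorem re_diag [IsAlgClosed F] {G : Gen F L} {ζ : F} {θ : lieAut F L} (hθ : G.IsStd ζ θ)
    {v : Ix dd → L} (hv : G.IsBas v) {n : Fin 3} (D : Fin (dd n) → F) (hD : ∀ i, D i ≠ 0) :
    Re θ v (iot n (Matrix.diagonal D)) := by
  obtain ⟨c, hc, hc'⟩ := exists_chr (fun m i => if m = n then (if h : i < dd n then D ⟨i, h⟩ / D 0 else 1) else 1)
    (by
      intro m i
      split_ifs
      · exact div_ne_zero (hD _) (hD _)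
      · exact one_ne_zero
      · exact one_ne_zero)
    (by
      intro m
      split_ifs with h1 h2
      · exact div_self (hD 0)
      · rfl
      · rfl)
  obtain ⟨t, ht⟩ := G.exists_torus c hc
  refine ⟨t, ?_, c 3 / D 0, div_ne_zero (hc 3) (hD 0), ?_⟩
  · apply aut_ext
    refine G.W_ind ?_ ?_ ?_
    · intro l y hy
      show t.1 (θ.1 y) = θ.1 (t.1 y)
      rw [hθ l y hy, ht l y hy, map_smul, map_smul, hθ l y hy, ht l y hy, smul_comm]
    · simp
    · intro a b ha hb; rw [map_add, map_add, ha, hb]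
  · intro x
    rw [ht _ _ (hv.1 x).1, Finset.sum_eq_single x]
    · congr 1
      rw [chr_wt hc, Matrix.smul_apply, iot_apply, if_pos (fun _ _ => rfl), Matrix.diagonal_apply_eq, Finset.prod_eq_single n]
      · rw [hc' n, if_pos rfl, dif_pos (x n).2, smul_eq_mul]
        field_simp
      · intro m _ hm
        rw [hc' m, if_neg hm]
      · simp
    · intro y _ hy
      rw [Matrix.smul_apply, iot_apply]
      split_ifs with h
      · rw [Matrix.diagonal_apply_ne, smul_zero, zero_smul]
        intro hn
        apply hy
        funext m
        by_cases hm : m = n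
        · subst hm; exact hn
        · exact h m hm
      · rw [smul_zero, zero_smul]
    · simp

theorem re_trans {G : Gen F L} {ζ : F} (hζ : IsPrimitiveRoot ζ 6) {θ : lieAut F L} (hθ : G.IsStd ζ θ)
    {v : Ix dd → L} (hv : G.IsBas v) {n : Fin 3} {i j : Fin (dd n)} (hij : i ≠ j) (c : F) :
    Re θ v (iot n (Matrix.transvection i j c)) := by
  obtain ⟨z, hz, hz0, hact⟩ := hv.2 n i j hij
  have hl : del n i j ≠ 0 := by
    intro h
    have := q_del n i j hij
    rw [h, q_zero] at this
    norm_num at this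
  have hnil := G.ad_nilp hl (Submodule.smul_mem _ c hz)
  have hzz : ∀ x, ⁅c • z, ⁅c • z, v x⁆⁆ = 0 := by
    intro x
    rw [smul_lie, smul_lie, lie_smul, hact x]
    split_ifs with h
    · rw [hact, Function.update_self, if_neg hij]; simp
    · simp
  refine ⟨expA (c • z) hnil, ?_, 1, one_ne_zero, ?_⟩
  · rw [conj_expA]
    congr 1
    apply expA_congr
    rw [map_smul, del_fix hζ hθ hz]
  · have := rep_add (rep_one v F) (rep_smul c (rep_unit (F := F) hact))
    intro x
    rw [expA_two _ _ _ (hzz x), smul_lie]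
    rw [one_smul, Matrix.transvection, map_add, map_one]
    have e : Matrix.single i j c = c • Matrix.single i j (1 : F) := by simp [Matrix.smul_single]
    rw [e, map_smul]
    exact this x

theorem re_fac [IsAlgClosed F] {G : Gen F L} {ζ : F} (hζ : IsPrimitiveRoot ζ 6) {θ : lieAut F L} (hθ : G.IsStd ζ θ)
    {v : Ix dd → L} (hv : G.IsBas v) {n : Fin 3} (P : Mt F dd n) (hP : P.det ≠ 0) : Re θ v (iot n P) := by
  refine Matrix.diagonal_transvection_induction_of_det_ne_zero (fun P => Re θ v (iot n P)) P hP ?_ ?_ ?_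
  · intro D hD
    apply re_diag hθ hv
    intro i hi
    apply hD
    rw [Matrix.det_diagonal]
    exact Finset.prod_eq_zero (Finset.mem_univ i) hi
  · intro t
    exact re_trans hζ hθ hv t.hij t.c
  · intro A B _ _ hA hB
    rw [map_mul]
    exact re_mul hA hB

theorem re_tens [IsAlgClosed F] {G : Gen F L} {ζ : F} (hζ : IsPrimitiveRoot ζ 6) {θ : lieAut F L} (hθ : G.IsStd ζ θ)
    {v : Ix dd → L} (hv : G.IsBas v) (P : ∀ n, Mt F dd n) (hP : ∀ n, (P n).det ≠ 0) : Re θ v (tens P) := by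
  have e : tens P = iot 0 (P 0) * iot 1 (P 1) * iot 2 (P 2) := by
    rw [iot_def, iot_def, iot_def, tens_mul, tens_mul]
    congr 1
    funext n
    fin_cases n
    · simp
    · simp
    · simp
  rw [e]
  exact re_mul (re_mul (re_fac hζ hθ hv _ (hP 0)) (re_fac hζ hθ hv _ (hP 1))) (re_fac hζ hθ hv _ (hP 2))

end Gen
end
end E8

namespace E8

section
variable {F L : Type} [Field F] [LieRing L] [LieAlgebra F L] [CharZero F] [Nontrivial L]

theorem exists_ne_of_det {k : ℕ} [NeZero k] {A : Matrix (Fin k) (Fin k) F} (h : A.det ≠ 0) : ∃ i j, A i j ≠ 0 := by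
  by_contra hc
  push Not at hc
  have : A = 0 := by ext i j; exact hc i j
  rw [this, Matrix.det_zero] at h
  exact h rfl

theorem smul_cancel {k : ℕ} [NeZero k] {A : Matrix (Fin k) (Fin k) F} (h : A.det ≠ 0) {c d : F} (hc : c • A = d • A) : c = d := by
  obtain ⟨i, j, hij⟩ := exists_ne_of_det h
  have := congrFun (congrFun hc i) j
  simp only [Matrix.smul_apply, smul_eq_mul] at this
  exact mul_right_cancel₀ hij this

namespace Gen

theorem scal_conj [IsAlgClosed F] {G : Gen F L} {ζ : F} (hζ : IsPrimitiveRoot ζ 6) {θ : lieAut F L} (hθ : G.IsStd ζ θ)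
    {v : Ix dd → L} (hv : G.IsBas v) {a b : lieAut F L} (ha : a * θ = θ * a) (hb : b * θ = θ * b) {T : MI F dd} {c : F}
    (h1 : Rep v a.1 T) (h2 : Rep v b.1 (c • T)) : ∃ j : ℕ, b = a * θ ^ j := by
  have hu : Commute (a⁻¹ * b) θ := Commute.mul_left (Commute.inv_left ha) hb
  obtain ⟨j, hj⟩ := scalar_mem hζ hθ hv (h := a⁻¹ * b) hu.eq (s := c) (by
    intro x
    show (a⁻¹).1 (b.1 (v x)) = _
    have e : b.1 (v x) = a.1 (c • v x) := by
      rw [h2 x, map_smul, h1 x]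
      simp [Finset.smul_sum, smul_smul]
    rw [e, aut_inv_apply'])
  exact ⟨j, by rw [← hj, mul_inv_cancel_left]⟩

theorem rep_scalar_one [IsAlgClosed F] {G : Gen F L} {ζ : F} (hζ : IsPrimitiveRoot ζ 6) {θ : lieAut F L} (hθ : G.IsStd ζ θ)
    {v : Ix dd → L} (hv : G.IsBas v) {b : lieAut F L} (hb : b * θ = θ * b) {A : ∀ n, Mt F dd n}
    (hr : Rep v b.1 (tens A)) (h : ∀ n, ∃ c : F, A n = c • 1) : ∃ j : ℕ, b = θ ^ j := by
  choose c hc using h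
  have e : tens A = (∏ n, c n) • (1 : MI F dd) := by
    rw [← tens_one, ← tens_smul]
    congr 1
    funext n
    exact hc n
  rw [e] at hr
  obtain ⟨j, hj⟩ := scal_conj hζ hθ hv (a := 1) (by simp) hb (T := 1) (rep_one v F) hr
  exact ⟨j, by rw [hj, one_mul]⟩

theorem noncomm [IsAlgClosed F] {G : Gen F L} {ζ : F} (hζ : IsPrimitiveRoot ζ 6) {θ : lieAut F L} (hθ : G.IsStd ζ θ)
    {v : Ix dd → L} (hv : G.IsBas v) {Q : Subgroup (lieAut F L)} (hQ : IsMaximalFiniteAbelian Q) (hθQ : θ ∈ Q)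
    {A : lieAut F L → ∀ n, Mt F dd n} (hA : ∀ g ∈ Q, Rep v g.1 (tens (A g))) (n : Fin 3) :
    ∃ x ∈ Q, ∃ y ∈ Q, A x n * A y n ≠ A y n * A x n := by
  have := G.finDim
  have := G.killing
  by_contra hcon
  push Not at hcon
  obtain ⟨M, hM0, hMt, hMc⟩ : ∃ M : Mt F dd n, M ≠ 0 ∧ M.trace = 0 ∧ ∀ g ∈ Q, M * A g n = A g n * M := by
    by_cases hs : ∃ g ∈ Q, ∀ c : F, A g n ≠ c • 1
    · obtain ⟨g, hg, hgs⟩ := hs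
      have hd : ((dd n : ℕ) : F) ≠ 0 := Nat.cast_ne_zero.mpr (NeZero.ne _)
      refine ⟨A g n - ((A g n).trace / (dd n : ℕ)) • 1, sub_ne_zero.mpr (hgs _), ?_, ?_⟩
      · rw [Matrix.trace_sub, Matrix.trace_smul, Matrix.trace_one, Fintype.card_fin, smul_eq_mul, div_mul_cancel₀ _ hd, sub_self]
      · intro h hh
        rw [sub_mul, mul_sub, hcon g hg h hh, smul_mul_assoc, mul_smul_comm, one_mul, mul_one]
    · push Not at hs
      have h01 : (⟨0, by have := dd_ge n; omega⟩ : Fin (dd n)) ≠ ⟨1, by have := dd_ge n; omega⟩ := by simp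
      refine ⟨Matrix.single ⟨0, by have := dd_ge n; omega⟩ ⟨1, by have := dd_ge n; omega⟩ 1, ?_, ?_, ?_⟩
      · intro h
        have := congrFun (congrFun h ⟨0, by have := dd_ge n; omega⟩) ⟨1, by have := dd_ge n; omega⟩
        simp at this
      · exact Matrix.trace_single_eq_of_ne _ _ _ h01
      · intro g hg
        obtain ⟨c, hc⟩ := hs g hg
        rw [hc, smul_mul_assoc, mul_smul_comm, one_mul, mul_one]
  obtain ⟨z, hz, hr⟩ := sl_mem hζ hθ hv hMt
  have hfix : ∀ g ∈ Q, g.1 z = z := by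
    intro g hg
    have e1 : (g⁻¹).1 z - z = 0 := by
      apply faithful hζ hθ hv
      · rw [map_sub, hz]
        congr 1
        show (θ * g⁻¹).1 z = _
        rw [hQ.2.1 θ g⁻¹ hθQ (Q.inv_mem hg)]
        show (g⁻¹).1 (θ.1 z) = _
        rw [hz]
      · intro x
        have e2 : ⁅z, g.1 (v x)⁆ = g.1 ⁅z, v x⁆ := by
          have r1 := rep_comp (LieAlgebra.ad F L z) hr (hA g hg) x
          have r2 := rep_comp g.1.toLinearMap (hA g hg) hr x
          have : iot n M * tens (A g) = tens (A g) * iot n M := by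
            rw [iot_tens, tens_iot, hMc g hg]
          rw [this] at r1
          exact r1.trans r2.symm
        have e3 : ⁅(g⁻¹).1 z, v x⁆ = ⁅z, v x⁆ := by
          apply g.1.injective
          rw [g.2, aut_inv_apply, e2]
        rw [sub_lie, e3, sub_self]
    have e4 := sub_eq_zero.mp e1
    nth_rewrite 1 [← e4]
    rw [aut_inv_apply]
  have hz0 : z = 0 := fixed_zero (fun x h => ad_inj x h) hQ hfix
  subst hz0
  apply hM0
  apply iot_inj n
  rw [map_zero]
  refine rep_unique hv hr ?_
  intro x
  simp

theorem pairing [IsAlgClosed F] {G : Gen F L} {ζ : F} (hζ : IsPrimitiveRoot ζ 6) {θ : lieAut F L} (hθ : G.IsStd ζ θ)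
    {v : Ix dd → L} (hv : G.IsBas v) {Q : Subgroup (lieAut F L)} (hQ : IsMaximalFiniteAbelian Q) (hθQ : θ ∈ Q) :
    ∃ (A : lieAut F L → ∀ n, Mt F dd n) (c : lieAut F L → lieAut F L → Fin 3 → F),
      (∀ g ∈ Q, (∀ n, (A g n).det ≠ 0) ∧ Rep v g.1 (tens (A g))) ∧
      (∀ g ∈ Q, ∀ h ∈ Q, ∀ n, A g n * A h n = c g h n • (A h n * A g n)) ∧
      (∀ g ∈ Q, ∀ g' ∈ Q, ∀ h ∈ Q, ∀ n, c (g * g') h n = c g h n * c g' h n) ∧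
      (∀ g ∈ Q, ∀ h ∈ Q, ∀ n, c g h n * c h g n = 1) ∧
      (∀ g ∈ Q, ∀ n, c g g n = 1) ∧
      (∀ g ∈ Q, ∀ h ∈ Q, ∏ n, c g h n = 1) ∧
      (∀ g ∈ Q, ∀ h ∈ Q, ∀ n, c g h n ^ dd n = 1) ∧
      (∀ n, ∃ g ∈ Q, ∃ h ∈ Q, c g h n ≠ 1) := by
  have h1 : ∀ g : lieAut F L, ∃ A : ∀ n, Mt F dd n, g ∈ Q → (∀ n, (A n).det ≠ 0) ∧ Rep v g.1 (tens A) := by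
    intro g
    by_cases hg : g ∈ Q
    · obtain ⟨A, h⟩ := rep_tens hζ hθ hv (hQ.2.1 g θ hg hθQ)
      exact ⟨A, fun _ => h⟩
    · exact ⟨fun n => 0, fun h => absurd h hg⟩
  choose A hA using h1
  have hdet : ∀ g ∈ Q, ∀ h ∈ Q, ∀ n, (A g n * A h n).det ≠ 0 := by
    intro g hg h hh n
    rw [Matrix.det_mul]
    exact mul_ne_zero ((hA g hg).1 n) ((hA h hh).1 n)
  have h2 : ∀ g h : lieAut F L, ∃ c : Fin 3 → F, g ∈ Q → h ∈ Q → (∀ n, A g n * A h n = c n • (A h n * A g n)) ∧ ∏ n, c n = 1 := by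
    intro g h
    by_cases hg : g ∈ Q ∧ h ∈ Q
    · obtain ⟨hg, hh⟩ := hg
      have r1 := rep_mul (hA g hg).2 (hA h hh).2
      have r2 := rep_mul (hA h hh).2 (hA g hg).2
      rw [hQ.2.1 g h hg hh] at r1
      have := rep_unique hv r1 r2
      rw [tens_mul, tens_mul] at this
      obtain ⟨c, hc⟩ := tens_eq (fun n => exists_ne_of_det (hdet g hg h hh n)) this
      exact ⟨c, fun _ _ => hc⟩
    · exact ⟨fun _ => 1, fun a b => absurd ⟨a, b⟩ hg⟩
  choose c hc using h2
  refine ⟨A, c, fun g hg => hA g hg, fun g hg h hh => (hc g h hg hh).1, ?_, ?_, ?_, fun g hg h hh => (hc g h hg hh).2, ?_, ?_⟩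
  · intro g hg g' hg' h hh n
    obtain ⟨s, hs⟩ : ∃ s : F, A g n * A g' n = s • A (g * g') n := by
      have r1 := rep_mul (hA g hg).2 (hA g' hg').2
      have := rep_unique hv r1 (hA (g * g') (Q.mul_mem hg hg')).2
      rw [tens_mul] at this
      obtain ⟨s, hs, _⟩ := tens_eq (fun n => exists_ne_of_det (hdet g hg g' hg' n)) this
      exact ⟨s n, hs n⟩
    have hs0 : s ≠ 0 := by
      rintro rfl
      have := hdet g hg g' hg' n
      rw [hs, zero_smul, Matrix.det_zero] at this
      exact this rfl
    have e1 : A g n * A g' n * A h n = (c g h n * c g' h n) • (A h n * (A g n * A g' n)) := by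
      rw [mul_assoc, (hc g' h hg' hh).1 n, mul_smul_comm, ← mul_assoc, (hc g h hg hh).1 n, smul_mul_assoc, smul_smul, mul_assoc, mul_comm (c g h n)]
    rw [hs, smul_mul_assoc, (hc (g * g') h (Q.mul_mem hg hg') hh).1 n, mul_smul_comm, smul_smul, smul_smul] at e1
    have := smul_cancel (hdet h hh (g * g') (Q.mul_mem hg hg') n) e1
    exact mul_left_cancel₀ hs0 (this.trans (mul_comm _ _))
  · intro g hg h hh n
    apply smul_cancel (hdet g hg h hh n)
    rw [mul_smul, ← (hc h g hh hg).1 n, ← (hc g h hg hh).1 n, one_smul]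
  · intro g hg n
    apply smul_cancel (hdet g hg g hg n)
    rw [← (hc g g hg hg).1 n, one_smul]
  · intro g hg h hh n
    have := congrArg Matrix.det ((hc g h hg hh).1 n)
    rw [Matrix.det_smul, Matrix.det_mul, Matrix.det_mul, Fintype.card_fin, mul_comm (A h n).det] at this
    have h0 : (A g n).det * (A h n).det ≠ 0 := mul_ne_zero ((hA g hg).1 n) ((hA h hh).1 n)
    exact mul_right_cancel₀ h0 (this.symm.trans (one_mul _).symm)
  · intro n
    obtain ⟨x, hx, y, hy, hne⟩ := noncomm hζ hθ hv hQ hθQ (fun g hg => (hA g hg).2) n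
    refine ⟨x, hx, y, hy, fun h => hne ?_⟩
    rw [(hc x y hx hy).1 n, h, one_smul]

end Gen
end
end E8

namespace E8

section
variable {F L : Type} [Field F] [LieRing L] [LieAlgebra F L] [CharZero F] [Nontrivial L]

/-- elements of order dividing two and three with product one -/
theorem coprime_one {a b c : F} (h : a * b * c = 1) (ha : a = 1) (hb : b ^ 3 = 1) (hc : c ^ 2 = 1) : b = 1 ∧ c = 1 := by
  subst ha
  rw [one_mul] at h
  have h2 : b ^ 2 = 1 := by
    have : b ^ 2 * c ^ 2 = 1 := by rw [← mul_pow, h, one_pow]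
    rwa [hc, mul_one] at this
  have hb1 : b = 1 := by
    have : b ^ 3 = b ^ 2 * b := pow_succ b 2
    rw [hb, h2, one_mul] at this
    exact this.symm
  exact ⟨hb1, by rw [hb1, one_mul] at h; exact h⟩

theorem root_cases {ζ : F} (hζ : IsPrimitiveRoot ζ 6) {b c : F} (hb : b ^ 3 = 1) (hb1 : b ≠ 1) (hc : c ^ 2 = 1) (hc1 : c ≠ 1) :
    (b = ζ ^ 2 ∨ b = ζ ^ 4) ∧ c = ζ ^ 3 := by
  have h3 : IsPrimitiveRoot (ζ ^ 2) 3 := hζ.pow (by norm_num) (by norm_num)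
  have h2 : IsPrimitiveRoot (ζ ^ 3) 2 := hζ.pow (by norm_num) (by norm_num)
  obtain ⟨i, hi, rfl⟩ := h3.eq_pow_of_pow_eq_one hb
  obtain ⟨j, hj, rfl⟩ := h2.eq_pow_of_pow_eq_one hc
  refine ⟨?_, ?_⟩
  · interval_cases i
    · exact absurd (pow_zero _) hb1
    · left; rw [pow_one]
    · right; rw [← pow_mul]
  · interval_cases j
    · exact absurd (pow_zero _) hc1
    · rw [pow_one]

namespace Gen

theorem pair_core {Q : Type*} [CommGroup Q] {ζ : F} (hζ : IsPrimitiveRoot ζ 6) (c : Q → Q → Fin 3 → F)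
    (hm : ∀ g g' h n, c (g * g') h n = c g h n * c g' h n) (hi : ∀ g h n, c g h n * c h g n = 1)
    (hs : ∀ g n, c g g n = 1) (hp : ∀ g h, ∏ n, c g h n = 1) (hd : ∀ g h n, c g h n ^ dd n = 1)
    (hn : ∀ n, ∃ g h, c g h n ≠ 1) :
    ∃ x y : Q, (∀ n, c x y n = ζ ^ (n.val + 1)) ∧
      ∀ g, ∃ a b : ℕ, ∀ n, c (g * y ^ a * x ^ b) x n = 1 ∧ c (g * y ^ a * x ^ b) y n = 1 := by
  have hne : ∀ g h n, c g h n ≠ 0 := fun g h n h0 => by have := hi g h n; rw [h0, zero_mul] at this; exact zero_ne_one this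
  have h1 : ∀ h n, c 1 h n = 1 := by
    intro h n
    have := hm 1 1 h n
    rw [mul_one] at this
    exact mul_right_cancel₀ (hne 1 h n) (this.symm.trans (one_mul _).symm)
  have hpow : ∀ g h n (k : ℕ), c (g ^ k) h n = c g h n ^ k := by
    intro g h n k
    induction k with
    | zero => rw [pow_zero, pow_zero, h1]
    | succ k ih => rw [pow_succ, pow_succ, hm, ih]
  have hinv : ∀ g h n, c h g n = (c g h n)⁻¹ := fun g h n => (inv_eq_of_mul_eq_one_right (hi g h n)).symm
  have hm' : ∀ g h h' n, c g (h * h') n = c g h n * c g h' n := by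
    intro g h h' n
    rw [hinv (h * h') g, hm, mul_inv, ← hinv, ← hinv]
  have hpow' : ∀ g h n (k : ℕ), c g (h ^ k) n = c g h n ^ k := by
    intro g h n k
    rw [hinv (h ^ k) g, hpow, ← inv_pow, ← hinv]
  have hd0 : ∀ g h, c g h 0 ^ 6 = 1 := fun g h => hd g h 0
  have hd1 : ∀ g h, c g h 1 ^ 3 = 1 := fun g h => hd g h 1
  have hd2 : ∀ g h, c g h 2 ^ 2 = 1 := fun g h => hd g h 2
  have hp3 : ∀ g h, c g h 0 * c g h 1 * c g h 2 = 1 := by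
    intro g h; rw [← Fin.prod_univ_three]; exact hp g h
  have hζ0 : ζ ≠ 0 := hζ.ne_zero (by norm_num)
  have hζ6 : ζ ^ 6 = 1 := hζ.pow_eq_one
  obtain ⟨x, y, hxy⟩ : ∃ x y : Q, ∀ n : Fin 3, c x y n = ζ ^ (n.val + 1) := by
    obtain ⟨x1, y1, n1⟩ := hn 1
    obtain ⟨x2, y2, n2⟩ := hn 2
    obtain ⟨x, hx⟩ : ∃ x, x = x1 ^ 4 * x2 ^ 3 := ⟨_, rfl⟩
    obtain ⟨y, hy⟩ : ∃ y, y = y1 ^ 4 * y2 ^ 3 := ⟨_, rfl⟩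
    have e : ∀ n, c x y n = c x1 y1 n ^ 16 * c x1 y2 n ^ 12 * c x2 y1 n ^ 12 * c x2 y2 n ^ 9 := by
      intro n
      rw [hx, hy, hm, hm', hm', hpow, hpow, hpow', hpow', hpow, hpow, hpow', hpow']
      ring
    have e1 : c x y 1 = c x1 y1 1 := by
      rw [e]
      have : ∀ a b d f : F, a ^ 16 * b ^ 12 * d ^ 12 * f ^ 9 = a * (a ^ 3) ^ 5 * (b ^ 3) ^ 4 * (d ^ 3) ^ 4 * (f ^ 3) ^ 3 := by
        intros; ring
      rw [this, hd1, hd1, hd1, hd1]; ring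
    have e2 : c x y 2 = c x2 y2 2 := by
      rw [e]
      have : ∀ a b d f : F, a ^ 16 * b ^ 12 * d ^ 12 * f ^ 9 = (a ^ 2) ^ 8 * (b ^ 2) ^ 6 * (d ^ 2) ^ 6 * (f ^ 2) ^ 4 * f := by
        intros; ring
      rw [this, hd2, hd2, hd2, hd2]; ring
    have key : ∀ x y : Q, c x y 1 = ζ ^ 2 → c x y 2 = ζ ^ 3 → ∀ n : Fin 3, c x y n = ζ ^ (n.val + 1) := by
      intro x y k1 k2 n
      fin_cases n
      · have := hp3 x y
        rw [k1, k2, mul_assoc, ← pow_add] at this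
        show c x y 0 = ζ ^ (0 + 1)
        have h5 : ζ ^ (0 + 1) * ζ ^ (2 + 3) = 1 := by rw [← pow_add]; exact hζ6
        exact mul_right_cancel₀ (pow_ne_zero _ hζ0) (this.trans h5.symm)
      · exact k1
      · exact k2
    obtain ⟨hb, hc⟩ := root_cases hζ (hd1 x y) (by rw [e1]; exact n1) (hd2 x y) (by rw [e2]; exact n2)
    rcases hb with hb | hb
    · exact ⟨x, y, key x y hb hc⟩
    · refine ⟨y, x, key y x ?_ ?_⟩
      · rw [hinv x y, hb]
        apply inv_eq_of_mul_eq_one_right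
        rw [← pow_add]; exact hζ6
      · rw [hinv x y, hc]
        apply inv_eq_of_mul_eq_one_right
        rw [← pow_add]; exact hζ6
  refine ⟨x, y, hxy, fun g => ?_⟩
  obtain ⟨a, _, ha⟩ := hζ.eq_pow_of_pow_eq_one (hd0 g x)
  obtain ⟨b, _, hb⟩ := hζ.eq_pow_of_pow_eq_one (hd0 g y)
  have hxy0 : c x y 0 = ζ := by rw [hxy 0]; simp
  have k1 : c (g * y ^ a * x ^ (5 * b)) x 0 = 1 := by
    rw [hm, hm, hpow, hpow, hs, ← ha, hinv x y, hxy0, one_pow, mul_one, ← mul_pow, mul_inv_cancel₀ hζ0, one_pow]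
  have k2 : c (g * y ^ a * x ^ (5 * b)) y 0 = 1 := by
    rw [hm, hm, hpow, hpow, hs, ← hb, hxy0, one_pow, mul_one, ← pow_add, show b + 5 * b = 6 * b by ring, pow_mul, hζ6, one_pow]
  refine ⟨a, 5 * b, fun n => ?_⟩
  have l1 := coprime_one (hp3 _ _) k1 (hd1 _ _) (hd2 _ _)
  have l2 := coprime_one (hp3 _ _) k2 (hd1 _ _) (hd2 _ _)
  fin_cases n
  · exact ⟨k1, k2⟩
  · exact ⟨l1.1, l2.1⟩
  · exact ⟨l1.2, l2.2⟩

theorem prim_dd {ζ : F} (hζ : IsPrimitiveRoot ζ 6) (n : Fin 3) : IsPrimitiveRoot (ζ ^ (n.val + 1)) (dd n) := by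
  fin_cases n
  · show IsPrimitiveRoot (ζ ^ (0 + 1)) 6
    rw [zero_add, pow_one]; exact hζ
  · show IsPrimitiveRoot (ζ ^ 2) 3
    exact hζ.pow (by norm_num) (by norm_num)
  · show IsPrimitiveRoot (ζ ^ 3) 2
    exact hζ.pow (by norm_num) (by norm_num)

theorem structure_thm [IsAlgClosed F] {G : Gen F L} {ζ : F} (hζ : IsPrimitiveRoot ζ 6) {θ : lieAut F L} (hθ : G.IsStd ζ θ)
    {v : Ix dd → L} (hv : G.IsBas v) {Q : Subgroup (lieAut F L)} (hQ : IsMaximalFiniteAbelian Q) (hθQ : θ ∈ Q) :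
    ∃ x ∈ Q, ∃ y ∈ Q, ∃ A B : ∀ n, Mt F dd n, (∀ n, (A n).det ≠ 0) ∧ (∀ n, (B n).det ≠ 0) ∧ Rep v x.1 (tens A) ∧
      Rep v y.1 (tens B) ∧ (∀ n, A n * B n = ζ ^ (n.val + 1) • (B n * A n)) ∧
      ∀ K : Subgroup (lieAut F L), θ ∈ K → x ∈ K → y ∈ K → Q ≤ K := by
  obtain ⟨A, c, hA, hc, hm, hi, hs, hp, hd, hn⟩ := pairing hζ hθ hv hQ hθQ
  letI : CommGroup Q := { (inferInstance : Group Q) with mul_comm := fun a b => Subtype.ext (hQ.2.1 a b a.2 b.2) }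
  obtain ⟨x, y, hxy, hg⟩ := pair_core (Q := Q) hζ (fun g h n => c g h n) (fun g g' h n => hm g g.2 g' g'.2 h h.2 n)
    (fun g h n => hi g g.2 h h.2 n) (fun g n => hs g g.2 n) (fun g h => hp g g.2 h h.2) (fun g h n => hd g g.2 h h.2 n)
    (fun n => by obtain ⟨g, hg, h, hh, hne⟩ := hn n; exact ⟨⟨g, hg⟩, ⟨h, hh⟩, hne⟩)
  have hrel : ∀ n, A x n * A y n = ζ ^ (n.val + 1) • (A y n * A x n) := by
    intro n; rw [hc x x.2 y y.2 n, hxy n]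
  refine ⟨x, x.2, y, y.2, A x, A y, (hA x x.2).1, (hA y y.2).1, (hA x x.2).2, (hA y y.2).2, hrel, ?_⟩
  intro K h1 h2 h3 g hgQ
  obtain ⟨a, b, hab⟩ := hg ⟨g, hgQ⟩
  obtain ⟨w, hw⟩ : ∃ w : Q, w = ⟨g, hgQ⟩ * y ^ a * x ^ b := ⟨_, rfl⟩
  rw [← hw] at hab
  obtain ⟨j, hj⟩ := rep_scalar_one hζ hθ hv (hQ.2.1 w θ w.2 hθQ) (hA w w.2).2 (fun n => by
    refine pair_comm (prim_dd hζ n) ((hA x x.2).1 n) ((hA y y.2).1 n) (hrel n) ?_ ?_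
    · rw [hc w w.2 x x.2 n, (hab n).1, one_smul]
    · rw [hc w w.2 y y.2 n, (hab n).2, one_smul])
  have e : (w : lieAut F L) = g * (y : lieAut F L) ^ a * (x : lieAut F L) ^ b := by rw [hw]; rfl
  have e2 : g = θ ^ j * ((x : lieAut F L) ^ b)⁻¹ * ((y : lieAut F L) ^ a)⁻¹ := by
    rw [← hj, e]; group
  rw [e2]
  exact K.mul_mem (K.mul_mem (K.pow_mem h1 _) (K.inv_mem (K.pow_mem h2 _))) (K.inv_mem (K.pow_mem h3 _))

theorem main_std [IsAlgClosed F] {G : Gen F L} {ζ : F} (hζ : IsPrimitiveRoot ζ 6) {θ : lieAut F L} (hθ : G.IsStd ζ θ)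
    {Q₁ Q₂ : Subgroup (lieAut F L)} (hQ₁ : IsMaximalFiniteAbelian Q₁) (hQ₂ : IsMaximalFiniteAbelian Q₂)
    (h₁ : θ ∈ Q₁) (h₂ : θ ∈ Q₂) : ∃ g : lieAut F L, Q₂ = Q₁.map (MulAut.conj g).toMonoidHom := by
  obtain ⟨v, hv⟩ := G.exists_bas
  obtain ⟨x, hx, y, hy, A, B, hA, hB, rx, ry, hAB, -⟩ := structure_thm hζ hθ hv hQ₁ h₁
  obtain ⟨x', hx', y', hy', A', B', hA', hB', rx', ry', hAB', hK⟩ := structure_thm hζ hθ hv hQ₂ h₂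
  have hP : ∀ n, ∃ (P : Mt F dd n) (s t : F), P.det ≠ 0 ∧ P * A n = s • (A' n * P) ∧ P * B n = t • (B' n * P) :=
    fun n => pair_conj (prim_dd hζ n) (hA n) (hB n) (hAB n) (hA' n) (hB' n) (hAB' n)
  choose P s t hPd hPA hPB using hP
  obtain ⟨h, hh, r, hr0, hr⟩ := re_tens hζ hθ hv P hPd
  have key : ∀ {x x' : lieAut F L} {A A' : ∀ n, Mt F dd n} {s : Fin 3 → F}, x ∈ Q₁ → x' ∈ Q₂ → Rep v x.1 (tens A) → Rep v x'.1 (tens A') →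
      (∀ n, P n * A n = s n • (A' n * P n)) → x' ∈ Q₁.map (MulAut.conj h).toMonoidHom := by
    intro x x' A A' s hx hx' rx rx' hPA
    have r1 := rep_mul hr rx
    have r2 := rep_mul rx' hr
    have e : (r • tens P) * tens A = (∏ n, s n) • (tens A' * (r • tens P)) := by
      rw [smul_mul_assoc, mul_smul_comm, tens_mul, tens_mul, smul_comm, ← tens_smul]
      congr 2
      funext n
      exact hPA n
    rw [e] at r1
    have cx : x * θ = θ * x := hQ₁.2.1 x θ hx h₁
    have cx' : x' * θ = θ * x' := hQ₂.2.1 x' θ hx' h₂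
    have c1 : Commute (h * x) θ := Commute.mul_left hh cx
    have c2 : Commute (x' * h) θ := Commute.mul_left cx' hh
    obtain ⟨j, hj⟩ := scal_conj hζ hθ hv c2.eq c1.eq r2 r1
    refine Subgroup.mem_map.mpr ⟨x * (θ ^ j)⁻¹, Q₁.mul_mem hx (Q₁.inv_mem (Q₁.pow_mem h₁ _)), ?_⟩
    show h * (x * (θ ^ j)⁻¹) * h⁻¹ = x'
    rw [← mul_assoc, hj]
    group
  have hle := hK (Q₁.map (MulAut.conj h).toMonoidHom) (Subgroup.mem_map.mpr ⟨θ, h₁, by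
    show h * θ * h⁻¹ = θ
    rw [hh, mul_inv_cancel_right]⟩) (key hx hx' rx rx' hPA) (key hy hy' ry ry' hPB)
  exact ⟨h, (hQ₂.2.2 _ (maxab_conj hQ₁ h).2.1 hle).symm⟩

theorem main [IsAlgClosed F] (G : Gen F L)
    {Q₁ Q₂ : Subgroup (lieAut F L)} (hQ₁ : IsMaximalFiniteAbelian Q₁) (hQ₂ : IsMaximalFiniteAbelian Q₂)
    (h₁ : ∃ θ ∈ Q₁, orderOf θ = 6) (h₂ : ∃ θ ∈ Q₂, orderOf θ = 6) : SubgroupIsConj Q₁ Q₂ := by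
  obtain ⟨ζ, hζ⟩ := HasEnoughRootsOfUnity.exists_primitiveRoot F 6
  obtain ⟨θ₁, hθ₁, o₁⟩ := h₁
  obtain ⟨θ₂, hθ₂, o₂⟩ := h₂
  obtain ⟨g₁, τ₁, hτ₁, s₁⟩ := step_std G hQ₁ hθ₁ o₁ hζ
  obtain ⟨g₂, τ₂, hτ₂, s₂⟩ := step_std G hQ₂ hθ₂ o₂ hζ
  have e : τ₁ = τ₂ := by
    apply aut_ext
    refine G.W_ind ?_ ?_ ?_
    · intro l y hy; rw [s₁ l y hy, s₂ l y hy]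
    · simp
    · intro a b ha hb; rw [map_add, map_add, ha, hb]
  subst e
  obtain ⟨h, hh⟩ := main_std hζ s₁ (maxab_conj hQ₁ g₁) (maxab_conj hQ₂ g₂) hτ₁ hτ₂
  refine ⟨g₂⁻¹ * (h * g₁), ?_⟩
  have hc : ∀ (Q : Subgroup (lieAut F L)) (a b : lieAut F L), (Q.map (MulAut.conj a).toMonoidHom).map (MulAut.conj b).toMonoidHom
      = Q.map (MulAut.conj (b * a)).toMonoidHom := by
    intro Q a b
    rw [Subgroup.map_map]
    congr 1
  have h1 := congrArg (fun Q => Subgroup.map (MulAut.conj g₂⁻¹).toMonoidHom Q) hh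
  simp only [hc] at h1
  rw [inv_mul_cancel] at h1
  have h2 : Q₂.map (MulAut.conj (1 : lieAut F L)).toMonoidHom = Q₂ := by
    rw [map_one]
    exact Subgroup.map_id Q₂
  rw [h2] at h1
  exact h1

end Gen
end
end E8

namespace E8

section
variable (F : Type) [Field F]

/-- projection from the free Lie algebra -/
noncomputable def prj : FreeLieAlgebra F (CartanMatrix.Generators (Fin 8)) →ₗ⁅F⁆ LieAlgebra.e₈ F where
  toFun u := (LieSubmodule.Quotient.mk u : FreeLieAlgebra F (CartanMatrix.Generators (Fin 8)) ⧸ CartanMatrix.Relations.toIdeal F CartanMatrix.E₈)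
  map_add' _ _ := rfl
  map_smul' _ _ := rfl
  map_lie' := rfl

theorem prj_surj : Function.Surjective (prj F) := fun y => by
  obtain ⟨u, hu⟩ := LieSubmodule.Quotient.surjective_mk' (CartanMatrix.Relations.toIdeal F CartanMatrix.E₈) y
  exact ⟨u, hu⟩

theorem prj_rel {u : FreeLieAlgebra F (CartanMatrix.Generators (Fin 8))} (h : u ∈ CartanMatrix.Relations.toSet F CartanMatrix.E₈) :
    prj F u = 0 := by
  have : u ∈ CartanMatrix.Relations.toIdeal F CartanMatrix.E₈ := LieSubmodule.subset_lieSpan h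
  exact (LieSubmodule.Quotient.mk_eq_zero _).mpr this

theorem free_gen {R X : Type} [CommRing R] (K : LieSubalgebra R (FreeLieAlgebra R X)) (h : ∀ x, FreeLieAlgebra.of R x ∈ K)
    (u : FreeLieAlgebra R X) : u ∈ K := by
  have e : K.incl.comp (FreeLieAlgebra.lift R (fun x => (⟨FreeLieAlgebra.of R x, h x⟩ : K))) = LieHom.id := by
    apply FreeLieAlgebra.hom_ext
    intro x
    simp
  have := LieHom.congr_fun e u
  rw [LieHom.id_apply] at this
  rw [← this]
  exact (FreeLieAlgebra.lift R (fun x => (⟨FreeLieAlgebra.of R x, h x⟩ : K)) u).2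

theorem E8_off : ∀ i j : Fin 8, i ≠ j → CartanMatrix.E₈ i j = 0 ∨ CartanMatrix.E₈ i j = -1 := fun i j h => CartanMatrix.isSimplyLaced_E₈ h

/-- the standard generators -/
noncomputable def stdGen : Gen F (LieAlgebra.e₈ F) := by
  have hHH : ∀ i j : Fin 8, ⁅prj F (.of F (.H i)), prj F (.of F (.H j))⁆ = 0 := fun i j => by
    rw [← LieHom.map_lie]
    exact prj_rel F (Or.inl (Or.inl (Or.inl (Or.inl (Or.inl ⟨(i, j), rfl⟩)))))
  have hEF : ∀ i : Fin 8, ⁅prj F (.of F (.E i)), prj F (.of F (.F i))⁆ = prj F (.of F (.H i)) := fun i => by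
    rw [← LieHom.map_lie, ← sub_eq_zero, ← map_sub]
    refine prj_rel F (Or.inl (Or.inl (Or.inl (Or.inl (Or.inr ⟨(i, i), ?_⟩)))))
    simp [CartanMatrix.Relations.EF]
  have hEF' : ∀ i j : Fin 8, i ≠ j → ⁅prj F (.of F (.E i)), prj F (.of F (.F j))⁆ = 0 := fun i j hij => by
    rw [← LieHom.map_lie]
    refine prj_rel F (Or.inl (Or.inl (Or.inl (Or.inl (Or.inr ⟨(i, j), ?_⟩)))))
    simp [CartanMatrix.Relations.EF, hij]
  have hHE : ∀ i j : Fin 8, ⁅prj F (.of F (.H i)), prj F (.of F (.E j))⁆ = ((CartanMatrix.E₈ i j : ℤ) : F) • prj F (.of F (.E j)) := fun i j => by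
    rw [← LieHom.map_lie, ← sub_eq_zero, Int.cast_smul_eq_zsmul, ← map_zsmul, ← map_sub]
    refine prj_rel F (Or.inl (Or.inl (Or.inl (Or.inr ⟨(i, j), rfl⟩))))
  have hHF : ∀ i j : Fin 8, ⁅prj F (.of F (.H i)), prj F (.of F (.F j))⁆ = -((CartanMatrix.E₈ i j : ℤ) : F) • prj F (.of F (.F j)) := fun i j => by
    rw [neg_smul, ← LieHom.map_lie, ← sub_eq_zero, sub_neg_eq_add, Int.cast_smul_eq_zsmul, ← map_zsmul, ← map_add]
    refine prj_rel F (Or.inl (Or.inl (Or.inr ⟨(i, j), rfl⟩)))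
  have hE : ∀ i j : Fin 8, i ≠ j → ⁅prj F (.of F (.E i)), ⁅prj F (.of F (.E i)), prj F (.of F (.E j))⁆⁆ = 0 := fun i j hij => by
    have := prj_rel F (u := CartanMatrix.Relations.adE F CartanMatrix.E₈ (i, j)) (Or.inl (Or.inr ⟨(i, j), rfl⟩))
    rcases E8_off i j hij with h | h
    · simp only [CartanMatrix.Relations.adE, Function.uncurry, h, Function.comp] at this
      simp at this
      rw [this, lie_zero]
    · simp only [CartanMatrix.Relations.adE, Function.uncurry, h, Function.comp] at this
      simpa using this
  have hF : ∀ i j : Fin 8, i ≠ j → ⁅prj F (.of F (.F i)), ⁅prj F (.of F (.F i)), prj F (.of F (.F j))⁆⁆ = 0 := fun i j hij => by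
    have := prj_rel F (u := CartanMatrix.Relations.adF F CartanMatrix.E₈ (i, j)) (Or.inr ⟨(i, j), rfl⟩)
    rcases E8_off i j hij with h | h
    · simp only [CartanMatrix.Relations.adF, Function.uncurry, h, Function.comp] at this
      simp at this
      rw [this, lie_zero]
    · simp only [CartanMatrix.Relations.adF, Function.uncurry, h, Function.comp] at this
      simpa using this
  refine ⟨fun i => prj F (.of F (.E i)), fun i => prj F (.of F (.F i)), fun i => prj F (.of F (.H i)), hHH, hEF, hEF', hHE, hHF, hE, hF, ?_⟩
  rw [eq_top_iff]
  intro y _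
  obtain ⟨u, rfl⟩ := prj_surj F y
  have he : ∀ i, prj F (.of F (.E i)) ∈ LieSubalgebra.lieSpan F (LieAlgebra.e₈ F) (Set.range (fun i : Fin 8 => prj F (.of F (.E i))) ∪ Set.range (fun i : Fin 8 => prj F (.of F (.F i)))) :=
    fun i => LieSubalgebra.subset_lieSpan (Or.inl ⟨i, rfl⟩)
  have hf : ∀ i, prj F (.of F (.F i)) ∈ LieSubalgebra.lieSpan F (LieAlgebra.e₈ F) (Set.range (fun i : Fin 8 => prj F (.of F (.E i))) ∪ Set.range (fun i : Fin 8 => prj F (.of F (.F i)))) :=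
    fun i => LieSubalgebra.subset_lieSpan (Or.inr ⟨i, rfl⟩)
  refine free_gen ((LieSubalgebra.lieSpan F (LieAlgebra.e₈ F) (Set.range (fun i : Fin 8 => prj F (.of F (.E i))) ∪ Set.range (fun i : Fin 8 => prj F (.of F (.F i))))).comap (prj F)) ?_ u
  intro x
  rw [LieSubalgebra.mem_comap]
  cases x with
  | E i => exact he i
  | F i => exact hf i
  | H i =>
    rw [← hEF i]
    exact LieSubalgebra.lie_mem _ (he i) (hf i)

end
end E8

theorem stmt6 (F : Type) [Field F] [IsAlgClosed F] [CharZero F]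
    (Q₁ Q₂ : Subgroup ↥(lieAut F (LieAlgebra.e₈ F)))
    (hQ₁ : IsMaximalFiniteAbelian Q₁) (hQ₂ : IsMaximalFiniteAbelian Q₂)
    (h₁ : ∃ θ ∈ Q₁, orderOf θ = 6) (h₂ : ∃ θ ∈ Q₂, orderOf θ = 6) :
    SubgroupIsConj Q₁ Q₂ := by
  have hnt : Nontrivial (LieAlgebra.e₈ F) := by
    by_contra hn
    rw [not_nontrivial_iff_subsingleton] at hn
    obtain ⟨θ, -, ho⟩ := h₁
    have : θ = 1 := Subtype.ext (LinearEquiv.ext fun x => Subsingleton.elim _ _)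
    rw [this, orderOf_one] at ho
    norm_num at ho
  exact (E8.stdGen F).main hQ₁ hQ₂ h₁ h₂
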